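/- arXiv:1806.08559 — 2 statements merged into one kernel-verified Lean document; each statement's English description precedes it below -/
import Mathlib

section
/- Let Ω be a bounded open set in ℝ^N which, for every i = 1,…,N, is convex in the x_i direction (if two points of Ω differ only in the i-th coordinate, the segment joining them lies in Ω) and symmetric with respect to the hyperplane {x_i = 0} (x ∈ Ω implies the reflection of x in that hyperplane is in Ω), with 0 ∈ Ω. Let u ∈ C²(Ω) ∩ C(Ω̄) satisfy -Δu = f(u) in Ω, u > 0 in Ω and u = 0 on ∂Ω, where f is C¹. Then the Hessian matrix of u at the origin is diagonal and strictly negative definite: ∂²u/∂x_i∂x_j(0) = 0 for all i ≠ j and ∂²u/∂x_i²(0) < 0 for all i. -/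
open Filter Metric Set

/-- Second partial derivative `∂²u/∂x_i∂x_j` of `u : ℝ^N → ℝ`. -/
noncomputable def psec {N : ℕ} (u : EuclideanSpace ℝ (Fin N) → ℝ) (i j : Fin N)
    (x : EuclideanSpace ℝ (Fin N)) : ℝ :=
  fderiv ℝ (fun y => fderiv ℝ u y (EuclideanSpace.single j 1)) x (EuclideanSpace.single i 1)

namespace GNN

/-- Euclidean space. -/
abbrev E (N : ℕ) := EuclideanSpace ℝ (Fin N)

/-- basis vector -/
noncomputable abbrev e {N : ℕ} (i : Fin N) : E N := EuclideanSpace.single i (1 : ℝ)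

/-- Laplacian through one-variable second derivatives along coordinate lines. -/
noncomputable def lap {N : ℕ} (u : E N → ℝ) (x : E N) : ℝ :=
  ∑ i : Fin N, iteratedDeriv 2 (fun t : ℝ => u (x + t • e i)) 0

lemma line_contDiffAt {N : ℕ} {u : E N → ℝ} {x : E N} (h : ContDiffAt ℝ 2 u x) (i : Fin N) :
    ContDiffAt ℝ 2 (fun t : ℝ => u (x + t • e i)) 0 := by
  have h1 : ContDiffAt ℝ 2 (fun t : ℝ => x + t • e i) 0 := by fun_prop
  have h2 : ContDiffAt ℝ 2 u (x + (0 : ℝ) • e i) := by simpa using h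
  exact ContDiffAt.comp (0 : ℝ) (g := u) h2 h1

lemma lap_sub {N : ℕ} {u v : E N → ℝ} {x : E N} (hu : ContDiffAt ℝ 2 u x)
    (hv : ContDiffAt ℝ 2 v x) : lap (fun y => u y - v y) x = lap u x - lap v x := by
  unfold lap
  rw [← Finset.sum_sub_distrib]
  refine Finset.sum_congr rfl fun i _ => ?_
  exact iteratedDeriv_fun_sub (by exact_mod_cast line_contDiffAt hu i)
    (by exact_mod_cast line_contDiffAt hv i)

lemma lap_const_mul {N : ℕ} {u : E N → ℝ} {x : E N} (c : ℝ) (hu : ContDiffAt ℝ 2 u x) :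
    lap (fun y => c * u y) x = c * lap u x := by
  unfold lap
  rw [Finset.mul_sum]
  refine Finset.sum_congr rfl fun i _ => ?_
  exact iteratedDeriv_const_mul c (by exact_mod_cast line_contDiffAt hu i)

lemma second_deriv_nonpos {g : ℝ → ℝ} (hg : ContinuousAt g 0) (hm : IsLocalMax g 0) :
    iteratedDeriv 2 g 0 ≤ 0 := by
  by_contra! hpos
  have h2 : iteratedDeriv 2 g 0 = deriv (deriv g) 0 := by
    rw [iteratedDeriv_succ, iteratedDeriv_one]
  have hmin := isLocalMin_of_deriv_deriv_pos (f := g) (x₀ := 0) (by rw [← h2]; exact hpos)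
    hm.deriv_eq_zero hg
  have heq : g =ᶠ[nhds 0] fun _ => g 0 := by
    filter_upwards [hm, hmin] with t h1 h2 using le_antisymm h1 h2
  have := heq.iteratedDeriv_eq 2
  rw [this] at hpos
  simp [iteratedDeriv_const] at hpos

lemma lap_nonpos {N : ℕ} {u : E N → ℝ} {x : E N} (hu : ContinuousAt u x)
    (hm : IsLocalMax u x) : lap u x ≤ 0 := by
  refine Finset.sum_nonpos fun i _ => ?_
  have hc : ContinuousAt (fun t : ℝ => x + t • e i) 0 := by fun_prop
  have h0 : x + (0 : ℝ) • e i = x := by simp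
  refine second_deriv_nonpos ?_ ?_
  · exact ContinuousAt.comp (g := u) (by rw [h0]; exact hu) hc
  · have : Tendsto (fun t : ℝ => x + t • e i) (nhds 0) (nhds x) := by
      have := hc.tendsto; rwa [h0] at this
    have h3 := this.eventually hm
    filter_upwards [h3] with t ht
    simpa using ht

/-- maximum principle in the form used below -/
lemma max_principle {N : ℕ} {C : Set (E N)} (hC : IsCompact C) {ψ : E N → ℝ} {m : ℝ}
    (hψ : ContinuousOn ψ C)
    (h : ∀ x ∈ C, m < ψ x → C ∈ nhds x ∧ 0 < lap ψ x) : ∀ x ∈ C, ψ x ≤ m := by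
  intro x hx
  obtain ⟨z, hz, hmax⟩ := hC.exists_isMaxOn ⟨x, hx⟩ hψ
  by_contra! hlt
  have hz1 : m < ψ z := lt_of_lt_of_le hlt (hmax hx)
  obtain ⟨hn, hl⟩ := h z hz hz1
  have := lap_nonpos (hψ.continuousAt hn) (hmax.isLocalMax hn)
  linarith

/-- barrier -/
noncomputable def phi {N : ℕ} (α R : ℝ) (y x : E N) : ℝ :=
  Real.exp (-α * ‖x - y‖ ^ 2) - Real.exp (-α * R ^ 2)

lemma phi_contDiff {N : ℕ} (α R : ℝ) (y : E N) : ContDiff ℝ 2 (phi α R y) := by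
  unfold phi
  have : ContDiff ℝ 2 (fun x : E N => ‖x - y‖ ^ 2) := by
    exact (contDiff_id.sub contDiff_const).norm_sq ℝ
  exact ((contDiff_const.mul this).exp).sub contDiff_const

lemma second_deriv_exp (a b α c : ℝ) :
    iteratedDeriv 2 (fun t : ℝ => Real.exp (-α * (a + 2 * t * b + t ^ 2)) - c) 0
      = (4 * α ^ 2 * b ^ 2 - 2 * α) * Real.exp (-α * a) := by
  rw [iteratedDeriv_succ, iteratedDeriv_one]
  have h1 : ∀ t : ℝ, HasDerivAt (fun t : ℝ => -α * (a + 2 * t * b + t ^ 2))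
      (-α * (2 * b + 2 * t)) t := by
    intro t
    have := ((((hasDerivAt_id' t).const_mul 2).mul_const b).const_add a).add
      ((hasDerivAt_id' t).pow 2)
    exact (this.const_mul (-α)).congr_deriv (by norm_num)
  have h2 : deriv (fun t : ℝ => Real.exp (-α * (a + 2 * t * b + t ^ 2)) - c)
      = fun t => Real.exp (-α * (a + 2 * t * b + t ^ 2)) * (-α * (2 * b + 2 * t)) := by
    funext t
    exact ((h1 t).exp.sub_const c).deriv
  rw [h2]
  have h3 : HasDerivAt (fun t : ℝ => -α * (2 * b + 2 * t)) (-α * 2) 0 := by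
    have := (((hasDerivAt_id' (0 : ℝ)).const_mul 2).const_add (2 * b)).const_mul (-α)
    exact this.congr_deriv (by norm_num)
  refine ((h1 0).exp.mul h3).deriv.trans ?_
  simp
  ring

lemma lap_phi {N : ℕ} (α R : ℝ) (y x : E N) :
    lap (phi α R y) x = (4 * α ^ 2 * ‖x - y‖ ^ 2 - 2 * α * N) * Real.exp (-α * ‖x - y‖ ^ 2) := by
  unfold lap phi
  have key : ∀ i : Fin N, iteratedDeriv 2 (fun t : ℝ =>
      Real.exp (-α * ‖x + t • e i - y‖ ^ 2) - Real.exp (-α * R ^ 2)) 0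
      = (4 * α ^ 2 * ((x - y) i) ^ 2 - 2 * α) * Real.exp (-α * ‖x - y‖ ^ 2) := by
    intro i
    rw [← second_deriv_exp (‖x - y‖ ^ 2) ((x - y) i) α (Real.exp (-α * R ^ 2))]
    congr 1
    funext t
    have : ‖x + t • e i - y‖ ^ 2 = ‖x - y‖ ^ 2 + 2 * t * (x - y) i + t ^ 2 := by
      have h : x + t • e i - y = (x - y) + t • e i := by abel
      rw [h, norm_add_sq_real, norm_smul, inner_smul_right, EuclideanSpace.inner_single_right]
      simp
      ring
    rw [this]
  rw [Finset.sum_congr rfl fun i _ => key i, ← Finset.sum_mul]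
  congr 1
  rw [Finset.sum_sub_distrib, ← Finset.mul_sum, EuclideanSpace.norm_sq_eq]
  simp
  ring

lemma phi_lower {N : ℕ} {α R : ℝ} (hα : 0 ≤ α) (hR : 0 ≤ R) (y x : E N) (hx : ‖x - y‖ ≤ R) :
    Real.exp (-α * R ^ 2) * (α * R) * (R - ‖x - y‖) ≤ phi α R y x := by
  unfold phi
  set s := ‖x - y‖ with hs
  have hs0 : 0 ≤ s := norm_nonneg _
  have h1 : Real.exp (-α * s ^ 2) = Real.exp (-α * R ^ 2) * Real.exp (α * (R ^ 2 - s ^ 2)) := by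
    rw [← Real.exp_add]; congr 1; ring
  have h2 := Real.add_one_le_exp (α * (R ^ 2 - s ^ 2))
  have h3 : α * R * (R - s) ≤ α * (R ^ 2 - s ^ 2) := by
    have : 0 ≤ α * (s * (R - s)) := by
      have : 0 ≤ R - s := by linarith
      positivity
    nlinarith
  have hp := Real.exp_pos (-α * R ^ 2)
  rw [h1]
  nlinarith

lemma phi_le_exp {N : ℕ} (α R : ℝ) (y x : E N) :
    phi α R y x ≤ Real.exp (-α * ‖x - y‖ ^ 2) := by
  unfold phi
  have := Real.exp_pos (-α * R ^ 2)
  linarith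

lemma phi_le_one {N : ℕ} {α R : ℝ} (hα : 0 ≤ α) (y x : E N) : phi α R y x ≤ 1 := by
  refine (phi_le_exp α R y x).trans ?_
  rw [Real.exp_le_one_iff]
  have : 0 ≤ α * ‖x - y‖ ^ 2 := by positivity
  linarith

lemma phi_pos {N : ℕ} {α R : ℝ} (hα : 0 < α) (y x : E N) (hx : ‖x - y‖ < R) :
    0 < phi α R y x := by
  unfold phi
  rw [sub_pos, Real.exp_lt_exp]
  have : ‖x - y‖ ^ 2 < R ^ 2 := by
    have := norm_nonneg (x - y)
    nlinarith
  nlinarith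

lemma phi_boundary {N : ℕ} {α R : ℝ} (y x : E N) (hx : ‖x - y‖ = R) :
    phi α R y x = 0 := by
  unfold phi
  rw [hx, sub_self]

lemma closedBall_mem_nhds_of_lt {N : ℕ} {c x : E N} {r : ℝ} (h : ‖x - c‖ < r) :
    closedBall c r ∈ nhds x :=
  mem_of_superset (isOpen_ball.mem_nhds (by rwa [mem_ball, dist_eq_norm])) ball_subset_closedBall

/-- Quantitative Hopf lemma. -/
lemma hopf {N : ℕ} {L ρ r : ℝ} (hL : 0 ≤ L) (hρ : 0 < ρ) (hρr : ρ < r) :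
    ∃ κ : ℝ, 0 < κ ∧ ∀ (c : E N) (w : E N → ℝ) (m : ℝ), 0 < m →
      ContinuousOn w (closedBall c r) →
      (∀ x ∈ ball c r, ContDiffAt ℝ 2 w x ∧ lap w x ≤ L * w x) →
      (∀ x ∈ closedBall c r, 0 ≤ w x) →
      (∀ x ∈ closedBall c ρ, m ≤ w x) →
      ∀ x ∈ closedBall c r, ρ ≤ ‖x - c‖ → κ * m * (r - ‖x - c‖) ≤ w x := by
  set α : ℝ := 1 + (2 * N + L) / (4 * ρ ^ 2) with hα
  have hα1 : 1 ≤ α := by rw [hα]; have : 0 ≤ (2 * N + L) / (4 * ρ ^ 2) := by positivity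
                         linarith
  have hαρ : 4 * α * ρ ^ 2 = 4 * ρ ^ 2 + 2 * N + L := by
    rw [hα]; field_simp; ring
  have hr : 0 < r := hρ.trans hρr
  refine ⟨Real.exp (-α * r ^ 2) * (α * r), by positivity, ?_⟩
  intro c w m hm hwc hw hw0 hwm
  have main : ∀ x ∈ closedBall c r ∩ {x | ρ ≤ ‖x - c‖}, m * phi α r c x - w x ≤ 0 := by
    apply max_principle
    · apply (isCompact_closedBall c r).inter_right
      exact isClosed_le continuous_const (by fun_prop)
    · refine ContinuousOn.sub ?_ (hwc.mono inter_subset_left)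
      exact ((phi_contDiff α r c).continuous.const_mul m |>.continuousOn)
    · rintro x ⟨hx1, hx2⟩ hx3
      have hx2 : ρ ≤ ‖x - c‖ := hx2
      have hxr : ‖x - c‖ ≤ r := by rwa [mem_closedBall, dist_eq_norm] at hx1
      have hlt : ‖x - c‖ < r := by
        rcases hxr.lt_or_eq with h | h
        · exact h
        · rw [phi_boundary c x h] at hx3
          have := hw0 x hx1
          linarith
      have hgt : ρ < ‖x - c‖ := by
        rcases hx2.lt_or_eq with h | h
        · exact h
        · have h1 := hwm x (by rw [mem_closedBall, dist_eq_norm, ← h])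
          have h2 : phi α r c x ≤ 1 := phi_le_one (by linarith) c x
          nlinarith
      obtain ⟨hw2, hwl⟩ := hw x (by rwa [mem_ball, dist_eq_norm])
      constructor
      · refine inter_mem (closedBall_mem_nhds_of_lt hlt) ?_
        have : IsOpen {x : E N | ρ < ‖x - c‖} := isOpen_lt continuous_const (by fun_prop)
        exact mem_of_superset (this.mem_nhds hgt) fun z (hz : ρ < ‖z - c‖) => hz.le
      · have hphi := (phi_contDiff (N := N) α r c).contDiffAt (x := x)
        rw [lap_sub (contDiffAt_const.mul hphi) hw2, lap_const_mul m hphi, lap_phi]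
        have h1 := phi_le_exp α r c x
        set X := Real.exp (-α * ‖x - c‖ ^ 2) with hX
        have hXp : 0 < X := Real.exp_pos _
        have h4 : 0 < 4 * α ^ 2 * ‖x - c‖ ^ 2 - 2 * α * N - L := by
          have h5 : ρ ^ 2 ≤ ‖x - c‖ ^ 2 := by nlinarith
          have h6 : 4 * α ^ 2 * ρ ^ 2 = α * (4 * ρ ^ 2 + 2 * N + L) := by rw [← hαρ]; ring
          have h7 : 4 * α ^ 2 * ρ ^ 2 ≤ 4 * α ^ 2 * ‖x - c‖ ^ 2 := by gcongr
          have h8 : 0 < α * ρ ^ 2 := by positivity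
          have h9 : L ≤ α * L := by nlinarith
          nlinarith
        have h10 : L * w x ≤ L * (m * X) := by
          apply mul_le_mul_of_nonneg_left _ hL
          have := mul_le_mul_of_nonneg_left h1 hm.le
          linarith
        have h11 : 0 < m * X * (4 * α ^ 2 * ‖x - c‖ ^ 2 - 2 * α * N - L) := by positivity
        nlinarith
  intro x hx hxρ
  have h1 := main x ⟨hx, hxρ⟩
  have h2 := phi_lower (N := N) (α := α) (R := r) (by linarith) hr.le c x
    (by rwa [mem_closedBall, dist_eq_norm] at hx)
  have h3 := mul_le_mul_of_nonneg_left h2 hm.le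
  linarith

/-- Strong positivity on a ball. -/
lemma ball_pos {N : ℕ} {L r : ℝ} (hL : 0 ≤ L) (hr : 0 < r) (c : E N) (w : E N → ℝ)
    (hwc : ContinuousOn w (closedBall c r))
    (hw : ∀ x ∈ ball c r, ContDiffAt ℝ 2 w x ∧ lap w x ≤ L * w x)
    (hw0 : ∀ x ∈ closedBall c r, 0 ≤ w x) (hc : 0 < w c) : ∀ x ∈ ball c r, 0 < w x := by
  have hcont : ContinuousAt w c := (hw c (mem_ball_self hr)).1.continuousAt
  have hev : ∀ᶠ x in nhds c, w c / 2 < w x := hcont.eventually_const_lt (by linarith)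
  obtain ⟨ε, hε, hεw⟩ := Metric.eventually_nhds_iff.1 hev
  set ρ := min (ε / 2) (r / 2) with hρ
  have hρ0 : 0 < ρ := by positivity
  have hρr : ρ < r := (min_le_right _ _).trans_lt (by linarith)
  have hρε : ρ < ε := (min_le_left _ _).trans_lt (by linarith)
  obtain ⟨κ, hκ, H⟩ := hopf (N := N) hL hρ0 hρr
  intro x hx
  by_cases h : ‖x - c‖ ≤ ρ
  · have := hεw (y := x) (by rw [dist_eq_norm]; linarith)
    linarith
  · push Not at h
    have h1 := H c w (w c / 2) (by linarith) hwc hw hw0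
      (fun z hz => (hεw (lt_of_le_of_lt hz hρε)).le) x (ball_subset_closedBall hx) h.le
    refine lt_of_lt_of_le ?_ h1
    have : 0 < r - ‖x - c‖ := by rw [mem_ball, dist_eq_norm] at hx; linarith
    positivity

/-- Growth lemma: a negative minimum cannot be seen from a nearby exterior ball. -/
lemma growth (N : ℕ) {L K : ℝ} (hL : 0 ≤ L) (hK : 1 ≤ K) :
    ∃ ρ : ℝ, 0 < ρ ∧ ∀ (S : Set (E N)) (w : E N → ℝ) (x₀ y : E N), IsOpen S →
      Bornology.IsBounded S →
      ContinuousOn w (closure S) → (∀ x ∈ frontier S, 0 ≤ w x) →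
      (∀ x ∈ S, ContDiffAt ℝ 2 w x ∧ lap w x ≤ L * |w x|) →
      x₀ ∈ S → w x₀ < 0 → (∀ x ∈ closure S, w x₀ ≤ w x) →
      Disjoint (ball y ρ) S → ‖x₀ - y‖ < K * ρ → False := by
  set β : ℝ := N + 1 with hβ
  have hβ1 : 1 ≤ β := by rw [hβ]; have : (0 : ℝ) ≤ N := by positivity
                         linarith
  set A : ℝ := Real.exp (-β * K ^ 2) with hA
  have hA0 : 0 < A := Real.exp_pos _
  obtain ⟨ρ, hρ, hρL⟩ : ∃ ρ : ℝ, 0 < ρ ∧ ρ ^ 2 * L < A := by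
    refine ⟨Real.sqrt (A / (L + 1)), by positivity, ?_⟩
    rw [Real.sq_sqrt (by positivity), div_mul_eq_mul_div, div_lt_iff₀ (by positivity)]
    nlinarith
  refine ⟨ρ, hρ, ?_⟩
  intro S w x₀ y hS hSb hwc hwf hw hx₀ hneg hmin hdisj hnear
  set M := - w x₀ with hM
  have hM0 : 0 < M := by linarith
  set α := β / ρ ^ 2 with hα
  have hα0 : 0 < α := by positivity
  set R := K * ρ with hR
  have main : ∀ x ∈ closure S ∩ closedBall y R, M * phi α R y x - w x ≤ M := by
    apply max_principle
    · exact (hSb.isCompact_closure).inter_right isClosed_closedBall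
    · refine ContinuousOn.sub ?_ (hwc.mono inter_subset_left)
      exact ((phi_contDiff α R y).continuous.const_mul M |>.continuousOn)
    · rintro x ⟨hx1, hx2⟩ hx3
      have hxR : ‖x - y‖ ≤ R := by rwa [mem_closedBall, dist_eq_norm] at hx2
      have hp1 : phi α R y x ≤ 1 := phi_le_one hα0.le y x
      have hlt : ‖x - y‖ < R := by
        rcases hxR.lt_or_eq with h | h
        · exact h
        · rw [phi_boundary y x h] at hx3
          have := hmin x hx1
          linarith
      have hwx : w x < 0 := by nlinarith
      have hxS : x ∈ S := by
        by_contra hcon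
        have := hwf x (by rw [hS.frontier_eq]; exact ⟨hx1, hcon⟩)
        linarith
      have hgt : ρ ≤ ‖x - y‖ := by
        by_contra! hcon
        exact Set.disjoint_left.1 hdisj (by rwa [mem_ball, dist_eq_norm]) hxS
      obtain ⟨hw2, hwl⟩ := hw x hxS
      constructor
      · exact inter_mem (mem_of_superset (hS.mem_nhds hxS) subset_closure)
          (closedBall_mem_nhds_of_lt hlt)
      · have hphi := (phi_contDiff (N := N) α R y).contDiffAt (x := x)
        rw [lap_sub (contDiffAt_const.mul hphi) hw2, lap_const_mul M hphi, lap_phi]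
        rw [abs_of_neg hwx] at hwl
        have h1 : L * -w x ≤ L * M := by
          apply mul_le_mul_of_nonneg_left _ hL
          have := hmin x hx1
          linarith
        have h2 : A ≤ Real.exp (-α * ‖x - y‖ ^ 2) := by
          rw [hA, Real.exp_le_exp]
          have h3 : ‖x - y‖ ^ 2 ≤ R ^ 2 := by
            have := norm_nonneg (x - y)
            nlinarith
          have h4 : α * R ^ 2 = β * K ^ 2 := by
            rw [hα, hR]; field_simp
          nlinarith
        set X := Real.exp (-α * ‖x - y‖ ^ 2) with hX
        have h5 : 1 / ρ ^ 2 ≤ 4 * α ^ 2 * ‖x - y‖ ^ 2 - 2 * α * N := by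
          have h6 : ρ ^ 2 ≤ ‖x - y‖ ^ 2 := by nlinarith
          have h7 : 4 * α ^ 2 * ρ ^ 2 ≤ 4 * α ^ 2 * ‖x - y‖ ^ 2 := by gcongr
          have h8 : 4 * α ^ 2 * ρ ^ 2 - 2 * α * N = (4 * β ^ 2 - 2 * β * N) / ρ ^ 2 := by
            rw [hα]; field_simp
          have h9 : 1 / ρ ^ 2 ≤ (4 * β ^ 2 - 2 * β * N) / ρ ^ 2 := by
            have : (N : ℝ) = β - 1 := by rw [hβ]; ring
            apply div_le_div_of_nonneg_right _ (by positivity)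
            rw [this]; nlinarith
          linarith
        have h10 : L < A * (1 / ρ ^ 2) := by
          rw [mul_one_div, lt_div_iff₀ (by positivity)]; linarith
        have h11 : A * (1 / ρ ^ 2) ≤ (4 * α ^ 2 * ‖x - y‖ ^ 2 - 2 * α * N) * X := by
          rw [mul_comm]
          exact mul_le_mul h5 h2 hA0.le ((by positivity : 0 ≤ 1 / ρ ^ 2).trans h5)
        have h12 := mul_lt_mul_of_pos_left (h10.trans_le h11) hM0
        linarith
  have h1 := main x₀ ⟨subset_closure hx₀, by rw [mem_closedBall, dist_eq_norm]; exact hnear.le⟩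
  have h2 := phi_pos (N := N) hα0 y x₀ hnear
  have h3 : 0 < M * phi α R y x₀ := by positivity
  linarith

/-- reflection in the hyperplane `x_i = l` -/
noncomputable def refl {N : ℕ} (i : Fin N) (l : ℝ) (x : E N) : E N := x + (2 * (l - x i)) • e i

lemma e_same {N : ℕ} (i : Fin N) : (e i : E N) i = 1 := by simp [e]

lemma e_ne {N : ℕ} {i j : Fin N} (h : j ≠ i) : (e i : E N) j = 0 := by simp [e, h]

lemma norm_e {N : ℕ} (i : Fin N) : ‖(e i : E N)‖ = 1 := by simp [e]

lemma add_smul_same {N : ℕ} (i : Fin N) (x : E N) (t : ℝ) : (x + t • e i) i = x i + t := by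
  simp [e]

lemma add_smul_ne {N : ℕ} {i j : Fin N} (h : j ≠ i) (x : E N) (t : ℝ) :
    (x + t • e i) j = x j := by
  simp [e, h]

lemma refl_same {N : ℕ} (i : Fin N) (l : ℝ) (x : E N) : refl i l x i = 2 * l - x i := by
  unfold refl; rw [add_smul_same]; ring

lemma refl_ne {N : ℕ} {i j : Fin N} (h : j ≠ i) (l : ℝ) (x : E N) : refl i l x j = x j := by
  unfold refl; rw [add_smul_ne h]

lemma refl_contDiff {N : ℕ} (i : Fin N) (l : ℝ) : ContDiff ℝ 2 (refl i l) := by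
  unfold refl; fun_prop

lemma refl_continuous {N : ℕ} (i : Fin N) : Continuous (fun p : ℝ × E N => refl i p.1 p.2) := by
  unfold refl; fun_prop

lemma refl_refl {N : ℕ} (i : Fin N) (l : ℝ) (x : E N) : refl i l (refl i l x) = x := by
  ext j
  by_cases h : j = i
  · subst h; rw [refl_same, refl_same]; ring
  · rw [refl_ne h, refl_ne h]

lemma lap_refl {N : ℕ} (i : Fin N) (l : ℝ) (u : E N → ℝ) (x : E N) :
    lap (fun z => u (refl i l z)) x = lap u (refl i l x) := by
  unfold lap
  refine Finset.sum_congr rfl fun j _ => ?_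
  by_cases h : j = i
  · subst h
    have : (fun t : ℝ => u (refl j l (x + t • e j)))
        = fun t : ℝ => (fun s : ℝ => u (refl j l x + s • e j)) (-t) := by
      funext t
      dsimp only
      refine congrArg u ?_
      ext k
      by_cases hk : k = j
      · subst hk; rw [refl_same, add_smul_same, add_smul_same, refl_same]; ring
      · rw [refl_ne hk, add_smul_ne hk, add_smul_ne hk, refl_ne hk]
    rw [this, iteratedDeriv_comp_neg 2 (fun s : ℝ => u (refl j l x + s • e j))]
    simp
  · congr 1
    funext t
    refine congrArg u ?_
    ext k
    by_cases hk : k = i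
    · subst hk
      rw [refl_same, add_smul_ne (Ne.symm h), add_smul_ne (Ne.symm h), refl_same]
    · rw [refl_ne hk]
      by_cases hkj : k = j
      · subst hkj; rw [add_smul_same, add_smul_same, refl_ne hk]
      · rw [add_smul_ne hkj, add_smul_ne hkj, refl_ne hk]

/-- The data of the problem. -/
structure Sol {N : ℕ} (Ω : Set (E N)) (u : E N → ℝ) (L : ℝ) : Prop where
  isOpen : IsOpen Ω
  bdd : Bornology.IsBounded Ω
  box1 : ∀ i : Fin N, ∀ p ∈ Ω, ∀ q : E N, (∀ j, j ≠ i → q j = p j) → |q i| ≤ |p i| → q ∈ Ω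
  c2 : ∀ x ∈ Ω, ContDiffAt ℝ 2 u x
  cont : ContinuousOn u (closure Ω)
  L0 : 0 ≤ L
  lip : ∀ x ∈ Ω, ∀ y ∈ Ω, |lap u x - lap u y| ≤ L * |u x - u y|
  pos : ∀ x ∈ Ω, 0 < u x
  bc : ∀ x ∈ frontier Ω, u x = 0

namespace Sol

variable {N : ℕ} {Ω : Set (E N)} {u : E N → ℝ} {L : ℝ}

lemma box (h : Sol Ω u L) {p q : E N} (hp : p ∈ Ω) (hq : ∀ j, |q j| ≤ |p j|) : q ∈ Ω := by
  classical
  have key : ∀ s : Finset (Fin N),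
      (WithLp.toLp 2 (fun j => if j ∈ s then q j else p j) : E N) ∈ Ω := by
    intro s
    induction s using Finset.induction_on with
    | empty => simpa using hp
    | insert a s ha ih =>
      refine h.box1 a _ ih _ ?_ ?_
      · intro j hj
        simp [Finset.mem_insert, hj]
      · simpa [ha] using hq a
  simpa using key Finset.univ

lemma nonneg (h : Sol Ω u L) {x : E N} (hx : x ∈ closure Ω) : 0 ≤ u x := by
  by_cases hx' : x ∈ Ω
  · exact (h.pos x hx').le
  · exact (h.bc x (by rw [h.isOpen.frontier_eq]; exact ⟨hx, hx'⟩)).ge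

lemma refl_mem (h : Sol Ω u L) (i : Fin N) {l : ℝ} (hl : 0 ≤ l) {x : E N} (hx : x ∈ Ω)
    (hxl : l ≤ x i) : refl i l x ∈ Ω := by
  refine h.box1 i x hx _ (fun j hj => refl_ne hj l x) ?_
  rw [refl_same, abs_le, abs_of_nonneg (hl.trans hxl)]
  constructor <;> linarith

lemma refl_zero_mem (h : Sol Ω u L) (i : Fin N) {x : E N} (hx : x ∈ Ω) : refl i 0 x ∈ Ω := by
  refine h.box1 i x hx _ (fun j hj => refl_ne hj 0 x) ?_
  rw [refl_same]; simp

lemma comp_refl (h : Sol Ω u L) (i : Fin N) : Sol Ω (fun x => u (refl i 0 x)) L where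
  isOpen := h.isOpen
  bdd := h.bdd
  box1 := h.box1
  c2 := fun x hx => by
    exact ContDiffAt.comp x (g := u) (h.c2 _ (h.refl_zero_mem i hx)) (refl_contDiff i 0).contDiffAt
  cont := by
    refine h.cont.comp (refl_contDiff i 0).continuous.continuousOn ?_
    exact MapsTo.closure (fun x hx => h.refl_zero_mem i hx) (refl_contDiff i 0).continuous
  L0 := h.L0
  lip := fun x hx y hy => by
    rw [lap_refl, lap_refl]
    exact h.lip _ (h.refl_zero_mem i hx) _ (h.refl_zero_mem i hy)
  pos := fun x hx => h.pos _ (h.refl_zero_mem i hx)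
  bc := fun x hx => by
    rw [h.isOpen.frontier_eq] at hx
    apply h.bc
    rw [h.isOpen.frontier_eq]
    refine ⟨MapsTo.closure (fun x hx => h.refl_zero_mem i hx) (refl_contDiff i 0).continuous hx.1,
      fun hc => hx.2 ?_⟩
    have := h.refl_zero_mem i hc
    rwa [refl_refl] at this

end Sol

/-- the cap -/
def cap {N : ℕ} (Ω : Set (E N)) (i : Fin N) (l : ℝ) : Set (E N) := {x | x ∈ Ω ∧ l < x i}

/-- reflected difference -/
noncomputable def dif {N : ℕ} (u : E N → ℝ) (i : Fin N) (l : ℝ) (x : E N) : ℝ :=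
  u (refl i l x) - u x

namespace Sol

variable {N : ℕ} {Ω : Set (E N)} {u : E N → ℝ} {L : ℝ}

lemma cap_open (h : Sol Ω u L) (i : Fin N) (l : ℝ) : IsOpen (cap Ω i l) :=
  h.isOpen.inter (isOpen_lt (f := fun _ : E N => l) (g := fun x : E N => x i)
    continuous_const (by fun_prop))

lemma cap_closure (i : Fin N) {l : ℝ} {x : E N} (hx : x ∈ closure (cap Ω i l)) :
    x ∈ closure Ω ∧ l ≤ x i := by
  refine ⟨closure_mono (fun y hy => hy.1) hx, ?_⟩
  have hc : IsClosed {y : E N | l ≤ y i} := isClosed_le continuous_const (by fun_prop)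
  exact closure_minimal (fun y (hy : y ∈ cap Ω i l) => hy.2.le) hc hx

lemma refl_closure (h : Sol Ω u L) (i : Fin N) {l : ℝ} (hl : 0 ≤ l) :
    MapsTo (refl i l) (closure (cap Ω i l)) (closure Ω) :=
  MapsTo.closure (fun x hx => h.refl_mem i hl hx.1 hx.2.le) (refl_contDiff i l).continuous

lemma dif_cont (h : Sol Ω u L) (i : Fin N) {l : ℝ} (hl : 0 ≤ l) :
    ContinuousOn (dif u i l) (closure (cap Ω i l)) := by
  refine ContinuousOn.sub ?_ (h.cont.mono fun x hx => (cap_closure i hx).1)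
  exact h.cont.comp (refl_contDiff i l).continuous.continuousOn (h.refl_closure i hl)

lemma dif_frontier (h : Sol Ω u L) (i : Fin N) {l : ℝ} (hl : 0 ≤ l) :
    ∀ x ∈ frontier (cap Ω i l), 0 ≤ dif u i l x := by
  intro x hx
  rw [(h.cap_open i l).frontier_eq] at hx
  obtain ⟨h1, h2⟩ := cap_closure i hx.1
  unfold dif
  by_cases hxo : x ∈ Ω
  · have : x i = l := by
      by_contra hne
      exact hx.2 ⟨hxo, lt_of_le_of_ne h2 (Ne.symm hne)⟩
    have : refl i l x = x := by unfold refl; simp [this]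
    rw [this, sub_self]
  · rw [h.bc x (by rw [h.isOpen.frontier_eq]; exact ⟨h1, hxo⟩), sub_zero]
    exact h.nonneg (h.refl_closure i hl hx.1)

lemma dif_lap (h : Sol Ω u L) (i : Fin N) {l : ℝ} (hl : 0 ≤ l) {x : E N} (hx : x ∈ Ω)
    (hxl : l ≤ x i) :
    ContDiffAt ℝ 2 (dif u i l) x ∧ lap (dif u i l) x ≤ L * |dif u i l x| := by
  have hr := h.refl_mem i hl hx hxl
  have h1 : ContDiffAt ℝ 2 (fun z => u (refl i l z)) x :=
    ContDiffAt.comp x (g := u) (h.c2 _ hr) (refl_contDiff i l).contDiffAt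
  refine ⟨h1.sub (h.c2 x hx), ?_⟩
  have h2 : lap (dif u i l) x = lap u (refl i l x) - lap u x := by
    unfold dif
    rw [lap_sub h1 (h.c2 x hx), lap_refl]
  rw [h2]
  exact (le_abs_self _).trans (h.lip _ hr _ hx)

/-- A negative minimum stays away from the boundary of the cap. -/
lemma min_far (h : Sol Ω u L) (i : Fin N) : ∃ δ : ℝ, 0 < δ ∧ ∀ l : ℝ, 0 ≤ l → ∀ x₀ ∈ cap Ω i l,
    dif u i l x₀ < 0 → (∀ x ∈ closure (cap Ω i l), dif u i l x₀ ≤ dif u i l x) →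
    ball x₀ δ ⊆ cap Ω i l := by
  obtain ⟨ρ, hρ, H⟩ := growth N (L := L) (K := N + 2) h.L0 (by
    have : (0 : ℝ) ≤ N := by positivity
    linarith)
  refine ⟨ρ, hρ, ?_⟩
  intro l hl x₀ hx₀ hneg hmin z hz
  by_contra hzc
  have hzd : ‖x₀ - z‖ < ρ := by rwa [mem_ball, dist_comm, dist_eq_norm] at hz
  have hN : (0 : ℝ) ≤ N := by positivity
  have H' := fun y => H (cap Ω i l) (dif u i l) x₀ y (h.cap_open i l)
    (h.bdd.subset fun x hx => hx.1) (h.dif_cont i hl) (h.dif_frontier i hl)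
    (fun x hx => h.dif_lap i hl hx.1 hx.2.le) hx₀ hneg hmin
  by_cases hzo : z ∈ Ω
  · have hzl : z i ≤ l := by
      by_contra! hcon
      exact hzc ⟨hzo, hcon⟩
    refine H' (z + (-ρ) • e i) ?_ ?_
    · rw [Set.disjoint_left]
      rintro x hx ⟨-, hxl⟩
      rw [mem_ball, dist_eq_norm] at hx
      have h1 := PiLp.norm_apply_le (x - (z + (-ρ) • e i)) i
      rw [PiLp.sub_apply, add_smul_same, Real.norm_eq_abs] at h1
      have h2 := (abs_le.1 h1).2
      linarith
    · have h1 : x₀ - (z + (-ρ) • e i) = (x₀ - z) + ρ • e i := by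
        rw [neg_smul]; abel
      rw [h1]
      have h2 := norm_add_le (x₀ - z) (ρ • e i)
      rw [norm_smul, norm_e, Real.norm_eq_abs, abs_of_pos hρ] at h2
      nlinarith
  · set s : E N := WithLp.toLp 2 (fun j => if 0 ≤ z j then (1 : ℝ) else -1) with hs
    have hsj : ∀ j, s j = if 0 ≤ z j then (1 : ℝ) else -1 := fun j => rfl
    have hsn : ‖s‖ ≤ N + 1 := by
      have h1 : ‖s‖ ^ 2 = N := by
        rw [EuclideanSpace.norm_sq_eq]
        have : ∀ j, ‖s j‖ ^ 2 = 1 := by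
          intro j; rw [hsj]; split_ifs <;> simp
        rw [Finset.sum_congr rfl fun j _ => this j]
        simp
      have := norm_nonneg s
      nlinarith
    refine H' (z + ρ • s) ?_ ?_
    · rw [Set.disjoint_left]
      rintro x hx ⟨hxo, -⟩
      apply hzo
      refine h.box hxo fun j => ?_
      rw [mem_ball, dist_eq_norm] at hx
      have h1 := PiLp.norm_apply_le (x - (z + ρ • s)) j
      rw [PiLp.sub_apply, PiLp.add_apply, PiLp.smul_apply, smul_eq_mul, hsj,
        Real.norm_eq_abs] at h1
      have h2 := abs_le.1 h1
      split_ifs at h2 with hj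
      · rw [abs_of_nonneg hj]
        refine le_trans ?_ (le_abs_self _)
        linarith
      · rw [abs_of_neg (not_le.1 hj)]
        refine le_trans ?_ (neg_le_abs _)
        linarith
    · have h1 : x₀ - (z + ρ • s) = (x₀ - z) - ρ • s := by abel
      rw [h1]
      have h2 := norm_sub_le (x₀ - z) (ρ • s)
      rw [norm_smul, Real.norm_eq_abs, abs_of_pos hρ] at h2
      nlinarith

/-- Strict positivity from nonnegativity. -/
lemma dif_pos (h : Sol Ω u L) (i : Fin N) {l : ℝ} (hl : 0 < l)
    (hnn : ∀ x ∈ cap Ω i l, 0 ≤ dif u i l x) : ∀ x ∈ cap Ω i l, 0 < dif u i l x := by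
  intro x hx
  by_contra! hx0
  -- exit time
  set A : Set ℝ := {t | 0 ≤ t ∧ x + t • e i ∈ Ω} with hA
  have hA0 : (0 : ℝ) ∈ A := ⟨le_rfl, by simpa using hx.1⟩
  have hAb : BddAbove A := by
    obtain ⟨C, hC⟩ := h.bdd.exists_norm_le
    refine ⟨C, fun t ht => ?_⟩
    have h1 := (PiLp.norm_apply_le (x + t • e i) i).trans (hC _ ht.2)
    rw [add_smul_same, Real.norm_eq_abs] at h1
    have := (abs_le.1 h1).2
    have := hx.2
    linarith
  set T := sSup A with hT
  have hT0 : 0 ≤ T := le_csSup hAb hA0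
  have hxi : 0 < x i := hl.trans hx.2
  have hin : ∀ t, 0 ≤ t → t < T → x + t • e i ∈ Ω := by
    intro t ht htT
    obtain ⟨s, hs, hts⟩ := exists_lt_of_lt_csSup ⟨0, hA0⟩ htT
    refine h.box1 i _ hs.2 _ (fun j hj => by rw [add_smul_ne hj, add_smul_ne hj]) ?_
    rw [add_smul_same, add_smul_same, abs_of_nonneg (by linarith), abs_of_nonneg (by linarith)]
    linarith
  have hline : Continuous (fun t : ℝ => x + t • e i) := by fun_prop
  have hnot : x + T • e i ∉ Ω := by
    intro hcon
    have : ∀ᶠ t in nhds T, x + t • e i ∈ Ω :=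
      hline.continuousAt.eventually (h.isOpen.mem_nhds hcon)
    obtain ⟨ε, hε, H⟩ := Metric.eventually_nhds_iff.1 this
    have h1 : T + ε / 2 ∈ A := ⟨by linarith, H (by
      rw [Real.dist_eq, add_sub_cancel_left, abs_of_pos (by linarith)]; linarith)⟩
    have := le_csSup hAb h1
    linarith
  have hTpos : 0 < T := by
    rcases hT0.lt_or_eq with h1 | h1
    · exact h1
    · exact absurd (by simpa [← h1] using hx.1) hnot
  have hcap : ∀ t, 0 ≤ t → t < T → x + t • e i ∈ cap Ω i l := fun t ht htT =>
    ⟨hin t ht htT, by rw [add_smul_same]; have := hx.2; linarith⟩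
  have hmaps : ∀ t ∈ Icc 0 T, x + t • e i ∈ closure (cap Ω i l) := by
    intro t ht
    have h1 : MapsTo (fun t : ℝ => x + t • e i) (closure (Ico 0 T)) (closure (cap Ω i l)) :=
      MapsTo.closure (fun t ht => hcap t ht.1 ht.2) hline
    apply h1
    rwa [closure_Ico hTpos.ne]
  have hcont : ContinuousOn (fun t : ℝ => dif u i l (x + t • e i)) (Icc 0 T) :=
    (h.dif_cont i hl.le).comp hline.continuousOn hmaps
  -- positivity at exit
  have hexit : 0 < dif u i l (x + T • e i) := by
    unfold dif
    have hc := (cap_closure i (hmaps T ⟨hT0, le_rfl⟩)).1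
    rw [h.bc (x + T • e i) (by rw [h.isOpen.frontier_eq]; exact ⟨hc, hnot⟩), sub_zero]
    apply h.pos
    have hb : max 0 (T - min l (x i)) < T := by
      apply max_lt hTpos
      have := lt_min hl hxi
      linarith
    refine h.box1 i _ (hin (max 0 (T - min l (x i))) (le_max_left _ _) hb) _ (fun j hj => by
      rw [refl_ne hj, add_smul_ne hj, add_smul_ne hj]) ?_
    rw [refl_same, add_smul_same, add_smul_same]
    have h1 := le_max_right 0 (T - min l (x i))
    have h2 := le_max_left 0 (T - min l (x i))
    have h3 := min_le_left l (x i)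
    have h4 := hx.2
    rw [abs_of_nonneg (a := x i + max 0 (T - min l (x i))) (by linarith), abs_le]
    constructor <;> linarith
  -- last zero
  obtain ⟨t, ⟨htI, htz⟩, htmax⟩ : ∃ t ∈ Icc 0 T ∩ {t | dif u i l (x + t • e i) ≤ 0},
      ∀ s ∈ Icc 0 T ∩ {t | dif u i l (x + t • e i) ≤ 0}, s ≤ t := by
    have hcl : IsClosed (Icc 0 T ∩ {t | dif u i l (x + t • e i) ≤ 0}) :=
      hcont.preimage_isClosed_of_isClosed isClosed_Icc isClosed_Iic
    have hcpt : IsCompact (Icc 0 T ∩ {t | dif u i l (x + t • e i) ≤ 0}) :=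
      isCompact_Icc.of_isClosed_subset hcl inter_subset_left
    obtain ⟨t, ht⟩ := hcpt.exists_isGreatest ⟨0, ⟨⟨le_rfl, hT0⟩, by simpa using hx0⟩⟩
    exact ⟨t, ht.1, fun s hs => ht.2 hs⟩
  have htz : dif u i l (x + t • e i) ≤ 0 := htz
  have htT : t < T := by
    rcases htI.2.lt_or_eq with h1 | h1
    · exact h1
    · rw [h1] at htz; linarith
  set p := x + t • e i with hp
  have hpc := hcap t htI.1 htT
  obtain ⟨r, hr, hrb⟩ := Metric.isOpen_iff.1 (h.cap_open i l) p hpc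
  set τ := min (r / 4) ((T - t) / 2) with hτ
  have hτ0 : 0 < τ := by
    apply lt_min <;> linarith
  have hτr : τ ≤ r / 4 := min_le_left _ _
  have hτT : τ ≤ (T - t) / 2 := min_le_right _ _
  have hceq : x + (t + τ) • e i = p + τ • e i := by rw [hp, add_smul, add_assoc]
  set c := x + (t + τ) • e i with hc
  have hpcd : ‖p - c‖ = τ := by
    rw [hceq, sub_add_cancel_left, norm_neg, norm_smul, norm_e, Real.norm_eq_abs,
      abs_of_pos hτ0, mul_one]
  have hsub : closedBall c (2 * τ) ⊆ cap Ω i l := by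
    intro z hz
    apply hrb
    rw [mem_closedBall] at hz
    rw [mem_ball]
    have := dist_triangle z c p
    rw [dist_comm c p, dist_eq_norm p c, hpcd] at this
    linarith
  have hcpos : 0 < dif u i l c := by
    by_contra! hcon
    have := htmax (t + τ) ⟨⟨by linarith [htI.1], by linarith⟩, hcon⟩
    linarith
  have := ball_pos h.L0 (by linarith : 0 < 2 * τ) c (dif u i l)
    ((h.dif_cont i hl.le).mono (hsub.trans subset_closure))
    (fun z hz => by
      have hz' := hsub (ball_subset_closedBall hz)
      have h1 := h.dif_lap i hl.le hz'.1 hz'.2.le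
      rwa [abs_of_nonneg (hnn z hz')] at h1)
    (fun z hz => hnn z (hsub hz)) hcpos p (by rw [mem_ball, dist_eq_norm, hpcd]; linarith)
  linarith

end Sol

namespace Sol

variable {N : ℕ} {Ω : Set (E N)} {u : E N → ℝ} {L : ℝ}

lemma dif_tendsto (h : Sol Ω u L) (i : Fin N) {l : ℝ} (hl : 0 ≤ l) {x : E N} (hx : x ∈ Ω)
    (hxl : l ≤ x i) :
    ContinuousAt (fun p : ℝ × E N => dif u i p.1 p.2) (l, x) := by
  unfold dif
  have h1 : ContinuousAt u (refl i l x) := (h.c2 _ (h.refl_mem i hl hx hxl)).continuousAt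
  have h2 : ContinuousAt u x := (h.c2 _ hx).continuousAt
  refine ContinuousAt.sub ?_ ?_
  · exact ContinuousAt.comp (f := fun p : ℝ × E N => refl i p.1 p.2) (g := u) (x := (l, x)) h1
      (refl_continuous i).continuousAt
  · exact ContinuousAt.comp (f := fun p : ℝ × E N => p.2) (g := u) (x := (l, x)) h2
      continuous_snd.continuousAt

/-- The moving plane conclusion. -/
lemma dif_nonneg (h : Sol Ω u L) (i : Fin N) :
    ∀ l : ℝ, 0 < l → ∀ x ∈ cap Ω i l, 0 ≤ dif u i l x := by
  by_contra! hcon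
  obtain ⟨l₀, hl₀, x₀, hx₀, hneg₀⟩ := hcon
  set B : Set ℝ := {l | 0 < l ∧ ∃ x ∈ cap Ω i l, dif u i l x < 0} with hB
  have hBne : B.Nonempty := ⟨l₀, hl₀, x₀, hx₀, hneg₀⟩
  have hBb : BddAbove B := by
    obtain ⟨C, hC⟩ := h.bdd.exists_norm_le
    refine ⟨C, ?_⟩
    rintro l ⟨_, x, hx, _⟩
    have h1 := (PiLp.norm_apply_le x i).trans (hC _ hx.1)
    have h2 := le_abs_self (x i)
    rw [Real.norm_eq_abs] at h1
    linarith [hx.2]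
  set b := sSup B with hb
  have hb0 : 0 < b := lt_of_lt_of_le hl₀ (le_csSup hBb ⟨hl₀, x₀, hx₀, hneg₀⟩)
  have hnn : ∀ x ∈ cap Ω i b, 0 ≤ dif u i b x := by
    intro x hx
    have h1 : Tendsto (fun l : ℝ => dif u i l x) (nhdsWithin b (Ioi b)) (nhds (dif u i b x)) := by
      have h2 : ContinuousAt (fun l : ℝ => dif u i l x) b :=
        ContinuousAt.comp (f := fun l : ℝ => (l, x)) (g := fun p : ℝ × E N => dif u i p.1 p.2)
          (x := b) (h.dif_tendsto i hb0.le hx.1 hx.2.le) (by fun_prop)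
      exact h2.tendsto.mono_left nhdsWithin_le_nhds
    refine ge_of_tendsto h1 ?_
    filter_upwards [Ioo_mem_nhdsGT hx.2] with l hl
    by_contra! hc
    have : l ∈ B := ⟨hb0.trans hl.1, x, ⟨hx.1, hl.2⟩, hc⟩
    have := le_csSup hBb this
    linarith [hl.1]
  have hpos := h.dif_pos i hb0 hnn
  obtain ⟨δ, hδ, hfar⟩ := h.min_far i
  have hmin : ∀ l ∈ B, ∃ x ∈ cap Ω i l, dif u i l x < 0 ∧ ball x δ ⊆ cap Ω i l := by
    rintro l ⟨hl, y, hy, hyn⟩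
    have hcpt : IsCompact (closure (cap Ω i l)) :=
      (h.bdd.subset fun x (hx : x ∈ cap Ω i l) => hx.1).isCompact_closure
    obtain ⟨z, hz, hzm⟩ := hcpt.exists_isMinOn ⟨y, subset_closure hy⟩ (h.dif_cont i hl.le)
    have hzn : dif u i l z < 0 := lt_of_le_of_lt (hzm (subset_closure hy)) hyn
    have hzc : z ∈ cap Ω i l := by
      by_contra hcc
      have := h.dif_frontier i hl.le z (by rw [(h.cap_open i l).frontier_eq]; exact ⟨hz, hcc⟩)
      linarith
    exact ⟨z, hzc, hzn, hfar l hl.le z hzc hzn fun x hx => hzm hx⟩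
  obtain ⟨s, -, hst, hsB⟩ := exists_seq_tendsto_sSup hBne hBb
  choose X hXc hXn hXb using fun n => hmin (s n) (hsB n)
  obtain ⟨x, hx, φ, hφ, hlim⟩ := h.bdd.isCompact_closure.tendsto_subseq
    (x := X) fun n => subset_closure (hXc n).1
  have hsφ : Tendsto (fun n => s (φ n)) atTop (nhds b) := hst.comp hφ.tendsto_atTop
  have hxO : x ∈ Ω := by
    obtain ⟨n, hn⟩ := (hlim.eventually (ball_mem_nhds x hδ)).exists
    have : x ∈ ball (X (φ n)) δ := by rw [mem_ball, dist_comm]; exact hn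
    exact (hXb _ this).1
  have hxi : b + δ / 2 ≤ x i := by
    have h1 : Tendsto (fun n => (X (φ n)) i) atTop (nhds (x i)) := by
      have hc : Continuous (fun y : E N => y i) := by fun_prop
      exact (hc.tendsto x).comp hlim
    refine le_of_tendsto_of_tendsto' (hsφ.add_const (δ / 2)) h1 fun n => ?_
    have h2 : X (φ n) + (-(δ / 2)) • e i ∈ ball (X (φ n)) δ := by
      rw [mem_ball, dist_eq_norm, add_sub_cancel_left, norm_smul, norm_e, Real.norm_eq_abs, abs_neg,
        abs_of_pos (by linarith)]
      linarith
    have h3 := (hXb _ h2).2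
    rw [add_smul_same] at h3
    linarith
  have hle : dif u i b x ≤ 0 := by
    have h1 := (h.dif_tendsto i hb0.le hxO (by linarith)).tendsto.comp (hsφ.prodMk_nhds hlim)
    exact le_of_tendsto' h1 fun n => (hXn (φ n)).le
  have := hpos x ⟨hxO, by linarith⟩
  linarith

lemma le_refl_zero (h : Sol Ω u L) (i : Fin N) {x : E N} (hx : x ∈ Ω) (hxi : 0 < x i) :
    u x ≤ u (refl i 0 x) := by
  have h1 : Tendsto (fun l : ℝ => dif u i l x) (nhdsWithin 0 (Ioi 0)) (nhds (dif u i 0 x)) := by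
    have h2 : ContinuousAt (fun l : ℝ => dif u i l x) 0 :=
      ContinuousAt.comp (f := fun l : ℝ => (l, x)) (g := fun p : ℝ × E N => dif u i p.1 p.2)
        (x := 0) (h.dif_tendsto i le_rfl hx hxi.le) (by fun_prop)
    exact h2.tendsto.mono_left nhdsWithin_le_nhds
  have : 0 ≤ dif u i 0 x := by
    refine ge_of_tendsto h1 ?_
    filter_upwards [Ioo_mem_nhdsGT hxi] with l hl
    exact h.dif_nonneg i l hl.1 x ⟨hx, hl.2⟩
  unfold dif at this
  linarith

lemma symm_pos (h : Sol Ω u L) (i : Fin N) {x : E N} (hx : x ∈ Ω) (hxi : 0 < x i) :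
    u (refl i 0 x) = u x := by
  refine le_antisymm ?_ (h.le_refl_zero i hx hxi)
  have := (h.comp_refl i).le_refl_zero i hx hxi
  rwa [refl_refl] at this

lemma symm (h : Sol Ω u L) (i : Fin N) {x : E N} (hx : x ∈ Ω) : u (refl i 0 x) = u x := by
  rcases lt_trichotomy (x i) 0 with hi | hi | hi
  · have := h.symm_pos i (h.refl_zero_mem i hx) (by rw [refl_same]; linarith)
    rw [refl_refl] at this
    exact this.symm
  · have : refl i 0 x = x := by unfold refl; simp [hi]
    rw [this]
  · exact h.symm_pos i hx hi

lemma hasDerivAt_line (h : Sol Ω u L) (i : Fin N) {x : E N} {t : ℝ} (hx : x + t • e i ∈ Ω) :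
    HasDerivAt (fun s : ℝ => u (x + s • e i)) (fderiv ℝ u (x + t • e i) (e i)) t := by
  have h1 : HasFDerivAt u (fderiv ℝ u (x + t • e i)) (x + t • e i) :=
    ((h.c2 _ hx).differentiableAt (by norm_num)).hasFDerivAt
  have h2 : HasDerivAt (fun s : ℝ => x + s • e i) (e i) t := by
    have := ((hasDerivAt_id' t).smul_const (e i)).const_add x
    simpa using this
  exact h1.comp_hasDerivAt t h2

lemma fderiv_zero (h : Sol Ω u L) (i : Fin N) {x : E N} (hx : x ∈ Ω) (hxi : x i = 0) :
    fderiv ℝ u x (e i) = 0 := by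
  have h0 : x + (0 : ℝ) • e i = x := by simp
  have h1 := h.hasDerivAt_line i (x := x) (t := 0) (by rwa [h0])
  rw [h0] at h1
  have h1' : HasDerivAt (fun s : ℝ => u (x + s • e i)) (fderiv ℝ u x (e i)) (-0) := by
    rwa [neg_zero]
  have h2 : HasDerivAt (fun s : ℝ => u (x + (-s) • e i)) (-(fderiv ℝ u x (e i))) 0 := by
    have := HasDerivAt.comp (0 : ℝ) h1' (hasDerivAt_neg (0 : ℝ))
    exact this.congr_deriv (by simp)
  have hline : Continuous (fun t : ℝ => x + t • e i) := by fun_prop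
  have hev : ∀ᶠ t in nhds (0 : ℝ), x + t • e i ∈ Ω :=
    hline.continuousAt.eventually (h.isOpen.mem_nhds (by simpa using hx))
  have h3 : HasDerivAt (fun s : ℝ => u (x + s • e i)) (-(fderiv ℝ u x (e i))) 0 := by
    refine h2.congr_of_eventuallyEq ?_
    filter_upwards [hev] with t ht
    rw [← h.symm i ht]
    refine congrArg u ?_
    ext k
    by_cases hk : k = i
    · subst hk; rw [refl_same, add_smul_same, add_smul_same, hxi]; ring
    · rw [refl_ne hk, add_smul_ne hk, add_smul_ne hk]
  have := h1.unique h3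
  linarith

end Sol

lemma le_deriv_of_le {g : ℝ → ℝ} {d a : ℝ} (hg : HasDerivAt g d 0) (h0 : g 0 = 0)
    (h : ∀ᶠ t in nhdsWithin (0 : ℝ) (Ioi 0), a * t ≤ g t) : a ≤ d := by
  have h1 := (hasDerivAt_iff_tendsto_slope.1 hg).mono_left
    (nhdsWithin_mono (0 : ℝ) (fun t (ht : t ∈ Ioi (0 : ℝ)) => ne_of_gt ht))
  refine ge_of_tendsto h1 ?_
  filter_upwards [h, self_mem_nhdsWithin] with t ht ht0
  have ht0 : 0 < t := ht0
  rw [slope_def_field, h0, sub_zero, sub_zero, le_div_iff₀ ht0]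
  exact ht

namespace Sol

variable {N : ℕ} {Ω : Set (E N)} {u : E N → ℝ} {L : ℝ}

lemma hopf_plane (h : Sol Ω u L) (i : Fin N) {r : ℝ} (hr : 0 < r) :
    ∃ κ : ℝ, 0 < κ ∧ ∀ (l : ℝ) (p : E N) (m : ℝ), 0 < l → p i = l → 0 < m →
      closedBall (p + r • e i) r ⊆ Ω →
      (∀ x ∈ closedBall (p + r • e i) (r / 2), m ≤ dif u i l x) →
      fderiv ℝ u p (e i) ≤ -(κ * m / 2) := by
  obtain ⟨κ, hκ, H⟩ := hopf (N := N) h.L0 (by linarith : 0 < r / 2) (by linarith : r / 2 < r)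
  refine ⟨κ, hκ, ?_⟩
  intro l p m hl hp hm hball hmd
  have hge : ∀ x ∈ closedBall (p + r • e i) r, l ≤ x i := by
    intro x hx
    rw [mem_closedBall, dist_eq_norm] at hx
    have h1 := (PiLp.norm_apply_le (x - (p + r • e i)) i).trans hx
    rw [PiLp.sub_apply, add_smul_same, Real.norm_eq_abs] at h1
    have h2 := (abs_le.1 h1).1
    linarith
  have hnn : ∀ x ∈ closedBall (p + r • e i) r, 0 ≤ dif u i l x := by
    intro x hx
    rcases (hge x hx).lt_or_eq with h1 | h1
    · exact h.dif_nonneg i l hl x ⟨hball hx, h1⟩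
    · have : refl i l x = x := by unfold refl; simp [h1]
      unfold dif
      rw [this, sub_self]
  have hkey := H (p + r • e i) (dif u i l) m hm
    (fun x hx => (h.dif_lap i hl.le (hball hx) (hge x hx)).1.continuousAt.continuousWithinAt)
    (fun x hx => by
      have hx' := ball_subset_closedBall hx
      have h1 := h.dif_lap i hl.le (hball hx') (hge x hx')
      rwa [abs_of_nonneg (hnn x hx')] at h1) hnn hmd
  have hpO : p ∈ Ω := by
    apply hball
    rw [mem_closedBall, dist_eq_norm, sub_add_cancel_left, norm_neg, norm_smul, norm_e,
      Real.norm_eq_abs, abs_of_pos hr, mul_one]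
  have h0 : p + (0 : ℝ) • e i = p := by simp
  have h1 := h.hasDerivAt_line i (x := p) (t := 0) (by rwa [h0])
  rw [h0] at h1
  have h1' : HasDerivAt (fun s : ℝ => u (p + s • e i)) (fderiv ℝ u p (e i)) (-0) := by
    rwa [neg_zero]
  have h2 : HasDerivAt (fun s : ℝ => u (p + (-s) • e i)) (-(fderiv ℝ u p (e i))) 0 := by
    have := HasDerivAt.comp (0 : ℝ) h1' (hasDerivAt_neg (0 : ℝ))
    exact this.congr_deriv (by simp)
  have h3 := le_deriv_of_le (a := κ * m) (h2.sub h1) (by simp) (by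
    filter_upwards [Ioo_mem_nhdsGT (by linarith : 0 < r / 2)] with t ht
    have hn : ‖p + t • e i - (p + r • e i)‖ = r - t := by
      have : p + t • e i - (p + r • e i) = (t - r) • e i := by rw [sub_smul]; abel
      rw [this, norm_smul, norm_e, Real.norm_eq_abs, abs_of_neg (by linarith [ht.2]), mul_one]
      ring
    have h4 := hkey (p + t • e i)
      (by rw [mem_closedBall, dist_eq_norm, hn]; linarith [ht.1])
      (by rw [hn]; linarith [ht.2])
    rw [hn] at h4
    unfold dif at h4
    have h5 : refl i l (p + t • e i) = p + (-t) • e i := by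
      ext k
      by_cases hk : k = i
      · subst hk; rw [refl_same, add_smul_same, add_smul_same, hp]; ring
      · rw [refl_ne hk, add_smul_ne hk, add_smul_ne hk]
    rw [h5] at h4
    have h6 : r - (r - t) = t := by ring
    rw [h6] at h4
    exact h4)
  linarith

lemma fderiv_neg (h : Sol Ω u L) (i : Fin N) {p : E N} (hp : p ∈ Ω) (hpi : 0 < p i) :
    fderiv ℝ u p (e i) < 0 := by
  obtain ⟨ε, hε, hεb⟩ := Metric.isOpen_iff.1 h.isOpen p hp
  set r := ε / 4 with hr
  have hr0 : 0 < r := by linarith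
  have hcp : dist (p + r • e i) p = r := by
    rw [dist_eq_norm, add_sub_cancel_left, norm_smul, norm_e, Real.norm_eq_abs, abs_of_pos hr0,
      mul_one]
  have hball : closedBall (p + r • e i) r ⊆ Ω := by
    intro z hz
    apply hεb
    rw [mem_closedBall] at hz
    have := dist_triangle z (p + r • e i) p
    rw [mem_ball]
    linarith
  have hcap : closedBall (p + r • e i) (r / 2) ⊆ cap Ω i (p i) := by
    intro x hx
    refine ⟨hball (closedBall_subset_closedBall (by linarith) hx), ?_⟩
    rw [mem_closedBall, dist_eq_norm] at hx
    have h1 := (PiLp.norm_apply_le (x - (p + r • e i)) i).trans hx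
    rw [PiLp.sub_apply, add_smul_same, Real.norm_eq_abs] at h1
    have h2 := (abs_le.1 h1).1
    linarith
  obtain ⟨κ, hκ, H⟩ := h.hopf_plane i hr0
  obtain ⟨z, hz, hzm⟩ := (isCompact_closedBall (p + r • e i) (r / 2)).exists_isMinOn
    ⟨_, mem_closedBall_self (by linarith)⟩
    ((h.dif_cont i hpi.le).mono (hcap.trans subset_closure))
  have hm := h.dif_pos i hpi (h.dif_nonneg i _ hpi) z (hcap hz)
  have := H (p i) p _ hpi rfl hm hball fun x hx => hzm hx
  have : 0 < κ * dif u i (p i) z / 2 := by positivity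
  linarith

lemma du_diff (h : Sol Ω u L) (j : Fin N) {x : E N} (hx : x ∈ Ω) :
    DifferentiableAt ℝ (fun y => fderiv ℝ u y (e j)) x := by
  have h1 : ContDiffAt ℝ 1 (fderiv ℝ u) x := (h.c2 x hx).fderiv_right (by norm_num)
  exact (h1.differentiableAt (by norm_num)).clm_apply (differentiableAt_const _)

lemma du_line (h : Sol Ω u L) (i j : Fin N) {x : E N} (hx : x ∈ Ω) :
    HasDerivAt (fun t : ℝ => fderiv ℝ u (x + t • e i) (e j)) (psec u i j x) 0 := by
  have h0 : x + (0 : ℝ) • e i = x := by simp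
  have h1 := (h.du_diff j hx).hasFDerivAt
  rw [← h0] at h1
  have h2 : HasDerivAt (fun s : ℝ => x + s • e i) (e i) 0 := by
    have := ((hasDerivAt_id' (0 : ℝ)).smul_const (e i)).const_add x
    simpa using this
  have h3 := h1.comp_hasDerivAt (0 : ℝ) h2
  rw [h0] at h3
  exact h3

lemma offdiag (h : Sol Ω u L) (hz : (0 : E N) ∈ Ω) {i j : Fin N} (hij : i ≠ j) :
    psec u i j 0 = 0 := by
  have h1 := h.du_line i j hz
  have hline : Continuous (fun t : ℝ => (0 : E N) + t • e i) := by fun_prop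
  have hev : ∀ᶠ t in nhds (0 : ℝ), (0 : E N) + t • e i ∈ Ω :=
    hline.continuousAt.eventually (h.isOpen.mem_nhds (by simpa using hz))
  have h2 : HasDerivAt (fun t : ℝ => fderiv ℝ u ((0 : E N) + t • e i) (e j)) 0 0 := by
    refine (hasDerivAt_const (0 : ℝ) (0 : ℝ)).congr_of_eventuallyEq ?_
    filter_upwards [hev] with t ht
    exact h.fderiv_zero j ht (by rw [add_smul_ne hij.symm]; rfl)
  exact h1.unique h2

lemma diag (h : Sol Ω u L) (hz : (0 : E N) ∈ Ω) (i : Fin N) : psec u i i 0 < 0 := by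
  obtain ⟨ε, hε, hεb⟩ := Metric.isOpen_iff.1 h.isOpen 0 hz
  set r := ε / 5 with hr
  have hr0 : 0 < r := by linarith
  have hin : ∀ x : E N, ‖x‖ ≤ 4 * r → x ∈ Ω := fun x hx =>
    hεb (by rw [mem_ball_zero_iff]; linarith)
  set K : Set (E N) := closedBall 0 (4 * r) ∩ {x | r / 4 ≤ x i} with hK
  have hKc : IsCompact K := (isCompact_closedBall _ _).inter_right
    (isClosed_le (f := fun _ : E N => r / 4) (g := fun x : E N => x i) continuous_const
      (by fun_prop))
  have hKΩ : K ⊆ Ω := fun x hx => hin x (by simpa using hx.1)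
  have hKne : K.Nonempty := by
    refine ⟨r • e i, ?_, ?_⟩
    · rw [mem_closedBall_zero_iff, norm_smul, norm_e, Real.norm_eq_abs, abs_of_pos hr0]; linarith
    · have := add_smul_same i (0 : E N) r
      rw [zero_add] at this
      change r / 4 ≤ (r • e i : E N) i
      rw [this]
      change r / 4 ≤ 0 + r
      linarith
  obtain ⟨z, hzK, hzm⟩ := hKc.exists_isMaxOn hKne
    (f := fun x => fderiv ℝ u x (e i))
    (fun x hx => (h.du_diff i (hKΩ hx)).continuousAt.continuousWithinAt)
  set m₀ := -(fderiv ℝ u z (e i)) with hm₀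
  have hm₀p : 0 < m₀ := by
    have hzi : r / 4 ≤ z i := hzK.2
    have := h.fderiv_neg i (hKΩ hzK) (by linarith)
    linarith
  have hKm : ∀ x ∈ K, fderiv ℝ u x (e i) ≤ -m₀ := by
    intro x hx
    have : fderiv ℝ u x (e i) ≤ fderiv ℝ u z (e i) := hzm hx
    linarith
  obtain ⟨κ, hκ, H⟩ := h.hopf_plane i hr0
  have hmain : ∀ l, 0 < l → l < r / 8 →
      fderiv ℝ u ((0 : E N) + l • e i) (e i) ≤ -(κ * m₀ * l) := by
    intro l hl hlr
    have hc : ‖(0 : E N) + l • e i + r • e i‖ = l + r := by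
      rw [zero_add, ← add_smul, norm_smul, norm_e, Real.norm_eq_abs, abs_of_pos (by linarith),
        mul_one]
    have hci : ((0 : E N) + l • e i + r • e i) i = l + r := by
      rw [add_smul_same, add_smul_same]; change 0 + l + r = l + r; ring
    have := H l ((0 : E N) + l • e i) (2 * l * m₀) hl
      (by rw [add_smul_same]; change 0 + l = l; ring) (by positivity) ?_ ?_
    · linarith
    · intro x hx
      apply hin
      rw [mem_closedBall, dist_eq_norm] at hx
      have := norm_le_norm_add_norm_sub' x ((0 : E N) + l • e i + r • e i)
      linarith
    · intro x hx
      rw [mem_closedBall, dist_eq_norm] at hx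
      have hxn := norm_le_norm_add_norm_sub' x ((0 : E N) + l • e i + r • e i)
      have hxi := (PiLp.norm_apply_le (x - ((0 : E N) + l • e i + r • e i)) i).trans hx
      rw [PiLp.sub_apply, hci, Real.norm_eq_abs] at hxi
      have hxi := (abs_le.1 hxi).1
      have hseg : ∀ s ∈ Icc (-(2 * l)) 0, x + s • e i ∈ K := by
        intro s hs
        refine ⟨?_, ?_⟩
        · rw [mem_closedBall_zero_iff]
          have h1 := norm_add_le x (s • e i)
          rw [norm_smul, norm_e, Real.norm_eq_abs, abs_of_nonpos hs.2] at h1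
          linarith [hs.1]
        · change r / 4 ≤ (x + s • e i) i
          rw [add_smul_same]
          linarith [hs.1]
      have hd : ∀ s ∈ Icc (-(2 * l)) 0, HasDerivAt (fun s : ℝ => u (x + s • e i))
          (fderiv ℝ u (x + s • e i) (e i)) s := fun s hs =>
        h.hasDerivAt_line i (hKΩ (hseg s hs))
      obtain ⟨s, hs, hsl⟩ := exists_hasDerivAt_eq_slope (fun s : ℝ => u (x + s • e i))
        (fun s => fderiv ℝ u (x + s • e i) (e i)) (by linarith : -(2 * l) < 0)
        (fun s hs => (hd s hs).continuousAt.continuousWithinAt)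
        (fun s hs => hd s (Ioo_subset_Icc_self hs))
      have h4 := hKm _ (hseg s (Ioo_subset_Icc_self hs))
      rw [hsl, div_le_iff₀ (by linarith)] at h4
      have hxΩ : x ∈ Ω := hin x (by linarith)
      unfold dif
      have h5 : u (refl i l x) = u (x + (-(2 * l)) • e i) := by
        rw [← h.symm i (h.refl_mem i hl.le hxΩ (by linarith))]
        refine congrArg u ?_
        ext k
        by_cases hk : k = i
        · subst hk; rw [refl_same, refl_same, add_smul_same]; ring
        · rw [refl_ne hk, refl_ne hk, add_smul_ne hk]
      rw [h5]
      have h6 : x + (0 : ℝ) • e i = x := by simp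
      rw [h6] at h4
      linarith
  have h1 := (h.du_line i i hz).neg
  have h2 := le_deriv_of_le (a := κ * m₀) h1 (by
    have := h.fderiv_zero i hz rfl
    simp [this]) (by
    filter_upwards [Ioo_mem_nhdsGT (by linarith : 0 < r / 8)] with l hl
    have := hmain l hl.1 hl.2
    change κ * m₀ * l ≤ -(fderiv ℝ u ((0 : E N) + l • e i) (e i))
    linarith)
  have : 0 < κ * m₀ := by positivity
  linarith

end Sol

lemma psec_eq {N : ℕ} {u : E N → ℝ} {x : E N} (hu : ContDiffAt ℝ 2 u x) (i : Fin N) :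
    iteratedDeriv 2 (fun t : ℝ => u (x + t • e i)) 0 = psec u i i x := by
  have h0 : x + (0 : ℝ) • e i = x := by simp
  have hl : ∀ t : ℝ, HasDerivAt (fun s : ℝ => x + s • e i) (e i) t := by
    intro t
    have := ((hasDerivAt_id' t).smul_const (e i)).const_add x
    simpa using this
  rw [iteratedDeriv_succ, iteratedDeriv_one]
  have hev : ∀ᶠ y in nhds x, DifferentiableAt ℝ u y := by
    filter_upwards [hu.eventually (by norm_num)] with y hy using hy.differentiableAt (by norm_num)
  have hline : Tendsto (fun t : ℝ => x + t • e i) (nhds 0) (nhds x) := by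
    have := (hl 0).continuousAt.tendsto
    rwa [h0] at this
  have h1 : deriv (fun t : ℝ => u (x + t • e i)) =ᶠ[nhds 0]
      fun t => fderiv ℝ u (x + t • e i) (e i) := by
    filter_upwards [hline.eventually hev] with t ht
    exact (ht.hasFDerivAt.comp_hasDerivAt t (hl t)).deriv
  rw [h1.deriv_eq]
  have h2 : DifferentiableAt ℝ (fun y => fderiv ℝ u y (e i)) x := by
    have h1 : ContDiffAt ℝ 1 (fderiv ℝ u) x := hu.fderiv_right (by norm_num)
    exact (h1.differentiableAt (by norm_num)).clm_apply (differentiableAt_const _)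
  have h3 := h2.hasFDerivAt
  rw [← h0] at h3
  have h4 := (h3.comp_hasDerivAt (0 : ℝ) (hl 0)).deriv
  rw [h0] at h4
  exact h4

end GNN

/-- Gidas–Ni–Nirenberg: in a bounded domain that is convex in every
coordinate direction and symmetric with respect to every coordinate hyperplane,
the Hessian at the origin of a positive solution vanishing on the boundary is
diagonal and strictly negative definite. -/
theorem gnn_hessian_diagonal_negative {N : ℕ}
    (Ω : Set (EuclideanSpace ℝ (Fin N))) (u : EuclideanSpace ℝ (Fin N) → ℝ) (f : ℝ → ℝ)
    (hopen : IsOpen Ω) (hbdd : Bornology.IsBounded Ω)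
    (h0 : (0 : EuclideanSpace ℝ (Fin N)) ∈ Ω)
    (hconv : ∀ i : Fin N, ∀ p ∈ Ω, ∀ q ∈ Ω, (∀ j : Fin N, j ≠ i → p j = q j) →
      segment ℝ p q ⊆ Ω)
    (hsym : ∀ i : Fin N, ∀ p ∈ Ω, ∀ q : EuclideanSpace ℝ (Fin N),
      q i = -(p i) → (∀ j : Fin N, j ≠ i → q j = p j) → q ∈ Ω)
    (hu2 : ContDiffOn ℝ 2 u Ω) (huc : ContinuousOn u (closure Ω))
    (hf : ContDiff ℝ 1 f)
    (hpde : ∀ x ∈ Ω, -(∑ i : Fin N, psec u i i x) = f (u x))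
    (hpos : ∀ x ∈ Ω, 0 < u x)
    (hbc : ∀ x ∈ frontier Ω, u x = 0) :
    (∀ i j : Fin N, i ≠ j → psec u i j 0 = 0) ∧ (∀ i : Fin N, psec u i i 0 < 0) := by
  have hc2 : ∀ x ∈ Ω, ContDiffAt ℝ 2 u x := fun x hx => hu2.contDiffAt (hopen.mem_nhds hx)
  have hlap : ∀ x ∈ Ω, GNN.lap u x = -f (u x) := by
    intro x hx
    rw [← hpde x hx, neg_neg]
    exact Finset.sum_congr rfl fun i _ => GNN.psec_eq (hc2 x hx) i
  obtain ⟨C, hC⟩ : ∃ C, ∀ x ∈ closure Ω, ‖u x‖ ≤ C :=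
    hbdd.isCompact_closure.exists_bound_of_continuousOn huc
  obtain ⟨L, hL⟩ := (hf.contDiffOn (s := Set.Icc (-C) C)).exists_lipschitzOnWith (by norm_num)
    (convex_Icc _ _) isCompact_Icc
  have hmem : ∀ x ∈ Ω, u x ∈ Set.Icc (-C) C := fun x hx =>
    abs_le.1 (hC x (subset_closure hx))
  have hS : GNN.Sol Ω u L :=
    { isOpen := hopen
      bdd := hbdd
      box1 := by
        intro i p hp q hq hqi
        have hr : GNN.refl i 0 p ∈ Ω := hsym i p hp _ (by rw [GNN.refl_same]; ring)
          fun j hj => GNN.refl_ne hj 0 p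
        refine hconv i p hp _ hr (fun j hj => (GNN.refl_ne hj 0 p).symm) ?_
        by_cases hpi : p i = 0
        · have : q = p := by
            ext j
            by_cases hj : j = i
            · subst hj
              rw [hpi, abs_zero] at hqi
              rw [hpi]
              exact abs_nonpos_iff.1 hqi
            · exact hq j hj
          rw [this]
          exact left_mem_segment ℝ _ _
        · have hle : |q i / p i| ≤ 1 := by
            rw [abs_div]
            exact div_le_one_of_le₀ hqi (abs_nonneg _)
          have hle := abs_le.1 hle
          refine ⟨(1 + q i / p i) / 2, (1 - q i / p i) / 2, by linarith, by linarith, by ring, ?_⟩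
          ext j
          rw [PiLp.add_apply, PiLp.smul_apply, PiLp.smul_apply, smul_eq_mul, smul_eq_mul]
          by_cases hj : j = i
          · subst hj
            rw [GNN.refl_same]
            field_simp
            ring
          · rw [GNN.refl_ne hj, hq j hj]
            ring
      c2 := hc2
      cont := huc
      L0 := L.2
      lip := by
        intro x hx y hy
        rw [hlap x hx, hlap y hy]
        have := hL.dist_le_mul _ (hmem x hx) _ (hmem y hy)
        rw [Real.dist_eq, Real.dist_eq] at this
        have h1 : -f (u x) - -f (u y) = -(f (u x) - f (u y)) := by ring
        rw [h1, abs_neg]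
        exact this
      pos := hpos
      bc := hbc }
  exact ⟨fun i j hij => hS.offdiag h0 hij, fun i => hS.diag h0 i⟩
end

section
/- Let Ω ⊂ ℝ² be a smooth bounded domain, and for each λ > 0 in an interval (0, λ̄) let u_λ be a smooth solution of -Δu_λ = λ e^{u_λ} in Ω with u_λ = 0 on ∂Ω, satisfying λ ∫_Ω e^{u_λ} → 8π as λ → 0⁺. For each λ let x_λ ∈ Ω be a point where u_λ attains its maximum over Ω̄. Then there exists λ₀ > 0 such that for every λ ∈ (0, λ₀), x_λ is a nondegenerate critical point of u_λ, i.e. the Hessian matrix of u_λ at x_λ is invertible. -/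
open Filter Metric Set

/-- Partial derivative in the first variable. -/
noncomputable def pdx (u : ℝ → ℝ → ℝ) : ℝ → ℝ → ℝ := fun x y => deriv (fun t => u t y) x

/-- Partial derivative in the second variable. -/
noncomputable def pdy (u : ℝ → ℝ → ℝ) : ℝ → ℝ → ℝ := fun x y => deriv (fun t => u x t) y

/-- `pd u i j = ∂^(i+j) u / ∂x^i ∂y^j`. -/
noncomputable def pd (u : ℝ → ℝ → ℝ) (i j : ℕ) : ℝ → ℝ → ℝ := pdx^[i] (pdy^[j] u)

/-- The open unit ball of `ℝ²`. -/
def B1 : Set (ℝ × ℝ) := Metric.ball (0 : ℝ × ℝ) 1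

/-- Real part of `(x+iy)^n`. -/
noncomputable def ReZ (n : ℕ) (x y : ℝ) : ℝ := (((x : ℂ) + (y : ℂ) * Complex.I) ^ n).re

/-- Imaginary part of `(x+iy)^n`. -/
noncomputable def ImZ (n : ℕ) (x y : ℝ) : ℝ := (((x : ℂ) + (y : ℂ) * Complex.I) ^ n).im


/-- Directional derivative along the first axis. -/
noncomputable def gDx (f : ℝ × ℝ → ℝ) : ℝ × ℝ → ℝ := fun p => fderiv ℝ f p (1, 0)

/-- Directional derivative along the second axis. -/
noncomputable def gDy (f : ℝ × ℝ → ℝ) : ℝ × ℝ → ℝ := fun p => fderiv ℝ f p (0, 1)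

/-- Laplacian. -/
noncomputable def gLap (f : ℝ × ℝ → ℝ) : ℝ × ℝ → ℝ := fun p => gDx (gDx f) p + gDy (gDy f) p

lemma gDx_contDiffAt {n : ℕ} {f : ℝ × ℝ → ℝ} {p : ℝ × ℝ} (hf : ContDiffAt ℝ ((n + 1 : ℕ) : WithTop ℕ∞) f p) :
    ContDiffAt ℝ (n : WithTop ℕ∞) (gDx f) p := by
  unfold gDx
  exact (hf.fderiv_right (m := (n : WithTop ℕ∞)) (by norm_cast)).clm_apply contDiffAt_const

lemma gDy_contDiffAt {n : ℕ} {f : ℝ × ℝ → ℝ} {p : ℝ × ℝ} (hf : ContDiffAt ℝ ((n + 1 : ℕ) : WithTop ℕ∞) f p) :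
    ContDiffAt ℝ (n : WithTop ℕ∞) (gDy f) p := by
  unfold gDy
  exact (hf.fderiv_right (m := (n : WithTop ℕ∞)) (by norm_cast)).clm_apply contDiffAt_const

lemma gDx_contDiff {n : ℕ} {f : ℝ × ℝ → ℝ} (hf : ContDiff ℝ ((n + 1 : ℕ) : WithTop ℕ∞) f) :
    ContDiff ℝ (n : WithTop ℕ∞) (gDx f) :=
  contDiff_iff_contDiffAt.2 fun _ => gDx_contDiffAt hf.contDiffAt

lemma gDy_contDiff {n : ℕ} {f : ℝ × ℝ → ℝ} (hf : ContDiff ℝ ((n + 1 : ℕ) : WithTop ℕ∞) f) :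
    ContDiff ℝ (n : WithTop ℕ∞) (gDy f) :=
  contDiff_iff_contDiffAt.2 fun _ => gDy_contDiffAt hf.contDiffAt

lemma gDx_congr {f g : ℝ × ℝ → ℝ} {p : ℝ × ℝ} (h : f =ᶠ[nhds p] g) : gDx f =ᶠ[nhds p] gDx g := by
  filter_upwards [h.eventuallyEq_nhds] with q hq
  simp only [gDx, hq.fderiv_eq]

lemma gDy_congr {f g : ℝ × ℝ → ℝ} {p : ℝ × ℝ} (h : f =ᶠ[nhds p] g) : gDy f =ᶠ[nhds p] gDy g := by
  filter_upwards [h.eventuallyEq_nhds] with q hq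
  simp only [gDy, hq.fderiv_eq]

lemma gLap_congr {f g : ℝ × ℝ → ℝ} {p : ℝ × ℝ} (h : f =ᶠ[nhds p] g) : gLap f =ᶠ[nhds p] gLap g := by
  filter_upwards [gDx_congr (gDx_congr h), gDy_congr (gDy_congr h)] with q h1 h2
  simp only [gLap, h1, h2]

lemma gDx_comp {b : ℝ → ℝ} {b' : ℝ} {f : ℝ × ℝ → ℝ} {p : ℝ × ℝ} (hb : HasDerivAt b b' (f p))
    (hf : DifferentiableAt ℝ f p) : gDx (fun q => b (f q)) p = b' * gDx f p := by
  have := (hb.comp_hasFDerivAt p hf.hasFDerivAt).fderiv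
  simp only [gDx]
  rw [show (fun q => b (f q)) = b ∘ f from rfl, this]; simp

lemma gDy_comp {b : ℝ → ℝ} {b' : ℝ} {f : ℝ × ℝ → ℝ} {p : ℝ × ℝ} (hb : HasDerivAt b b' (f p))
    (hf : DifferentiableAt ℝ f p) : gDy (fun q => b (f q)) p = b' * gDy f p := by
  have := (hb.comp_hasFDerivAt p hf.hasFDerivAt).fderiv
  simp only [gDy]
  rw [show (fun q => b (f q)) = b ∘ f from rfl, this]; simp

lemma gDx_mul {f g : ℝ × ℝ → ℝ} {p : ℝ × ℝ} (hf : DifferentiableAt ℝ f p)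
    (hg : DifferentiableAt ℝ g p) : gDx (fun q => f q * g q) p = gDx f p * g p + f p * gDx g p := by
  simp only [gDx]; rw [fderiv_fun_mul hf hg]; simp; ring

lemma gDy_mul {f g : ℝ × ℝ → ℝ} {p : ℝ × ℝ} (hf : DifferentiableAt ℝ f p)
    (hg : DifferentiableAt ℝ g p) : gDy (fun q => f q * g q) p = gDy f p * g p + f p * gDy g p := by
  simp only [gDy]; rw [fderiv_fun_mul hf hg]; simp; ring

lemma gDxy_symm {f : ℝ × ℝ → ℝ} {p : ℝ × ℝ} (hf : ContDiffAt ℝ 2 f p) :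
    gDx (gDy f) p = gDy (gDx f) p := by
  have hs : IsSymmSndFDerivAt ℝ f p := hf.isSymmSndFDerivAt (by simp)
  have hd : DifferentiableAt ℝ (fderiv ℝ f) p :=
    (hf.fderiv_right (m := 1) (by norm_num)).differentiableAt (by norm_num)
  have h1 : ∀ v : ℝ × ℝ, fderiv ℝ (fun q => fderiv ℝ f q v) p = (fderiv ℝ (fderiv ℝ f) p).flip v := by
    intro v
    rw [fderiv_clm_apply hd (differentiableAt_const v)]
    simp
  unfold gDx gDy
  rw [h1, h1]
  exact hs.eq _ _

/-- Laplacian of a composition. -/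
lemma gLap_comp {b b1 b2 : ℝ → ℝ} {f : ℝ × ℝ → ℝ} {p : ℝ × ℝ}
    (hb : ∀ s, HasDerivAt b (b1 s) s) (hb1 : ∀ s, HasDerivAt b1 (b2 s) s)
    (hf : ContDiffAt ℝ 2 f p) :
    gLap (fun q => b (f q)) p =
      b1 (f p) * gLap f p + b2 (f p) * ((gDx f p) ^ 2 + (gDy f p) ^ 2) := by
  have hev : ∀ᶠ q in nhds p, DifferentiableAt ℝ f q := by
    filter_upwards [hf.eventually (by simp)] with q hq using hq.differentiableAt (by norm_num)
  have hx : DifferentiableAt ℝ (gDx f) p := (gDx_contDiffAt (n := 1) hf).differentiableAt (by norm_num)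
  have hy : DifferentiableAt ℝ (gDy f) p := (gDy_contDiffAt (n := 1) hf).differentiableAt (by norm_num)
  have hfp := hf.differentiableAt (by norm_num)
  have hbf : DifferentiableAt ℝ (fun q => b1 (f q)) p :=
    (hb1 (f p)).differentiableAt.comp p hfp
  have e1 : gDx (fun q => b (f q)) =ᶠ[nhds p] fun q => b1 (f q) * gDx f q := by
    filter_upwards [hev] with q hq using gDx_comp (hb _) hq
  have e2 : gDy (fun q => b (f q)) =ᶠ[nhds p] fun q => b1 (f q) * gDy f q := by
    filter_upwards [hev] with q hq using gDy_comp (hb _) hq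
  simp only [gLap]
  rw [(gDx_congr e1).eq_of_nhds, (gDy_congr e2).eq_of_nhds, gDx_mul hbf hx, gDy_mul hbf hy,
    gDx_comp (hb1 _) hfp, gDy_comp (hb1 _) hfp]
  ring

lemma gDx_hcs {f : ℝ × ℝ → ℝ} (hf : HasCompactSupport f) : HasCompactSupport (gDx f) :=
  hf.fderiv_apply (𝕜 := ℝ) (1, 0)

lemma gDy_hcs {f : ℝ × ℝ → ℝ} (hf : HasCompactSupport f) : HasCompactSupport (gDy f) :=
  hf.fderiv_apply (𝕜 := ℝ) (0, 1)

lemma ibp_gDx {f g : ℝ × ℝ → ℝ} (hf : ContDiff ℝ 1 f) (hg : ContDiff ℝ 1 g)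
    (hc : HasCompactSupport g) :
    ∫ p, gDx f p * g p = - ∫ p, f p * gDx g p := by
  have cf := hf.continuous
  have cg := hg.continuous
  have cf' : Continuous (gDx f) := (gDx_contDiff (n := 0) hf).continuous
  have cg' : Continuous (gDx g) := (gDx_contDiff (n := 0) hg).continuous
  have := integral_mul_fderiv_eq_neg_fderiv_mul_of_integrable (μ := MeasureTheory.volume)
    (f := f) (g := g) (v := ((1 : ℝ), (0 : ℝ)))
    ((cf'.mul cg).integrable_of_hasCompactSupport hc.mul_left)
    ((cf.mul cg').integrable_of_hasCompactSupport (gDx_hcs hc).mul_left)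
    ((cf.mul cg).integrable_of_hasCompactSupport hc.mul_left)
    (fun x _ => (hf.differentiable (by norm_num)) x) (fun x _ => (hg.differentiable (by norm_num)) x)
  simp only [gDx]
  linarith

lemma ibp_gDy {f g : ℝ × ℝ → ℝ} (hf : ContDiff ℝ 1 f) (hg : ContDiff ℝ 1 g)
    (hc : HasCompactSupport g) :
    ∫ p, gDy f p * g p = - ∫ p, f p * gDy g p := by
  have cf := hf.continuous
  have cg := hg.continuous
  have cf' : Continuous (gDy f) := (gDy_contDiff (n := 0) hf).continuous
  have cg' : Continuous (gDy g) := (gDy_contDiff (n := 0) hg).continuous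
  have := integral_mul_fderiv_eq_neg_fderiv_mul_of_integrable (μ := MeasureTheory.volume)
    (f := f) (g := g) (v := ((0 : ℝ), (1 : ℝ)))
    ((cf'.mul cg).integrable_of_hasCompactSupport hc.mul_left)
    ((cf.mul cg').integrable_of_hasCompactSupport (gDy_hcs hc).mul_left)
    ((cf.mul cg).integrable_of_hasCompactSupport hc.mul_left)
    (fun x _ => (hf.differentiable (by norm_num)) x) (fun x _ => (hg.differentiable (by norm_num)) x)
  simp only [gDy]
  linarith

lemma ibp_xx {f g : ℝ × ℝ → ℝ} (hf : ContDiff ℝ 2 f) (hg : ContDiff ℝ 2 g)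
    (hc : HasCompactSupport g) :
    ∫ p, gDx (gDx f) p * g p = ∫ p, f p * gDx (gDx g) p := by
  rw [ibp_gDx (gDx_contDiff (n := 1) hf) (hg.of_le (by norm_num)) hc,
    ibp_gDx (hf.of_le (by norm_num)) (gDx_contDiff (n := 1) hg) (gDx_hcs hc), neg_neg]

lemma ibp_yy {f g : ℝ × ℝ → ℝ} (hf : ContDiff ℝ 2 f) (hg : ContDiff ℝ 2 g)
    (hc : HasCompactSupport g) :
    ∫ p, gDy (gDy f) p * g p = ∫ p, f p * gDy (gDy g) p := by
  rw [ibp_gDy (gDy_contDiff (n := 1) hf) (hg.of_le (by norm_num)) hc,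
    ibp_gDy (hf.of_le (by norm_num)) (gDy_contDiff (n := 1) hg) (gDy_hcs hc), neg_neg]

lemma ibp_xy {f g : ℝ × ℝ → ℝ} (hf : ContDiff ℝ 2 f) (hg : ContDiff ℝ 2 g)
    (hc : HasCompactSupport g) :
    ∫ p, gDx (gDy f) p * g p = ∫ p, f p * gDy (gDx g) p := by
  rw [ibp_gDx (gDy_contDiff (n := 1) hf) (hg.of_le (by norm_num)) hc,
    ibp_gDy (hf.of_le (by norm_num)) (gDx_contDiff (n := 1) hg) (gDx_hcs hc), neg_neg]

lemma gLap_continuous {f : ℝ × ℝ → ℝ} (hf : ContDiff ℝ 2 f) : Continuous (gLap f) :=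
  (gDx_contDiff (n := 0) (gDx_contDiff (n := 1) hf)).continuous.add
    (gDy_contDiff (n := 0) (gDy_contDiff (n := 1) hf)).continuous

lemma gLap_hcs {f : ℝ × ℝ → ℝ} (hf : HasCompactSupport f) : HasCompactSupport (gLap f) :=
  (gDx_hcs (gDx_hcs hf)).add (gDy_hcs (gDy_hcs hf))

lemma ibp_lap {f g : ℝ × ℝ → ℝ} (hf : ContDiff ℝ 2 f) (hg : ContDiff ℝ 2 g)
    (hc : HasCompactSupport g) :
    ∫ p, gLap f p * g p = ∫ p, f p * gLap g p := by
  have cxx : ∀ {f : ℝ × ℝ → ℝ}, ContDiff ℝ 2 f → Continuous (gDx (gDx f)) := fun h =>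
    (gDx_contDiff (n := 0) (gDx_contDiff (n := 1) h)).continuous
  have cyy : ∀ {f : ℝ × ℝ → ℝ}, ContDiff ℝ 2 f → Continuous (gDy (gDy f)) := fun h =>
    (gDy_contDiff (n := 0) (gDy_contDiff (n := 1) h)).continuous
  simp only [gLap, add_mul, mul_add]
  rw [MeasureTheory.integral_add, MeasureTheory.integral_add, ibp_xx hf hg hc, ibp_yy hf hg hc]
  · exact (hf.continuous.mul (cxx hg)).integrable_of_hasCompactSupport (gDx_hcs (gDx_hcs hc)).mul_left
  · exact (hf.continuous.mul (cyy hg)).integrable_of_hasCompactSupport (gDy_hcs (gDy_hcs hc)).mul_left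
  · exact ((cxx hf).mul hg.continuous).integrable_of_hasCompactSupport hc.mul_left
  · exact ((cyy hf).mul hg.continuous).integrable_of_hasCompactSupport hc.mul_left

/-- Relation of the frozen iterated partial derivatives with `gDx`, `gDy`. -/
lemma pdx_eq {u : ℝ → ℝ → ℝ} {p : ℝ × ℝ}
    (h : DifferentiableAt ℝ (fun q : ℝ × ℝ => u q.1 q.2) p) :
    pdx u p.1 p.2 = gDx (fun q => u q.1 q.2) p := by
  have h1 : HasFDerivAt (fun q : ℝ × ℝ => u q.1 q.2) _ (p.1, p.2) := h.hasFDerivAt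
  have h2 : HasDerivAt (fun t : ℝ => (t, p.2)) ((1 : ℝ), (0 : ℝ)) p.1 :=
    (hasDerivAt_id _).prodMk (hasDerivAt_const _ _)
  exact (h1.comp_hasDerivAt p.1 h2).deriv

lemma pdy_eq {u : ℝ → ℝ → ℝ} {p : ℝ × ℝ}
    (h : DifferentiableAt ℝ (fun q : ℝ × ℝ => u q.1 q.2) p) :
    pdy u p.1 p.2 = gDy (fun q => u q.1 q.2) p := by
  have h1 : HasFDerivAt (fun q : ℝ × ℝ => u q.1 q.2) _ (p.1, p.2) := h.hasFDerivAt
  have h2 : HasDerivAt (fun t : ℝ => (p.1, t)) ((0 : ℝ), (1 : ℝ)) p.2 :=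
    (hasDerivAt_const _ _).prodMk (hasDerivAt_id _)
  exact (h1.comp_hasDerivAt p.2 h2).deriv

lemma pd_eqs {u : ℝ → ℝ → ℝ} {p : ℝ × ℝ} (h : ContDiffAt ℝ 2 (fun q : ℝ × ℝ => u q.1 q.2) p) :
    pd u 2 0 p.1 p.2 = gDx (gDx (fun q => u q.1 q.2)) p ∧
    pd u 0 2 p.1 p.2 = gDy (gDy (fun q => u q.1 q.2)) p ∧
    pd u 1 1 p.1 p.2 = gDx (gDy (fun q => u q.1 q.2)) p := by
  have hev : ∀ᶠ q in nhds p, DifferentiableAt ℝ (fun q : ℝ × ℝ => u q.1 q.2) q := by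
    filter_upwards [h.eventually (by simp)] with q hq using hq.differentiableAt (by norm_num)
  have ex : (fun q : ℝ × ℝ => pdx u q.1 q.2) =ᶠ[nhds p] gDx (fun q => u q.1 q.2) := by
    filter_upwards [hev] with q hq using pdx_eq hq
  have ey : (fun q : ℝ × ℝ => pdy u q.1 q.2) =ᶠ[nhds p] gDy (fun q => u q.1 q.2) := by
    filter_upwards [hev] with q hq using pdy_eq hq
  have hx : DifferentiableAt ℝ (fun q : ℝ × ℝ => pdx u q.1 q.2) p :=
    ((gDx_contDiffAt (n := 1) h).differentiableAt (by norm_num)).congr_of_eventuallyEq ex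
  have hy : DifferentiableAt ℝ (fun q : ℝ × ℝ => pdy u q.1 q.2) p :=
    ((gDy_contDiffAt (n := 1) h).differentiableAt (by norm_num)).congr_of_eventuallyEq ey
  refine ⟨?_, ?_, ?_⟩
  · rw [← (gDx_congr ex).eq_of_nhds, ← pdx_eq hx]; rfl
  · rw [← (gDy_congr ey).eq_of_nhds, ← pdy_eq hy]; rfl
  · rw [← (gDx_congr ey).eq_of_nhds, ← pdx_eq hy]; rfl


/-- The squared Euclidean norm. -/
noncomputable def gN (p : ℝ × ℝ) : ℝ := p.1 ^ 2 + p.2 ^ 2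

/-- A radial smooth bump on the unit disc. -/
noncomputable def gEta (p : ℝ × ℝ) : ℝ := Real.smoothTransition (1 - gN p)

lemma gN_contDiff {n : WithTop ℕ∞} : ContDiff ℝ n gN := by
  unfold gN; fun_prop

lemma gEta_contDiff {n : ℕ∞} : ContDiff ℝ n gEta := by
  unfold gEta
  exact Real.smoothTransition.contDiff.comp (contDiff_const.sub gN_contDiff)

lemma gEta_zero {p : ℝ × ℝ} (h : 1 ≤ gN p) : gEta p = 0 :=
  Real.smoothTransition.zero_of_nonpos (by linarith)

lemma gEta_nonneg (p : ℝ × ℝ) : 0 ≤ gEta p := Real.smoothTransition.nonneg _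

lemma norm_sq_le_gN (p : ℝ × ℝ) : ‖p‖ ^ 2 ≤ gN p := by
  unfold gN
  rw [Prod.norm_def]
  rcases max_choice ‖p.1‖ ‖p.2‖ with h | h <;> rw [h] <;> simp [sq_nonneg]

lemma gN_le_norm_sq (p : ℝ × ℝ) : gN p ≤ 2 * ‖p‖ ^ 2 := by
  unfold gN
  have h1 : |p.1| ≤ ‖p‖ := norm_fst_le p
  have h2 : |p.2| ≤ ‖p‖ := norm_snd_le p
  have := sq_le_sq' (by linarith [abs_nonneg p.1, norm_nonneg p]) h1
  have := sq_le_sq' (by linarith [abs_nonneg p.2, norm_nonneg p]) h2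
  rw [sq_abs] at *
  linarith

lemma gEta_hcs : HasCompactSupport gEta := by
  refine HasCompactSupport.intro (isCompact_closedBall (0 : ℝ × ℝ) 1) fun p hp => gEta_zero ?_
  rw [mem_closedBall_zero_iff, not_le] at hp
  nlinarith [norm_sq_le_gN p]

lemma gEta_integral_pos : 0 < ∫ p, gEta p := by
  refine (gEta_contDiff (n := 0)).continuous.integral_pos_of_hasCompactSupport_nonneg_nonzero
    gEta_hcs gEta_nonneg (x := 0) ?_
  simp [gEta, gN]

/-- Polar coordinates for functions supported in the unit disc. -/
lemma polar_disc {f : ℝ × ℝ → ℝ} (hf : Continuous f) (h0 : ∀ p, 1 ≤ gN p → f p = 0) :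
    ∫ p, f p = ∫ r in Ioo (0 : ℝ) 1, ∫ t in Ioo (-Real.pi) Real.pi,
      r * f (r * Real.cos t, r * Real.sin t) := by
  rw [← integral_comp_polarCoord_symm f, polarCoord_target]
  have hc : Continuous fun p : ℝ × ℝ => p.1 * f (p.1 * Real.cos p.2, p.1 * Real.sin p.2) := by
    fun_prop
  have e1 : ∫ p in Ioi (0 : ℝ) ×ˢ Ioo (-Real.pi) Real.pi, p.1 • f (polarCoord.symm p) =
      ∫ p in Ioo (0 : ℝ) 1 ×ˢ Ioo (-Real.pi) Real.pi,
        p.1 * f (p.1 * Real.cos p.2, p.1 * Real.sin p.2) := by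
    refine MeasureTheory.setIntegral_eq_of_subset_of_forall_sdiff_eq_zero
      ((measurableSet_Ioi (a := (0 : ℝ))).prod (measurableSet_Ioo (a := -Real.pi) (b := Real.pi))) ?_ ?_
    · exact prod_mono Ioo_subset_Ioi_self subset_rfl
    · rintro ⟨r, t⟩ ⟨⟨h1, h2⟩, h3⟩
      simp only [mem_Ioi, mem_Ioo, mem_prod, not_and, not_lt] at h1 h2 h3
      have hr : 1 ≤ r := by
        by_contra hr
        exact absurd h2.2 (not_lt.2 (h3 ⟨h1, not_le.1 hr⟩ h2.1))
      simp only
      rw [h0, smul_zero]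
      simp only [gN, polarCoord_symm_apply]
      have := Real.sin_sq_add_cos_sq t
      have e : (r * Real.cos t) ^ 2 + (r * Real.sin t) ^ 2 = r ^ 2 := by
        linear_combination r ^ 2 * this
      rw [e]; nlinarith
  rw [e1, MeasureTheory.Measure.volume_eq_prod, MeasureTheory.setIntegral_prod]
  rw [← MeasureTheory.Measure.volume_eq_prod]
  exact (hc.continuousOn.integrableOn_compact (isCompact_Icc.prod isCompact_Icc)).mono_set
    (prod_mono Ioo_subset_Icc_self Ioo_subset_Icc_self)

lemma circle_mean {A B : ℝ × ℝ → ℝ} (hA : ContDiff ℝ 1 A) (hB : ContDiff ℝ 1 B)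
    (hCR : ∀ p, gN p < 1 → gDx A p = gDy B p ∧ gDy A p = - gDx B p) {r : ℝ} (hr : r ∈ Ioo (0 : ℝ) 1) :
    ∫ t in Ioo (-Real.pi) Real.pi, A (r * Real.cos t, r * Real.sin t) = 2 * Real.pi * A 0 := by
  set F : ℂ → ℂ := fun z => (A (z.re, z.im) : ℂ) + Complex.I * (B (z.re, z.im) : ℂ) with hF
  have hcA := hA.continuous
  have hcB := hB.continuous
  have hcF : Continuous F := by
    rw [hF]; fun_prop
  have hdiff : ∀ z ∈ ball (0 : ℂ) |r| \ ∅, DifferentiableAt ℂ F z := by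
    rintro z ⟨hz, -⟩
    rw [mem_ball_zero_iff, abs_of_pos hr.1] at hz
    have hN : gN (z.re, z.im) < 1 := by
      have : gN (z.re, z.im) = ‖z‖ ^ 2 := by
        rw [Complex.sq_norm, Complex.normSq_apply]; simp [gN]; ring
      rw [this]
      nlinarith [norm_nonneg z, hr.2, hr.1]
    have hL : HasFDerivAt (fun z : ℂ => (z.re, z.im)) (Complex.reCLM.prod Complex.imCLM) z :=
      (Complex.reCLM.hasFDerivAt).prodMk (Complex.imCLM.hasFDerivAt)
    have hAz := ((hA.differentiable (by norm_num)) (z.re, z.im)).hasFDerivAt.comp z hL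
    have hBz := ((hB.differentiable (by norm_num)) (z.re, z.im)).hasFDerivAt.comp z hL
    have hFz := (Complex.ofRealCLM.hasFDerivAt.comp z hAz).add
      ((Complex.ofRealCLM.hasFDerivAt.comp z hBz).const_mul Complex.I)
    have hFz' : HasFDerivAt F _ z := hFz
    rw [differentiableAt_complex_iff_differentiableAt_real]
    refine ⟨hFz'.differentiableAt, ?_⟩
    rw [hFz'.fderiv]
    obtain ⟨h1, h2⟩ := hCR _ hN
    simp only [gDx, gDy] at h1 h2
    have e0 : ((Complex.reCLM.prod Complex.imCLM) (1 : ℂ)) = ((1 : ℝ), (0 : ℝ)) := by simp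
    have e1 : ((Complex.reCLM.prod Complex.imCLM) Complex.I) = ((0 : ℝ), (1 : ℝ)) := by simp
    simp only [add_apply, ContinuousLinearMap.comp_apply,
      smul_apply, e0, e1, h1, h2]
    apply Complex.ext <;> simp
  have hm := circleAverage_of_differentiable_on_off_countable (c := 0) (R := r) countable_empty
    hcF.continuousOn hdiff
  rw [Real.circleAverage_eq_integral_add (-Real.pi)] at hm
  have hpi := Real.pi_pos
  have e2 : ∫ t in (0 : ℝ)..2 * Real.pi, F (circleMap 0 r (t + -Real.pi)) =
      ∫ t in (-Real.pi)..Real.pi, F (circleMap 0 r t) := by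
    rw [intervalIntegral.integral_comp_add_right (fun t => F (circleMap 0 r t))]
    congr 1 <;> ring
  rw [e2] at hm
  have hre := congrArg Complex.re hm
  have e3 : (∫ t in (-Real.pi)..Real.pi, F (circleMap 0 r t)).re =
      ∫ t in (-Real.pi)..Real.pi, A (r * Real.cos t, r * Real.sin t) := by
    have := Complex.reCLM.intervalIntegral_comp_comm (μ := MeasureTheory.volume)
      (((hcF.comp (continuous_circleMap 0 r))).intervalIntegrable (-Real.pi) Real.pi)
    simp only [Complex.reCLM_apply] at this
    rw [show (∫ t in (-Real.pi)..Real.pi, F (circleMap 0 r t)).re = _ from this.symm]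
    congr 1
    ext t
    simp [hF, circleMap, Complex.exp_re, Complex.exp_im]
  have e4 : (F 0).re = A 0 := by simp [hF]; rfl
  rw [Complex.smul_re, e3, e4, smul_eq_mul] at hre
  rw [← MeasureTheory.integral_Ioc_eq_integral_Ioo, ← intervalIntegral.integral_of_le (by linarith)]
  field_simp at hre
  linarith

lemma mean_value {A B : ℝ × ℝ → ℝ} (hA : ContDiff ℝ 1 A) (hB : ContDiff ℝ 1 B)
    (hCR : ∀ p, gN p < 1 → gDx A p = gDy B p ∧ gDy A p = - gDx B p) :
    ∫ p, A p * gEta p = A 0 * ∫ p, gEta p := by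
  have hce : Continuous gEta := (gEta_contDiff (n := 0)).continuous
  rw [polar_disc (f := fun p => A p * gEta p) (hA.continuous.mul hce) (fun p hp => by rw [gEta_zero hp, mul_zero]),
    polar_disc hce (fun p hp => gEta_zero hp), ← MeasureTheory.integral_const_mul]
  refine MeasureTheory.setIntegral_congr_fun measurableSet_Ioo fun r hr => ?_
  have he : ∀ t, gEta (r * Real.cos t, r * Real.sin t) = Real.smoothTransition (1 - r ^ 2) := by
    intro t
    simp only [gEta, gN]
    congr 2
    linear_combination r ^ 2 * (Real.sin_sq_add_cos_sq t)
  have hpi := Real.pi_pos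
  simp only [he]
  have : ∀ t : ℝ, r * (A (r * Real.cos t, r * Real.sin t) * Real.smoothTransition (1 - r ^ 2)) =
    (r * Real.smoothTransition (1 - r ^ 2)) * A (r * Real.cos t, r * Real.sin t) := fun t => by ring
  simp only [this]
  rw [MeasureTheory.integral_const_mul, circle_mean hA hB hCR hr]
  simp only [MeasureTheory.setIntegral_const, smul_eq_mul, MeasureTheory.measureReal_def, Real.volume_Ioo]
  rw [ENNReal.toReal_ofReal (by linarith)]
  ring


lemma gDx_sub {f g : ℝ × ℝ → ℝ} {p : ℝ × ℝ} (hf : DifferentiableAt ℝ f p)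
    (hg : DifferentiableAt ℝ g p) : gDx (fun q => f q - g q) p = gDx f p - gDx g p := by
  simp only [gDx]; rw [fderiv_fun_sub hf hg]; simp

lemma gDy_sub {f g : ℝ × ℝ → ℝ} {p : ℝ × ℝ} (hf : DifferentiableAt ℝ f p)
    (hg : DifferentiableAt ℝ g p) : gDy (fun q => f q - g q) p = gDy f p - gDy g p := by
  simp only [gDy]; rw [fderiv_fun_sub hf hg]; simp

lemma gDx_add {f g : ℝ × ℝ → ℝ} {p : ℝ × ℝ} (hf : DifferentiableAt ℝ f p)
    (hg : DifferentiableAt ℝ g p) : gDx (fun q => f q + g q) p = gDx f p + gDx g p := by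
  simp only [gDx]; rw [fderiv_fun_add hf hg]; simp

lemma gDy_add {f g : ℝ × ℝ → ℝ} {p : ℝ × ℝ} (hf : DifferentiableAt ℝ f p)
    (hg : DifferentiableAt ℝ g p) : gDy (fun q => f q + g q) p = gDy f p + gDy g p := by
  simp only [gDy]; rw [fderiv_fun_add hf hg]; simp

lemma gDx_cmul (c : ℝ) {f : ℝ × ℝ → ℝ} {p : ℝ × ℝ} (hf : DifferentiableAt ℝ f p) :
    gDx (fun q => c * f q) p = c * gDx f p := by
  simp only [gDx]; rw [fderiv_const_mul hf]; simp

lemma gDy_cmul (c : ℝ) {f : ℝ × ℝ → ℝ} {p : ℝ × ℝ} (hf : DifferentiableAt ℝ f p) :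
    gDy (fun q => c * f q) p = c * gDy f p := by
  simp only [gDy]; rw [fderiv_const_mul hf]; simp

/-- Four times the real part of the holomorphic (Schwarzian) quantity `v_zz - v_z ^ 2 / 2`. -/
noncomputable def gA (v : ℝ × ℝ → ℝ) (p : ℝ × ℝ) : ℝ :=
  (gDx (gDx v) p - gDy (gDy v) p) - (1 / 2) * (gDx v p * gDx v p - gDy v p * gDy v p)

/-- Minus four times its imaginary part. -/
noncomputable def gB (v : ℝ × ℝ → ℝ) (p : ℝ × ℝ) : ℝ :=
  2 * gDx (gDy v) p - gDx v p * gDy v p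

lemma gA_contDiff {v : ℝ × ℝ → ℝ} (hv : ContDiff ℝ 3 v) : ContDiff ℝ 1 (gA v) := by
  have h1 : ContDiff ℝ 2 (gDx v) := gDx_contDiff (n := 2) hv
  have h2 : ContDiff ℝ 2 (gDy v) := gDy_contDiff (n := 2) hv
  have h3 : ContDiff ℝ 1 (gDx (gDx v)) := gDx_contDiff (n := 1) h1
  have h4 : ContDiff ℝ 1 (gDy (gDy v)) := gDy_contDiff (n := 1) h2
  have h1' := h1.of_le (show (1 : WithTop ℕ∞) ≤ 2 by norm_num)
  have h2' := h2.of_le (show (1 : WithTop ℕ∞) ≤ 2 by norm_num)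
  unfold gA
  fun_prop

lemma gB_contDiff {v : ℝ × ℝ → ℝ} (hv : ContDiff ℝ 3 v) : ContDiff ℝ 1 (gB v) := by
  have h1 : ContDiff ℝ 2 (gDx v) := gDx_contDiff (n := 2) hv
  have h2 : ContDiff ℝ 2 (gDy v) := gDy_contDiff (n := 2) hv
  have h3 : ContDiff ℝ 1 (gDx (gDy v)) := gDx_contDiff (n := 1) h2
  have h1' := h1.of_le (show (1 : WithTop ℕ∞) ≤ 2 by norm_num)
  have h2' := h2.of_le (show (1 : WithTop ℕ∞) ≤ 2 by norm_num)
  unfold gB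
  fun_prop

/-- The Cauchy-Riemann equations for `gA`, `gB`. -/
lemma gAB_CR {v : ℝ × ℝ → ℝ} (hv : ContDiff ℝ 3 v) {k : ℝ} {p : ℝ × ℝ}
    (hpde : ∀ᶠ q in nhds p, gLap v q = -(k * Real.exp (v q))) :
    gDx (gA v) p = - gDy (gB v) p ∧ gDy (gA v) p = gDx (gB v) p := by
  have h1 : ContDiff ℝ 2 (gDx v) := gDx_contDiff (n := 2) hv
  have h2 : ContDiff ℝ 2 (gDy v) := gDy_contDiff (n := 2) hv
  have h3 : ContDiff ℝ 1 (gDx (gDx v)) := gDx_contDiff (n := 1) h1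
  have h4 : ContDiff ℝ 1 (gDy (gDy v)) := gDy_contDiff (n := 1) h2
  have h5 : ContDiff ℝ 1 (gDx (gDy v)) := gDx_contDiff (n := 1) h2
  have dv := hv.differentiable (by norm_num) p
  have d1 := h1.differentiable (by norm_num) p
  have d2 := h2.differentiable (by norm_num) p
  have d3 := h3.differentiable (by norm_num) p
  have d4 := h4.differentiable (by norm_num) p
  have d5 := h5.differentiable (by norm_num) p
  have hsym : gDy (gDx v) = gDx (gDy v) := by
    funext q; exact (gDxy_symm (hv.of_le (by norm_num)).contDiffAt).symm
  have hsx : gDy (gDx (gDy v)) p = gDx (gDy (gDy v)) p := (gDxy_symm h2.contDiffAt).symm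
  have hsy : gDx (gDx (gDy v)) p = gDy (gDx (gDx v)) p := by
    rw [← hsym]; exact gDxy_symm h1.contDiffAt
  have hE : ∀ s, HasDerivAt (fun s => -(k * Real.exp s)) (-(k * Real.exp s)) s := fun s =>
    ((Real.hasDerivAt_exp s).const_mul k).neg
  have hp := hpde.self_of_nhds
  have ex : gDx (gLap v) p = gLap v p * gDx v p := by
    rw [(gDx_congr (f := gLap v) (g := fun q => -(k * Real.exp (v q))) hpde).eq_of_nhds, hp]
    exact gDx_comp (hE (v p)) dv
  have ey : gDy (gLap v) p = gLap v p * gDy v p := by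
    rw [(gDy_congr (f := gLap v) (g := fun q => -(k * Real.exp (v q))) hpde).eq_of_nhds, hp]
    exact gDy_comp (hE (v p)) dv
  have ex' : gDx (gLap v) p = gDx (gDx (gDx v)) p + gDx (gDy (gDy v)) p := gDx_add d3 d4
  have ey' : gDy (gLap v) p = gDy (gDx (gDx v)) p + gDy (gDy (gDy v)) p := gDy_add d3 d4
  rw [ex'] at ex
  rw [ey'] at ey
  have d11 : DifferentiableAt ℝ (fun q => gDx v q * gDx v q) p := d1.mul d1
  have d22 : DifferentiableAt ℝ (fun q => gDy v q * gDy v q) p := d2.mul d2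
  have d12 : DifferentiableAt ℝ (fun q => gDx v q * gDy v q) p := d1.mul d2
  have d34 : DifferentiableAt ℝ (fun q => gDx (gDx v) q - gDy (gDy v) q) p := d3.sub d4
  have dd : DifferentiableAt ℝ (fun q => gDx v q * gDx v q - gDy v q * gDy v q) p := d11.sub d22
  have ddc : DifferentiableAt ℝ
    (fun q => (1 / 2 : ℝ) * (gDx v q * gDx v q - gDy v q * gDy v q)) p := dd.const_mul _
  have d5c : DifferentiableAt ℝ (fun q => 2 * gDx (gDy v) q) p := d5.const_mul _
  have aA : gDx (gA v) p = (gDx (gDx (gDx v)) p - gDx (gDy (gDy v)) p)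
      - (1 / 2) * (2 * gDx v p * gDx (gDx v) p - 2 * gDy v p * gDx (gDy v) p) := by
    unfold gA
    rw [gDx_sub d34 ddc, gDx_sub d3 d4,
      gDx_cmul _ dd, gDx_sub d11 d22, gDx_mul d1 d1, gDx_mul d2 d2]
    ring
  have bA : gDy (gA v) p = (gDy (gDx (gDx v)) p - gDy (gDy (gDy v)) p)
      - (1 / 2) * (2 * gDx v p * gDy (gDx v) p - 2 * gDy v p * gDy (gDy v) p) := by
    unfold gA
    rw [gDy_sub d34 ddc, gDy_sub d3 d4,
      gDy_cmul _ dd, gDy_sub d11 d22, gDy_mul d1 d1, gDy_mul d2 d2]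
    ring
  have aB : gDx (gB v) p = 2 * gDx (gDx (gDy v)) p
      - (gDx (gDx v) p * gDy v p + gDx v p * gDx (gDy v) p) := by
    unfold gB
    rw [gDx_sub d5c d12, gDx_cmul _ d5, gDx_mul d1 d2]
  have bB : gDy (gB v) p = 2 * gDy (gDx (gDy v)) p
      - (gDy (gDx v) p * gDy v p + gDx v p * gDy (gDy v) p) := by
    unfold gB
    rw [gDy_sub d5c d12, gDy_cmul _ d5, gDy_mul d1 d2]
  simp only [gLap] at ex ey
  constructor
  · rw [aA, bB, hsx, hsym]; linear_combination ex
  · rw [bA, aB, hsy, hsym]; linear_combination -ey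

lemma gEta_deriv_zero {p : ℝ × ℝ} (h : 1 < gN p) : gEta =ᶠ[nhds p] fun _ => 0 := by
  have : ∀ᶠ q in nhds p, 1 < gN q :=
    (gN_contDiff (n := 0)).continuous.continuousAt.eventually (lt_mem_nhds h)
  filter_upwards [this] with q hq using gEta_zero hq.le

/-- Integral bound for a bounded function against a compactly supported derivative of the bump. -/
lemma int_bound {f g : ℝ × ℝ → ℝ} {M : ℝ} (hf : Continuous f) (hg : Continuous g)
    (hgc : HasCompactSupport g) (h0 : ∀ p, g p ≠ 0 → |f p| ≤ M) :
    |∫ p, f p * g p| ≤ M * ∫ p, |g p| := by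
  rw [← MeasureTheory.integral_const_mul]
  refine (MeasureTheory.abs_integral_le_integral_abs).trans ?_
  refine MeasureTheory.integral_mono
    ((hf.mul hg).integrable_of_hasCompactSupport hgc.mul_left).abs
    ((hg.integrable_of_hasCompactSupport hgc).abs.const_mul M) fun p => ?_
  simp only [abs_mul]
  by_cases h : g p = 0
  · simp [h]
  · exact mul_le_mul_of_nonneg_right (h0 p h) (abs_nonneg _)

lemma schw_arith {M a1 a2 a3 a4 X Y Z P Q : ℝ} (hM : 0 ≤ M) (p1 : 0 ≤ a1) (p2 : 0 ≤ a2)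
    (p3 : 0 ≤ a3) (p4 : 0 ≤ a4) (hX : |X| ≤ M * a1) (hY : |Y| ≤ M * a2) (hZ : |Z| ≤ M * a3)
    (hP : |P| ≤ M ^ 2 * a4 / 4) (hQ : |Q| ≤ M ^ 2 * a4 / 4) :
    |X - Y - P| ≤ (1 + a1 + a2 + 2 * a3 + a4) * (M + M ^ 2) ∧
    |2 * Z - 2 * Q| ≤ (1 + a1 + a2 + 2 * a3 + a4) * (M + M ^ 2) := by
  have M2 : 0 ≤ M ^ 2 := sq_nonneg M
  have r1 := mul_nonneg hM p1
  have r2 := mul_nonneg hM p2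
  have r3 := mul_nonneg hM p3
  have r4 := mul_nonneg hM p4
  have s1 := mul_nonneg M2 p1
  have s2 := mul_nonneg M2 p2
  have s3 := mul_nonneg M2 p3
  have s4 := mul_nonneg M2 p4
  have e : (1 + a1 + a2 + 2 * a3 + a4) * (M + M ^ 2) = M + M ^ 2 + M * a1 + M * a2 + 2 * (M * a3)
    + M * a4 + M ^ 2 * a1 + M ^ 2 * a2 + 2 * (M ^ 2 * a3) + M ^ 2 * a4 := by ring
  rw [e]
  rw [abs_le] at hX hY hZ hP hQ
  constructor <;> rw [abs_le] <;> constructor <;> linarith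

/-- Interior estimate for the Schwarzian quantity at the centre of the unit disc. -/
lemma schwarzian_bound : ∃ C : ℝ, 0 < C ∧ ∀ (v : ℝ × ℝ → ℝ) (k M : ℝ), ContDiff ℝ 3 v → 0 ≤ k →
    0 ≤ M → (∀ p, gN p ≤ 1 → gLap v p = -(k * Real.exp (v p)) ∧ 0 ≤ v p ∧ v p ≤ M) →
    |gA v 0| ≤ C * (M + M ^ 2) ∧ |gB v 0| ≤ C * (M + M ^ 2) := by
  have e2 : ContDiff ℝ 2 gEta := gEta_contDiff (n := 2)
  have ec := gEta_hcs
  have cxx : Continuous (gDx (gDx gEta)) :=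
    (gDx_contDiff (n := 0) (gDx_contDiff (n := 1) e2)).continuous
  have cyy : Continuous (gDy (gDy gEta)) :=
    (gDy_contDiff (n := 0) (gDy_contDiff (n := 1) e2)).continuous
  have cyx : Continuous (gDy (gDx gEta)) :=
    (gDy_contDiff (n := 0) (gDx_contDiff (n := 1) e2)).continuous
  have hxx := gDx_hcs (gDx_hcs ec)
  have hyy := gDy_hcs (gDy_hcs ec)
  have hyx := gDy_hcs (gDx_hcs ec)
  have z0 : ∀ p, 1 < gN p → gDx (gDx gEta) p = 0 ∧ gDy (gDy gEta) p = 0 ∧ gDy (gDx gEta) p = 0 := by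
    intro p hp
    have h := gEta_deriv_zero hp
    have c0 : gDx (fun _ : ℝ × ℝ => (0 : ℝ)) = fun _ => 0 := by funext q; simp [gDx]
    have c1 : gDy (fun _ : ℝ × ℝ => (0 : ℝ)) = fun _ => 0 := by funext q; simp [gDy]
    refine ⟨?_, ?_, ?_⟩
    · rw [(gDx_congr (gDx_congr h)).eq_of_nhds, c0, c0]
    · rw [(gDy_congr (gDy_congr h)).eq_of_nhds, c1, c1]
    · rw [(gDy_congr (gDx_congr h)).eq_of_nhds, c0, c1]
  set I := ∫ p, gEta p with hI
  have Ipos : 0 < I := gEta_integral_pos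
  set a1 := ∫ p, |gDx (gDx gEta) p| with ha1
  set a2 := ∫ p, |gDy (gDy gEta) p| with ha2
  set a3 := ∫ p, |gDy (gDx gEta) p| with ha3
  set a4 := ∫ p, |gLap gEta p| with ha4
  have p1 : 0 ≤ a1 := MeasureTheory.integral_nonneg fun _ => abs_nonneg _
  have p2 : 0 ≤ a2 := MeasureTheory.integral_nonneg fun _ => abs_nonneg _
  have p3 : 0 ≤ a3 := MeasureTheory.integral_nonneg fun _ => abs_nonneg _
  have p4 : 0 ≤ a4 := MeasureTheory.integral_nonneg fun _ => abs_nonneg _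
  refine ⟨(1 + a1 + a2 + 2 * a3 + a4) / I, by positivity, ?_⟩
  intro v k M hv hk hM hpde
  have hv2 : ContDiff ℝ 2 v := hv.of_le (by norm_num)
  have cv := hv.continuous
  have ce := e2.continuous
  have d1 : Continuous (gDx v) := (gDx_contDiff (n := 2) hv).continuous
  have d2 : Continuous (gDy v) := (gDy_contDiff (n := 2) hv).continuous
  have dxx : Continuous (gDx (gDx v)) := (gDx_contDiff (n := 1) (gDx_contDiff (n := 2) hv)).continuous
  have dyy : Continuous (gDy (gDy v)) := (gDy_contDiff (n := 1) (gDy_contDiff (n := 2) hv)).continuous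
  have dxy : Continuous (gDx (gDy v)) := (gDx_contDiff (n := 1) (gDy_contDiff (n := 2) hv)).continuous
  have habs : ∀ p, gN p ≤ 1 → |v p| ≤ M := fun p hp => by
    rw [abs_of_nonneg (hpde p hp).2.1]; exact (hpde p hp).2.2
  have hevp : ∀ p, gN p < 1 → ∀ᶠ q in nhds p, gLap v q = -(k * Real.exp (v q)) := by
    intro p hp
    have : ∀ᶠ q in nhds p, gN q < 1 :=
      (gN_contDiff (n := 0)).continuous.continuousAt.eventually (gt_mem_nhds hp)
    filter_upwards [this] with q hq using (hpde q hq.le).1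
  have int : ∀ {f : ℝ × ℝ → ℝ}, Continuous f → MeasureTheory.Integrable fun p => f p * gEta p :=
    fun hf => (hf.mul ce).integrable_of_hasCompactSupport ec.mul_left
  -- Caccioppoli
  have hG : ∫ p, (gDx v p * gDx v p + gDy v p * gDy v p) * gEta p ≤ M ^ 2 * a4 / 2 := by
    have hw : ContDiff ℝ 2 (fun p => (M - v p) ^ 2) := by fun_prop
    have hib := ibp_lap hw e2 ec
    have hlap : ∀ p, gLap (fun p => (M - v p) ^ 2) p =
        -2 * (M - v p) * gLap v p + 2 * ((gDx v p) ^ 2 + (gDy v p) ^ 2) := by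
      intro p
      refine gLap_comp (b := fun s => (M - s) ^ 2) (b1 := fun s => -2 * (M - s)) (b2 := fun _ => 2)
        (fun s => ?_) (fun s => ?_) hv2.contDiffAt
      · convert! ((hasDerivAt_id s).const_sub M).pow 2 using 1; simp
      · convert! ((hasDerivAt_id s).const_sub M).const_mul (-2) using 1; simp
    have hle : ∫ p, (gDx v p * gDx v p + gDy v p * gDy v p) * gEta p ≤
        ∫ p, (1 / 2) * (gLap (fun p => (M - v p) ^ 2) p * gEta p) := by
      refine MeasureTheory.integral_mono (int (by fun_prop))
        ((int (gLap_continuous hw)).const_mul _) fun p => ?_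
      simp only
      rcases lt_or_ge 1 (gN p) with h | h
      · rw [gEta_zero h.le]; simp
      · obtain ⟨q1, q2, q3⟩ := hpde p h
        rw [← mul_assoc]
        refine mul_le_mul_of_nonneg_right ?_ (gEta_nonneg p)
        rw [hlap, q1]
        have : 0 ≤ (M - v p) * (k * Real.exp (v p)) :=
          mul_nonneg (by linarith) (mul_nonneg hk (Real.exp_pos _).le)
        nlinarith
    rw [MeasureTheory.integral_const_mul, hib] at hle
    have := int_bound (M := M ^ 2) hw.continuous (gLap_continuous e2) (gLap_hcs ec) (fun p hp => by
      rcases lt_or_ge 1 (gN p) with h | h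
      · exact absurd (by simp [gLap, (z0 p h).1, (z0 p h).2.1]) hp
      · obtain ⟨q1, q2, q3⟩ := hpde p h
        rw [abs_of_nonneg (sq_nonneg _)]
        exact pow_le_pow_left₀ (by linarith) (by linarith) 2)
    have := (le_abs_self _).trans this
    linarith
  have hG0 : ∀ f : ℝ × ℝ → ℝ, Continuous f →
      (∀ p, |f p| ≤ (1 / 2) * (gDx v p * gDx v p + gDy v p * gDy v p)) →
      |∫ p, f p * gEta p| ≤ M ^ 2 * a4 / 4 := by
    intro f hf hfb
    refine (MeasureTheory.abs_integral_le_integral_abs).trans ?_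
    have : ∫ p, |f p * gEta p| ≤
        ∫ p, (1 / 2) * ((gDx v p * gDx v p + gDy v p * gDy v p) * gEta p) := by
      refine MeasureTheory.integral_mono (int hf).abs ((int (by fun_prop)).const_mul _) fun p => ?_
      simp only
      rw [abs_mul, abs_of_nonneg (gEta_nonneg p), ← mul_assoc]
      exact mul_le_mul_of_nonneg_right (hfb p) (gEta_nonneg p)
    rw [MeasureTheory.integral_const_mul] at this
    linarith
  have bxx := int_bound (M := M) cv cxx hxx (fun p hp => habs p (by
    by_contra h; exact hp (z0 p (not_le.1 h)).1))
  have byy := int_bound (M := M) cv cyy hyy (fun p hp => habs p (by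
    by_contra h; exact hp (z0 p (not_le.1 h)).2.1))
  have byx := int_bound (M := M) cv cyx hyx (fun p hp => habs p (by
    by_contra h; exact hp (z0 p (not_le.1 h)).2.2))
  rw [← ibp_xx hv2 e2 ec] at bxx
  rw [← ibp_yy hv2 e2 ec] at byy
  rw [← ibp_xy hv2 e2 ec] at byx
  have hCA := mean_value (gA_contDiff hv) (gB_contDiff hv).neg (fun p hp => by
    obtain ⟨h1, h2⟩ := gAB_CR hv (hevp p hp)
    have n1 : gDx (-gB v) p = - gDx (gB v) p := by unfold gDx; rw [fderiv_neg]; rfl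
    have n2 : gDy (-gB v) p = - gDy (gB v) p := by unfold gDy; rw [fderiv_neg]; rfl
    change gDx (gA v) p = gDy (-gB v) p ∧ gDy (gA v) p = - gDx (-gB v) p
    rw [n1, n2, h1, h2]; simp)
  have hCB := mean_value (gB_contDiff hv) (gA_contDiff hv) (fun p hp => by
    obtain ⟨h1, h2⟩ := gAB_CR hv (hevp p hp)
    rw [h1, h2]; simp)
  have eA : ∫ p, gA v p * gEta p = (∫ p, gDx (gDx v) p * gEta p) - (∫ p, gDy (gDy v) p * gEta p)
      - ∫ p, ((1 / 2) * (gDx v p * gDx v p - gDy v p * gDy v p)) * gEta p := by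
    have i1 : MeasureTheory.Integrable
        (fun p => gDx (gDx v) p * gEta p - gDy (gDy v) p * gEta p) := (int dxx).sub (int dyy)
    have i2 : MeasureTheory.Integrable
        (fun p => ((1 / 2) * (gDx v p * gDx v p - gDy v p * gDy v p)) * gEta p) :=
      int (f := fun p => (1 / 2) * (gDx v p * gDx v p - gDy v p * gDy v p)) (by fun_prop)
    rw [← MeasureTheory.integral_sub (int dxx) (int dyy), ← MeasureTheory.integral_sub i1 i2]
    congr 1; ext p; simp only [gA]; ring
  have eB : ∫ p, gB v p * gEta p = 2 * (∫ p, gDx (gDy v) p * gEta p)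
      - 2 * ∫ p, ((1 / 2) * (gDx v p * gDy v p)) * gEta p := by
    rw [← MeasureTheory.integral_const_mul, ← MeasureTheory.integral_const_mul,
      ← MeasureTheory.integral_sub ((int dxy).const_mul _)
        ((int (f := fun p => (1 / 2) * (gDx v p * gDy v p)) (by fun_prop)).const_mul _)]
    congr 1; ext p; simp only [gB]; ring
  have qA := hG0 (fun p => (1 / 2) * (gDx v p * gDx v p - gDy v p * gDy v p)) (by fun_prop)
    (fun p => by
      rw [abs_le]; constructor <;> nlinarith [mul_self_nonneg (gDx v p), mul_self_nonneg (gDy v p)])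
  have qB := hG0 (fun p => (1 / 2) * (gDx v p * gDy v p)) (by fun_prop)
    (fun p => by
      rw [abs_le]; constructor <;> nlinarith [mul_self_nonneg (gDx v p), mul_self_nonneg (gDy v p),
        mul_self_nonneg (gDx v p - gDy v p), mul_self_nonneg (gDx v p + gDy v p)])
  rw [hCA] at eA
  rw [hCB] at eB
  obtain ⟨tA, tB⟩ := schw_arith hM p1 p2 p3 p4 bxx byy byx qA qB
  rw [← eA, abs_mul, abs_of_pos Ipos] at tA
  rw [← eB, abs_mul, abs_of_pos Ipos] at tB
  constructor
  · rw [div_mul_eq_mul_div, le_div_iff₀ Ipos]; exact tA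
  · rw [div_mul_eq_mul_div, le_div_iff₀ Ipos]; exact tB


lemma gDx_scale {f : ℝ × ℝ → ℝ} (hf : Differentiable ℝ f) (x0 : ℝ × ℝ) (r : ℝ) :
    gDx (fun y => f (x0 + r • y)) = fun y => r * gDx f (x0 + r • y) := by
  funext y
  have h : HasFDerivAt (fun y : ℝ × ℝ => x0 + r • y) (r • ContinuousLinearMap.id ℝ (ℝ × ℝ)) y :=
    ((hasFDerivAt_id y).const_smul r).const_add x0
  have := ((hf (x0 + r • y)).hasFDerivAt.comp y h).fderiv
  simp only [gDx]
  rw [show (fun y => f (x0 + r • y)) = f ∘ (fun y => x0 + r • y) from rfl, this]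
  simp only [ContinuousLinearMap.comp_apply, _root_.smul_apply,
    ContinuousLinearMap.id_apply, map_smul, smul_eq_mul]

lemma gDy_scale {f : ℝ × ℝ → ℝ} (hf : Differentiable ℝ f) (x0 : ℝ × ℝ) (r : ℝ) :
    gDy (fun y => f (x0 + r • y)) = fun y => r * gDy f (x0 + r • y) := by
  funext y
  have h : HasFDerivAt (fun y : ℝ × ℝ => x0 + r • y) (r • ContinuousLinearMap.id ℝ (ℝ × ℝ)) y :=
    ((hasFDerivAt_id y).const_smul r).const_add x0
  have := ((hf (x0 + r • y)).hasFDerivAt.comp y h).fderiv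
  simp only [gDy]
  rw [show (fun y => f (x0 + r • y)) = f ∘ (fun y => x0 + r • y) from rfl, this]
  simp only [ContinuousLinearMap.comp_apply, _root_.smul_apply,
    ContinuousLinearMap.id_apply, map_smul, smul_eq_mul]

lemma gDD_scale {f : ℝ × ℝ → ℝ} (hf : ContDiff ℝ 3 f) (x0 : ℝ × ℝ) (r : ℝ) (y : ℝ × ℝ) :
    gDx (gDx (fun y => f (x0 + r • y))) y = r ^ 2 * gDx (gDx f) (x0 + r • y) ∧
    gDy (gDy (fun y => f (x0 + r • y))) y = r ^ 2 * gDy (gDy f) (x0 + r • y) ∧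
    gDx (gDy (fun y => f (x0 + r • y))) y = r ^ 2 * gDx (gDy f) (x0 + r • y) := by
  have d := hf.differentiable (by norm_num)
  have h1 : ContDiff ℝ 2 (gDx f) := gDx_contDiff (n := 2) hf
  have h2 : ContDiff ℝ 2 (gDy f) := gDy_contDiff (n := 2) hf
  have d1 := h1.differentiable (by norm_num)
  have d2 := h2.differentiable (by norm_num)
  have hm : Differentiable ℝ (fun y : ℝ × ℝ => x0 + r • y) := by fun_prop
  have s1 : DifferentiableAt ℝ (fun y => gDx f (x0 + r • y)) y := (d1.comp hm) y
  have s2 : DifferentiableAt ℝ (fun y => gDy f (x0 + r • y)) y := (d2.comp hm) y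
  refine ⟨?_, ?_, ?_⟩
  · rw [gDx_scale d, gDx_cmul r s1, gDx_scale d1]; ring
  · rw [gDy_scale d, gDy_cmul r s2, gDy_scale d2]; ring
  · rw [gDy_scale d, gDx_cmul r s2, gDx_scale d2]; ring

/-- Smooth cutoff extension. -/
lemma cutoff_ext {u : ℝ × ℝ → ℝ} {x0 : ℝ × ℝ} {d : ℝ} (hd : 0 < d)
    (hu : ContDiffOn ℝ 3 u (ball x0 d)) :
    ∃ w : ℝ × ℝ → ℝ, ContDiff ℝ 3 w ∧ ∀ p ∈ ball x0 (3 / 4 * d), w =ᶠ[nhds p] u := by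
  let χ : ContDiffBump x0 := ⟨3 / 4 * d, 7 / 8 * d, by linarith, by linarith⟩
  refine ⟨fun p => χ p * u p, ?_, ?_⟩
  · rw [contDiff_iff_contDiffAt]
    intro p
    by_cases hp : p ∈ ball x0 d
    · exact χ.contDiffAt.mul (hu.contDiffAt (isOpen_ball.mem_nhds hp))
    · have : (fun p => χ p * u p) =ᶠ[nhds p] fun _ => 0 := by
        have h1 : (closedBall x0 (7 / 8 * d))ᶜ ∈ nhds p := by
          refine isClosed_closedBall.isOpen_compl.mem_nhds ?_
          simp only [mem_compl_iff, mem_closedBall, mem_ball, not_lt, not_le] at hp ⊢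
          linarith
        filter_upwards [h1] with q hq
        have : χ q = 0 := χ.zero_of_le_dist (by
          simp only [mem_compl_iff, mem_closedBall, not_le] at hq
          exact hq.le)
        rw [this, zero_mul]
      exact contDiffAt_const.congr_of_eventuallyEq this
  · intro p hp
    filter_upwards [isOpen_ball.mem_nhds hp] with q hq
    have : χ q = 1 := χ.one_of_mem_closedBall (ball_subset_closedBall hq)
    rw [this, one_mul]

/-- If the Hessian degenerates at the maximum, `d² K` is bounded by the height. -/
lemma local_bound : ∃ C : ℝ, 0 < C ∧ ∀ (u : ℝ × ℝ → ℝ) (x0 : ℝ × ℝ) (d l : ℝ), 0 < d → 0 < l →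
    ContDiffOn ℝ 3 u (ball x0 d) →
    (∀ p ∈ ball x0 d, gLap u p = -(l * Real.exp (u p)) ∧ 0 ≤ u p ∧ u p ≤ u x0) →
    gDx (gDx u) x0 * gDy (gDy u) x0 - (gDx (gDy u) x0) ^ 2 = 0 →
    d ^ 2 * (l * Real.exp (u x0)) ≤ C * (u x0 + u x0 ^ 2) := by
  obtain ⟨C, hC, hS⟩ := schwarzian_bound
  refine ⟨8 * C, by positivity, ?_⟩
  intro u x0 d l hd hl hu hp hdet
  obtain ⟨w, hw, hwu⟩ := cutoff_ext hd hu
  have hx0 : x0 ∈ ball x0 d := mem_ball_self hd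
  have hx0' : x0 ∈ ball x0 (3 / 4 * d) := mem_ball_self (by linarith)
  have hloc : IsLocalMax u x0 := by
    filter_upwards [isOpen_ball.mem_nhds hx0] with q hq using (hp q hq).2.2
  have hgrad := hloc.fderiv_eq_zero
  have e0 := hwu x0 hx0'
  have wx : gDx w x0 = 0 := by
    rw [(gDx_congr e0).eq_of_nhds]; simp [gDx, hgrad]
  have wy : gDy w x0 = 0 := by
    rw [(gDy_congr e0).eq_of_nhds]; simp [gDy, hgrad]
  have wxx := (gDx_congr (gDx_congr e0)).eq_of_nhds
  have wyy := (gDy_congr (gDy_congr e0)).eq_of_nhds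
  have wxy := (gDx_congr (gDy_congr e0)).eq_of_nhds
  set r := d / 2 with hr
  have hv : ContDiff ℝ 3 (fun y : ℝ × ℝ => w (x0 + r • y)) := by fun_prop
  have key := hS (fun y => w (x0 + r • y)) (r ^ 2 * l) (u x0) hv (by positivity)
    (hp x0 hx0).2.1 (fun y hy => by
      have hy1 : ‖y‖ ≤ 1 := by nlinarith [norm_sq_le_gN y, norm_nonneg y]
      have hd2 : dist (x0 + r • y) x0 ≤ r := by
        rw [dist_eq_norm, add_sub_cancel_left, norm_smul, Real.norm_of_nonneg (by positivity)]
        nlinarith [norm_nonneg y, show 0 < r by positivity]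
      have m1 : x0 + r • y ∈ ball x0 (3 / 4 * d) := by rw [mem_ball]; linarith
      have m2 : x0 + r • y ∈ ball x0 d := by rw [mem_ball]; linarith
      obtain ⟨q1, q2, q3⟩ := hp _ m2
      have ew := hwu _ m1
      obtain ⟨s1, s2, -⟩ := gDD_scale hw x0 r y
      have el : gLap w (x0 + r • y) = gLap u (x0 + r • y) := (gLap_congr ew).eq_of_nhds
      rw [ew.eq_of_nhds]
      refine ⟨?_, q2, q3⟩
      unfold gLap at el q1 ⊢
      rw [s1, s2, ← mul_add, el, q1]; ring)
  obtain ⟨kA, kB⟩ := key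
  obtain ⟨s1, s2, s3⟩ := gDD_scale hw x0 r 0
  have dw := hw.differentiable (by norm_num)
  have tx : gDx (fun y => w (x0 + r • y)) 0 = 0 := by
    rw [gDx_scale dw]; simp [wx]
  have ty : gDy (fun y => w (x0 + r • y)) 0 = 0 := by
    rw [gDy_scale dw]; simp [wy]
  simp only [smul_zero, add_zero] at s1 s2 s3
  unfold gA at kA
  unfold gB at kB
  rw [tx, ty, s1, s2, wxx, wyy] at kA
  rw [tx, ty, s3, wxy] at kB
  have hK := (hp x0 hx0).1
  unfold gLap at hK
  have hu0 := (hp x0 hx0).2.1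
  set a := gDx (gDx u) x0
  set b := gDy (gDy u) x0
  set c := gDx (gDy u) x0
  set K := l * Real.exp (u x0) with hKd
  set N := u x0 + u x0 ^ 2 with hN
  have Kp : 0 < K := by positivity
  have Np : 0 ≤ C * N := by positivity
  have A2 := sq_le_sq' (abs_le.1 kA).1 (abs_le.1 kA).2
  have B2 := sq_le_sq' (abs_le.1 kB).1 (abs_le.1 kB).2
  have hsq : (r ^ 2 * K) ^ 2 ≤ (2 * (C * N)) ^ 2 := by
    have : (r ^ 2 * K) ^ 2 = (r ^ 2 * a - r ^ 2 * b - 1 / 2 * (0 * 0 - 0 * 0)) ^ 2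
        + (2 * (r ^ 2 * c) - 0 * 0) ^ 2 := by
      rw [show K = -(a + b) by linarith]
      linear_combination (4 * r ^ 4) * hdet
    rw [this]; nlinarith
  have := abs_le_of_sq_le_sq hsq (by linarith)
  have h3 := (le_abs_self _).trans this
  rw [hr] at h3
  linarith

lemma deriv2_nonneg_of_localMin {f : ℝ → ℝ} {a : ℝ} (h : IsLocalMin f a) (hc : ContinuousAt f a) :
    0 ≤ deriv (deriv f) a := by
  by_contra hn
  rw [not_le] at hn
  have hmax := isLocalMax_of_deriv_deriv_neg hn h.deriv_eq_zero hc
  have he : f =ᶠ[nhds a] fun _ => f a := by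
    filter_upwards [h, hmax] with t h1 h2 using le_antisymm h2 h1
  have he2 : deriv f =ᶠ[nhds a] fun _ => 0 := by
    filter_upwards [he.deriv] with t ht
    rw [ht]; simp
  rw [he2.deriv_eq] at hn
  simp at hn

lemma pos_of_superharmonic {Ω : Set (ℝ × ℝ)} (hopen : IsOpen Ω) (hbdd : Bornology.IsBounded Ω)
    {u : ℝ → ℝ → ℝ} (hc : ContinuousOn (fun p : ℝ × ℝ => u p.1 p.2) (closure Ω))
    (hbc : ∀ p ∈ frontier Ω, u p.1 p.2 = 0)
    (hl : ∀ p ∈ Ω, pd u 2 0 p.1 p.2 + pd u 0 2 p.1 p.2 < 0) :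
    ∀ p ∈ closure Ω, 0 ≤ u p.1 p.2 := by
  intro q hq
  have hK : IsCompact (closure Ω) := hbdd.isCompact_closure
  obtain ⟨p, hp, hmin⟩ := hK.exists_isMinOn ⟨q, hq⟩ hc
  have hle : ∀ x ∈ closure Ω, u p.1 p.2 ≤ u x.1 x.2 := fun x hx => hmin hx
  by_contra hneg
  rw [not_le] at hneg
  have hp0 : u p.1 p.2 < 0 := (hle q hq).trans_lt hneg
  have hpO : p ∈ Ω := by
    by_contra hn
    have : p ∈ frontier Ω := by
      rw [frontier, hopen.interior_eq]; exact ⟨hp, hn⟩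
    linarith [hbc p this]
  have hnb : Ω ∈ nhds p := hopen.mem_nhds hpO
  have hcp : ContinuousAt (fun p : ℝ × ℝ => u p.1 p.2) p :=
    hc.continuousAt (Filter.mem_of_superset hnb subset_closure)
  have c1 : ContinuousAt (fun t : ℝ => ((t, p.2) : ℝ × ℝ)) p.1 := by fun_prop
  have c2 : ContinuousAt (fun t : ℝ => ((p.1, t) : ℝ × ℝ)) p.2 := by fun_prop
  have k1 : 0 ≤ deriv (deriv (fun t => u t p.2)) p.1 := by
    refine deriv2_nonneg_of_localMin ?_ ?_
    · filter_upwards [c1 hnb] with t ht using hle _ (subset_closure ht)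
    · exact ContinuousAt.comp (f := fun t : ℝ => ((t, p.2) : ℝ × ℝ))
        (g := fun p : ℝ × ℝ => u p.1 p.2) hcp c1
  have k2 : 0 ≤ deriv (deriv (fun t => u p.1 t)) p.2 := by
    refine deriv2_nonneg_of_localMin ?_ ?_
    · filter_upwards [c2 hnb] with t ht using hle _ (subset_closure ht)
    · exact ContinuousAt.comp (f := fun t : ℝ => ((p.1, t) : ℝ × ℝ))
        (g := fun p : ℝ × ℝ => u p.1 p.2) hcp c2
  have := hl p hpO
  have e1 : pd u 2 0 p.1 p.2 = deriv (deriv (fun t => u t p.2)) p.1 := rfl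
  have e2 : pd u 0 2 p.1 p.2 = deriv (deriv (fun t => u p.1 t)) p.2 := rfl
  linarith

/-- Uniform boundary arcs of scale at most `r` based at points of `S`. -/
def gArcs (F S : Set (ℝ × ℝ)) (r L : ℝ) : Prop :=
  ∀ p ∈ S, p ∈ F → ∀ s : ℝ, 0 < s → s ≤ r → ∃ a : ℝ → ℝ × ℝ, Continuous a ∧
    (∀ t, a t ∈ F ∧ ‖a t - p‖ ≤ L * s) ∧ ∀ y : ℝ × ℝ, ∃ c : ℝ, ∀ t ∈ Icc (0 : ℝ) 1,
      |c - s * t| ≤ ‖y - a t‖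

lemma gArcs_local {F V : Set (ℝ × ℝ)} {g : ℝ × ℝ → ℝ} {p0 : ℝ × ℝ} (hV : IsOpen V) (hp0 : p0 ∈ V)
    (hp0F : p0 ∈ F) (hg : ContDiff ℝ 1 g) (hF : ∀ q ∈ V, (q ∈ F ↔ g q = 0)) (ℓ : ℝ × ℝ →L[ℝ] ℝ)
    (hℓ : ∀ h, |ℓ h| ≤ ‖h‖) (hinj : ∀ h, ℓ h = 0 → fderiv ℝ g p0 h = 0 → h = 0) :
    ∃ S ∈ nhds p0, ∃ r > 0, ∃ L > 0, gArcs F S r L := by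
  set Φ : ℝ × ℝ → ℝ × ℝ := fun q => (ℓ q, g q) with hΦ
  set D : ℝ × ℝ →L[ℝ] ℝ × ℝ := ℓ.prod (fderiv ℝ g p0) with hD
  have hDinj : Function.Injective D.toLinearMap := by
    rw [← LinearMap.ker_eq_bot, LinearMap.ker_eq_bot']
    intro h hh
    have : ((ℓ h, fderiv ℝ g p0 h) : ℝ × ℝ) = 0 := hh
    rw [Prod.mk_eq_zero] at this
    exact hinj h this.1 this.2
  set E : (ℝ × ℝ) ≃L[ℝ] (ℝ × ℝ) :=
    (LinearEquiv.ofInjectiveEndo D.toLinearMap hDinj).toContinuousLinearEquiv with hE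
  have hED : (E : ℝ × ℝ →L[ℝ] ℝ × ℝ) = D := by
    ext1 <;> rfl
  have hst : HasStrictFDerivAt Φ (E : ℝ × ℝ →L[ℝ] ℝ × ℝ) p0 := by
    rw [hED]
    exact ℓ.hasStrictFDerivAt.prodMk
      (hg.contDiffAt.hasStrictFDerivAt (by norm_num))
  set e := hst.toOpenPartialHomeomorph Φ with he
  have he_coe : (e : ℝ × ℝ → ℝ × ℝ) = Φ := hst.toOpenPartialHomeomorph_coe
  have hsrc : p0 ∈ e.source := hst.mem_toOpenPartialHomeomorph_source
  have hinvd : HasStrictFDerivAt e.symm (E.symm : ℝ × ℝ →L[ℝ] ℝ × ℝ) (Φ p0) := hst.to_localInverse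
  obtain ⟨L, W, hW, hlip⟩ := hinvd.exists_lipschitzOnWith
  have htgt : Φ p0 ∈ e.target := by rw [← he_coe]; exact e.map_source hsrc
  have hsymm0 : e.symm (Φ p0) = p0 := by rw [← he_coe]; exact e.left_inv hsrc
  have hN : W ∩ (e.target ∩ e.symm ⁻¹' V) ∈ nhds (Φ p0) := by
    refine inter_mem hW (inter_mem (e.open_target.mem_nhds htgt) ?_)
    have hcs : ContinuousAt e.symm (Φ p0) := hinvd.continuousAt
    exact hcs (by rw [hsymm0]; exact hV.mem_nhds hp0)
  obtain ⟨ρ, hρ, hball⟩ := Metric.mem_nhds_iff.1 hN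
  have hg0 : g p0 = 0 := (hF p0 hp0).1 hp0F
  have hcΦ : ContinuousAt Φ p0 := hst.continuousAt
  refine ⟨e.source ∩ (V ∩ Φ ⁻¹' (ball (Φ p0) (ρ / 2))), inter_mem (e.open_source.mem_nhds hsrc)
    (inter_mem (hV.mem_nhds hp0) (hcΦ (ball_mem_nhds _ (by positivity)))), ρ / 4, by positivity,
    (L : ℝ) + 1, by positivity, ?_⟩
  rintro p ⟨hps, hpV, hpb⟩ hpF s hs hsr
  have hgp : g p = 0 := (hF p hpV).1 hpF
  set τ : ℝ → ℝ := fun t => max 0 (min t 1) with hτ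
  have hτc : Continuous τ := by fun_prop
  have hτ0 : ∀ t, 0 ≤ τ t := fun t => le_max_left _ _
  have hτ1 : ∀ t, τ t ≤ 1 := fun t => max_le zero_le_one (min_le_right _ _)
  set z : ℝ → ℝ × ℝ := fun t => (ℓ p + s * τ t, 0) with hz
  have hzc : Continuous z := by fun_prop
  have hΦp : Φ p = (ℓ p, 0) := by simp [hΦ, hgp]
  have hzp : ∀ t, dist (z t) (Φ p) ≤ s := by
    intro t
    rw [hΦp, hz, Prod.dist_eq]
    simp only [dist_self, Real.dist_eq, add_sub_cancel_left]
    rw [abs_of_nonneg (mul_nonneg hs.le (hτ0 t))]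
    refine max_le ?_ hs.le
    nlinarith [hτ1 t]
  have hzb : ∀ t, z t ∈ ball (Φ p0) ρ := by
    intro t
    rw [mem_ball]
    have h1 : dist (Φ p) (Φ p0) < ρ / 2 := hpb
    linarith [dist_triangle (z t) (Φ p) (Φ p0), hzp t]
  have hpball : Φ p ∈ ball (Φ p0) ρ := by
    have h1 : dist (Φ p) (Φ p0) < ρ / 2 := hpb
    rw [mem_ball]; linarith
  have hsymmp : e.symm (Φ p) = p := by rw [← he_coe]; exact e.left_inv hps
  have hΦa : ∀ t, Φ (e.symm (z t)) = z t := by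
    intro t
    rw [← he_coe]; exact e.right_inv (hball (hzb t)).2.1
  refine ⟨fun t => e.symm (z t), ?_, fun t => ⟨?_, ?_⟩, fun y => ⟨ℓ y - ℓ p, fun t ht => ?_⟩⟩
  · exact hlip.continuousOn.comp_continuous hzc fun t => (hball (hzb t)).1
  · rw [hF _ (hball (hzb t)).2.2]
    have := hΦa t
    rw [hΦ, hz] at this
    exact (Prod.ext_iff.1 this).2
  · have := hlip.dist_le_mul (z t) (hball (hzb t)).1 (Φ p) (hball hpball).1
    rw [hsymmp, dist_eq_norm] at this
    have h2 := mul_le_mul_of_nonneg_left (hzp t) L.coe_nonneg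
    simp only
    linarith
  · have h1 : ℓ (e.symm (z t)) = ℓ p + s * τ t := by
      have := hΦa t
      exact (Prod.ext_iff.1 this).1
    have h2 : τ t = t := by
      rw [hτ]; simp only
      rw [min_eq_left ht.2, max_eq_right ht.1]
    have h3 := hℓ (y - e.symm (z t))
    rw [map_sub, h1, h2] at h3
    rw [sub_sub]
    exact h3

lemma gArcs_all {Ω : Set (ℝ × ℝ)} (hbdd : Bornology.IsBounded Ω)
    (hs : ∀ p ∈ frontier Ω, ∃ (V : Set (ℝ × ℝ)) (g : ℝ × ℝ → ℝ),
      IsOpen V ∧ p ∈ V ∧ ContDiff ℝ (⊤ : ℕ∞) g ∧ (∀ q ∈ V, (q ∈ frontier Ω ↔ g q = 0)) ∧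
      ∀ q ∈ V, fderiv ℝ g q ≠ 0) :
    ∃ r > 0, ∃ L > 0, gArcs (frontier Ω) (frontier Ω) r L := by
  have hK : IsCompact (frontier Ω) :=
    hbdd.isCompact_closure.of_isClosed_subset isClosed_frontier frontier_subset_closure
  refine hK.induction_on (p := fun S => ∃ r > 0, ∃ L > 0, gArcs (frontier Ω) S r L) ?_ ?_ ?_ ?_
  · exact ⟨1, one_pos, 1, one_pos, fun p hp => absurd hp (notMem_empty p)⟩
  · rintro S T hST ⟨r, hr, L, hL, h⟩
    exact ⟨r, hr, L, hL, fun p hp => h p (hST hp)⟩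
  · rintro S T ⟨r, hr, L, hL, h⟩ ⟨r', hr', L', hL', h'⟩
    refine ⟨min r r', lt_min hr hr', max L L', lt_max_of_lt_left hL, ?_⟩
    rintro p (hp | hp) hpF s hs0 hsr
    · obtain ⟨a, ha, hb, hc⟩ := h p hp hpF s hs0 (hsr.trans (min_le_left _ _))
      exact ⟨a, ha, fun t => ⟨(hb t).1, (hb t).2.trans
        (mul_le_mul_of_nonneg_right (le_max_left _ _) hs0.le)⟩, hc⟩
    · obtain ⟨a, ha, hb, hc⟩ := h' p hp hpF s hs0 (hsr.trans (min_le_right _ _))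
      exact ⟨a, ha, fun t => ⟨(hb t).1, (hb t).2.trans
        (mul_le_mul_of_nonneg_right (le_max_right _ _) hs0.le)⟩, hc⟩
  · intro p0 hp0
    obtain ⟨V, g, hV, hpV, hg, hF, hd⟩ := hs p0 hp0
    have hg1 : ContDiff ℝ 1 g := hg.of_le (by exact_mod_cast le_top)
    have hd0 := hd p0 hpV
    have key : ∃ S ∈ nhds p0, ∃ r > 0, ∃ L > 0, gArcs (frontier Ω) S r L := by
      by_cases h2 : fderiv ℝ g p0 (0, 1) = 0
      · have h1 : fderiv ℝ g p0 (1, 0) ≠ 0 := by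
          intro h1
          apply hd0
          ext
          · simpa using h1
          · simpa using h2
        refine gArcs_local hV hpV hp0 hg1 hF (ContinuousLinearMap.snd ℝ ℝ ℝ)
          (fun h => norm_snd_le h) ?_
        rintro ⟨x, y⟩ hy hx
        have hy0 : y = 0 := hy
        subst hy0
        have : fderiv ℝ g p0 (x, 0) = x * fderiv ℝ g p0 (1, 0) := by
          rw [← smul_eq_mul, ← map_smul]; simp
        rw [this] at hx
        have hx0 : x = 0 := (mul_eq_zero.1 hx).resolve_right h1
        rw [hx0]; rfl
      · refine gArcs_local hV hpV hp0 hg1 hF (ContinuousLinearMap.fst ℝ ℝ ℝ)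
          (fun h => norm_fst_le h) ?_
        rintro ⟨x, y⟩ hx hy
        have hx0 : x = 0 := hx
        subst hx0
        have : fderiv ℝ g p0 (0, y) = y * fderiv ℝ g p0 (0, 1) := by
          rw [← smul_eq_mul, ← map_smul]; simp
        rw [this] at hy
        have hy0 : y = 0 := (mul_eq_zero.1 hy).resolve_right h2
        rw [hy0]; rfl
    obtain ⟨S, hS, h⟩ := key
    exact ⟨S, mem_nhdsWithin_of_mem_nhds hS, h⟩

lemma log_int_lower (x : ℝ) : -2 ≤ ∫ t in (0 : ℝ)..1, Real.log (x - t) := by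
  have h := intervalIntegral.integral_comp_sub_left (a := 0) (b := 1) (fun t => Real.log t) x
  rw [h, integral_log, sub_zero]
  have key : ∀ w : ℝ, 0 ≤ w → w - 1 ≤ w * Real.log w := by
    intro w hw
    rcases hw.eq_or_lt with h0 | h0
    · rw [← h0]; simp
    · have := Real.one_sub_inv_le_log_of_pos h0
      have h2 := mul_le_mul_of_nonneg_left this hw
      rw [mul_sub, mul_inv_cancel₀ h0.ne'] at h2
      linarith
  have mono : ∀ w : ℝ, 0 ≤ w → w * Real.log w ≤ (w + 1) * Real.log (w + 1) := by
    intro w hw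
    have h1 : 0 ≤ Real.log (w + 1) := Real.log_nonneg (by linarith)
    rcases hw.eq_or_lt with h0 | h0
    · rw [← h0]; simp
    · have h2 : Real.log w ≤ Real.log (w + 1) := Real.log_le_log h0 (by linarith)
      nlinarith [mul_le_mul_of_nonneg_left h2 hw]
  rcases le_or_gt 1 x with h1 | h1
  · have := mono (x - 1) (by linarith)
    rw [sub_add_cancel] at this
    linarith
  · rcases le_or_gt 0 x with h2 | h2
    · have k1 := key x h2
      have k2 := key (1 - x) (by linarith)
      rw [show Real.log (x - 1) = Real.log (1 - x) by rw [← Real.log_neg_eq_log]; ring_nf]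
      linarith
    · have := mono (-x) (by linarith)
      rw [Real.log_neg_eq_log, show Real.log (-x + 1) = Real.log (x - 1) by
        rw [← Real.log_neg_eq_log]; ring_nf] at this
      linarith

lemma avg_log_lower {f : ℝ → ℝ} (hf : Continuous f) {c s : ℝ} (hs : 0 < s)
    (h : ∀ t ∈ Icc (0 : ℝ) 1, c - s * t ≠ 0 → Real.log |c - s * t| ≤ f t) :
    Real.log s - 2 ≤ ∫ t in (0 : ℝ)..1, f t := by
  set x := c / s with hx
  have hi : IntervalIntegrable (fun t => Real.log (x - t)) MeasureTheory.volume 0 1 := by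
    have := (intervalIntegral.intervalIntegrable_log' (a := x) (b := x - 1)).comp_sub_left x
    simpa using this
  have h1 : ∫ t in (0 : ℝ)..1, (Real.log s + Real.log (x - t)) ≤ ∫ t in (0 : ℝ)..1, f t := by
    refine intervalIntegral.integral_mono_ae_restrict zero_le_one
      (intervalIntegrable_const.add hi) (hf.intervalIntegrable _ _) ?_
    have hne : ∀ᵐ t : ℝ, t ≠ x := by
      have : MeasureTheory.volume ({x} : Set ℝ) = 0 := by simp
      rw [MeasureTheory.ae_iff]; simpa using this
    filter_upwards [MeasureTheory.ae_restrict_of_ae hne,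
      MeasureTheory.ae_restrict_mem measurableSet_Icc] with t ht ht2
    have e : c - s * t = s * (x - t) := by rw [hx]; field_simp
    have hxt : x - t ≠ 0 := sub_ne_zero.2 (Ne.symm ht)
    have := h t ht2 (by rw [e]; exact mul_ne_zero hs.ne' hxt)
    rw [Real.log_abs, e, Real.log_mul hs.ne' hxt] at this
    exact this
  rw [intervalIntegral.integral_add intervalIntegrable_const hi] at h1
  have := log_int_lower x
  rw [intervalIntegral.integral_const, sub_zero, one_smul] at h1
  linarith

/-- The regularised logarithmic kernel. -/
noncomputable def gE (ε : ℝ) (y : ℝ × ℝ) : ℝ := (1 / 2) * Real.log (gN y + ε ^ 2)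

/-- Its Laplacian. -/
noncomputable def gM (ε : ℝ) (y : ℝ × ℝ) : ℝ := 2 * ε ^ 2 / (gN y + ε ^ 2) ^ 2

lemma gN_nonneg (y : ℝ × ℝ) : 0 ≤ gN y := by unfold gN; positivity

lemma gE_contDiff {ε : ℝ} (hε : 0 < ε) {n : WithTop ℕ∞} : ContDiff ℝ n (gE ε) := by
  unfold gE
  refine contDiff_const.mul (ContDiff.log (gN_contDiff.add contDiff_const) fun y => ?_)
  have := gN_nonneg y
  positivity

lemma gLap_gE {ε : ℝ} (hε : 0 < ε) (y : ℝ × ℝ) : gLap (gE ε) y = gM ε y := by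
  have hpos : ∀ q, 0 < gN q + ε ^ 2 := fun q => by have := gN_nonneg q; positivity
  have dN : Differentiable ℝ gN := (gN_contDiff (n := 1)).differentiable (by norm_num)
  have d1 : Differentiable ℝ (fun q : ℝ × ℝ => q.1) := differentiable_fst
  have d2 : Differentiable ℝ (fun q : ℝ × ℝ => q.2) := differentiable_snd
  have x1 : ∀ q, gDx (fun q : ℝ × ℝ => q.1) q = 1 := fun q => by
    simp [gDx, fderiv_fst]
  have y2 : ∀ q, gDy (fun q : ℝ × ℝ => q.2) q = 1 := fun q => by
    simp [gDy, fderiv_snd]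
  have x2 : ∀ q, gDx (fun q : ℝ × ℝ => q.2) q = 0 := fun q => by
    simp [gDx, fderiv_snd]
  have y1 : ∀ q, gDy (fun q : ℝ × ℝ => q.1) q = 0 := fun q => by
    simp [gDy, fderiv_fst]
  have s1 : Differentiable ℝ (fun q : ℝ × ℝ => q.1 ^ 2) := by fun_prop
  have s2 : Differentiable ℝ (fun q : ℝ × ℝ => q.2 ^ 2) := by fun_prop
  have sq : ∀ s : ℝ, HasDerivAt (fun s : ℝ => s ^ 2) (2 * s) s := fun s => by
    simpa using hasDerivAt_pow 2 s
  have Nx : ∀ q, gDx gN q = 2 * q.1 := fun q => by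
    unfold gN
    rw [gDx_add (s1 q) (s2 q), gDx_comp (sq q.1) (d1 q), gDx_comp (sq q.2) (d2 q), x1, x2]; ring
  have Ny : ∀ q, gDy gN q = 2 * q.2 := fun q => by
    unfold gN
    rw [gDy_add (s1 q) (s2 q), gDy_comp (sq q.1) (d1 q), gDy_comp (sq q.2) (d2 q), y1, y2]; ring
  have hlog : ∀ q, HasDerivAt (fun s => (1 / 2) * Real.log (s + ε ^ 2))
      ((1 / 2) * (gN q + ε ^ 2)⁻¹) (gN q) := fun q => by
    refine HasDerivAt.const_mul _ ?_
    have := ((hasDerivAt_id (gN q)).add_const (ε ^ 2)).log (hpos q).ne'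
    simpa using this
  have hinv : ∀ q, HasDerivAt (fun s => (s + ε ^ 2)⁻¹)
      (-(1 / (gN q + ε ^ 2) ^ 2)) (gN q) := fun q => by
    have := ((hasDerivAt_id (gN q)).add_const (ε ^ 2)).inv (hpos q).ne'
    rw [neg_div] at this
    exact this
  have Ex : gDx (gE ε) = fun q => q.1 * (gN q + ε ^ 2)⁻¹ := by
    funext q
    unfold gE
    rw [gDx_comp (hlog q) (dN q), Nx]; ring
  have Ey : gDy (gE ε) = fun q => q.2 * (gN q + ε ^ 2)⁻¹ := by
    funext q
    unfold gE
    rw [gDy_comp (hlog q) (dN q), Ny]; ring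
  have di : DifferentiableAt ℝ (fun q => (gN q + ε ^ 2)⁻¹) y :=
    ((dN y).add_const (ε ^ 2)).inv (hpos y).ne'
  unfold gLap
  rw [Ex, Ey, gDx_mul (d1 y) di, gDy_mul (d2 y) di, x1, y2, gDx_comp (hinv y) (dN y),
    gDy_comp (hinv y) (dN y), Nx, Ny]
  unfold gM
  have := (hpos y).ne'
  field_simp
  unfold gN
  ring

lemma gLap_shift (f : ℝ × ℝ → ℝ) (b y : ℝ × ℝ) :
    gLap (fun q => f (q - b)) y = gLap f (y - b) := by
  have hx : ∀ f : ℝ × ℝ → ℝ, gDx (fun q => f (q - b)) = fun q => gDx f (q - b) := fun f => by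
    funext q; simp only [gDx]; rw [fderiv_comp_sub]
  have hy : ∀ f : ℝ × ℝ → ℝ, gDy (fun q => f (q - b)) = fun q => gDy f (q - b) := fun f => by
    funext q; simp only [gDy]; rw [fderiv_comp_sub]
  simp only [gLap]
  rw [hx, hy, hx, hy]

lemma green_gE {h : ℝ × ℝ → ℝ} (hh : ContDiff ℝ 2 h) (hc : HasCompactSupport h) {ε : ℝ}
    (hε : 0 < ε) (b : ℝ × ℝ) :
    ∫ y, gE ε (y - b) * gLap h y = ∫ y, gM ε (y - b) * h y := by
  have hE : ContDiff ℝ 2 (fun y => gE ε (y - b)) := (gE_contDiff hε).comp (contDiff_id.sub contDiff_const)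
  rw [← ibp_lap hE hh hc]
  simp only [gLap_shift, gLap_gE hε]

lemma lap_int_zero {h : ℝ × ℝ → ℝ} (hh : ContDiff ℝ 2 h) (hc : HasCompactSupport h) :
    ∫ y, gLap h y = 0 := by
  have := ibp_lap (f := fun _ => 1) contDiff_const hh hc
  have c0 : ∀ p, gLap (fun _ : ℝ × ℝ => (1 : ℝ)) p = 0 := fun p => by
    have c1 : gDx (fun _ : ℝ × ℝ => (1 : ℝ)) = fun _ => 0 := by funext q; simp [gDx]
    have c2 : gDy (fun _ : ℝ × ℝ => (1 : ℝ)) = fun _ => 0 := by funext q; simp [gDy]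
    unfold gLap
    rw [c1, c2]; simp [gDx, gDy]
  simp only [c0, zero_mul, one_mul, MeasureTheory.integral_zero] at this
  exact this.symm

lemma gM_one_integrable : MeasureTheory.Integrable (gM 1) := by
  have h := integrable_rpow_neg_one_add_norm_sq (E := ℝ × ℝ) (μ := MeasureTheory.volume) (r := 4)
    (by simp; norm_num)
  refine (h.const_mul 2).mono' ?_ (Eventually.of_forall fun y => ?_)
  · have : Continuous (gM 1) := by
      unfold gM
      refine continuous_const.div ?_ fun y => ?_
      · have := (gN_contDiff (n := 0)).continuous; fun_prop
      · have := gN_nonneg y; positivity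
    exact this.aestronglyMeasurable
  · have h1 := gN_nonneg y
    have h2 := norm_sq_le_gN y
    have h3 : 0 ≤ ‖y‖ ^ 2 := sq_nonneg _
    rw [Real.norm_of_nonneg (by unfold gM; positivity)]
    rw [show (-4 / 2 : ℝ) = ((-2 : ℤ) : ℝ) by norm_num, Real.rpow_intCast, zpow_neg]
    unfold gM
    rw [div_eq_mul_inv]
    simp only [one_pow, mul_one]
    gcongr
    rw [show ((2 : ℤ)) = ((2 : ℕ) : ℤ) by rfl, zpow_natCast]
    gcongr ?_ ^ 2
    linarith

/-- Total mass of the kernel. -/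
noncomputable def gc0 : ℝ := ∫ y, gM 1 y

lemma gc0_pos : 0 < gc0 := by
  unfold gc0
  have hp : ∀ y, 0 < gM 1 y := fun y => by
    have := gN_nonneg y
    unfold gM; positivity
  rw [MeasureTheory.integral_pos_iff_support_of_nonneg (fun y => (hp y).le) gM_one_integrable]
  have : Function.support (gM 1) = univ := by
    ext y; simp [(hp y).ne']
  rw [this]; simp

lemma gM_tendsto {h : ℝ × ℝ → ℝ} (hh : Continuous h) (hc : HasCompactSupport h) (x0 : ℝ × ℝ) :
    Tendsto (fun ε => ∫ y, gM ε (y - x0) * h y) (nhdsWithin 0 (Ioi 0)) (nhds (gc0 * h x0)) := by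
  have e : ∀ ε ∈ Ioi (0 : ℝ), ∫ z, gM 1 z * h (x0 + ε • z) = ∫ y, gM ε (y - x0) * h y := by
    intro ε hε
    have hε0 : ε ≠ 0 := ne_of_gt hε
    have h1 : ∫ y, gM ε (y - x0) * h y = ∫ y, gM ε y * h (x0 + y) := by
      rw [← MeasureTheory.integral_add_right_eq_self (fun y => gM ε (y - x0) * h y) x0]
      congr 1; ext y; rw [add_sub_cancel_right, add_comm]
    rw [h1]
    have h2 := MeasureTheory.Measure.integral_comp_smul (MeasureTheory.volume : MeasureTheory.Measure (ℝ × ℝ))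
      (fun y => gM ε y * h (x0 + y)) ε
    have h3 : ∀ z, gM ε (ε • z) = (ε ^ 2)⁻¹ * gM 1 z := by
      intro z
      have hz : gN (ε • z) = ε ^ 2 * gN z := by
        unfold gN; simp only [Prod.smul_fst, Prod.smul_snd, smul_eq_mul]; ring
      unfold gM
      rw [hz]
      have := gN_nonneg z
      have : gN z + 1 ≠ 0 := by positivity
      field_simp
    have hfr : Module.finrank ℝ (ℝ × ℝ) = 2 := by simp
    rw [hfr] at h2
    simp only [h3, mul_assoc, MeasureTheory.integral_const_mul, smul_eq_mul] at h2
    rw [abs_of_nonneg (by positivity)] at h2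
    exact mul_left_cancel₀ (inv_ne_zero (pow_ne_zero 2 hε0)) h2
  refine Tendsto.congr' (f₁ := fun ε => ∫ z, gM 1 z * h (x0 + ε • z)) ?_ ?_
  · filter_upwards [self_mem_nhdsWithin] with ε hε using e ε hε
  · have : gc0 * h x0 = ∫ z, gM 1 z * h x0 := by
      rw [MeasureTheory.integral_mul_const]; rfl
    rw [this]
    obtain ⟨B, hB⟩ := hh.bounded_above_of_compact_support hc
    have gc : Continuous (gM 1) := by
      unfold gM
      refine continuous_const.div ?_ fun y => ?_
      · have := (gN_contDiff (n := 0)).continuous; fun_prop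
      · have := gN_nonneg y; positivity
    refine MeasureTheory.tendsto_integral_filter_of_dominated_convergence (fun z => gM 1 z * B)
      ?_ ?_ (gM_one_integrable.mul_const B) ?_
    · refine Eventually.of_forall fun ε => Continuous.aestronglyMeasurable ?_
      fun_prop
    · refine Eventually.of_forall fun ε => Eventually.of_forall fun z => ?_
      have : 0 ≤ gM 1 z := by
        have := gN_nonneg z
        unfold gM; positivity
      rw [norm_mul, Real.norm_of_nonneg this]
      exact mul_le_mul_of_nonneg_left (hB _) this
    · refine Eventually.of_forall fun z => ?_
      have hcont : Continuous (fun ε : ℝ => gM 1 z * h (x0 + ε • z)) := by fun_prop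
      have := hcont.tendsto 0
      simp only [zero_smul, add_zero] at this
      exact this.mono_left nhdsWithin_le_nhds

/-- The comparison kernel: average along a boundary arc minus pole at `x0`. -/
noncomputable def gPsi (a : ℝ → ℝ × ℝ) (x0 : ℝ × ℝ) (C0 ε : ℝ) (y : ℝ × ℝ) : ℝ :=
  (∫ t in (0 : ℝ)..1, gE ε (y - a t)) - gE ε (y - x0) + C0

lemma kernel_ineq {h : ℝ × ℝ → ℝ} (hh : ContDiff ℝ 2 h) (hc : HasCompactSupport h)
    (h0 : ∀ y, 0 ≤ h y) {a : ℝ → ℝ × ℝ} (ha : Continuous a) {δ : ℝ} (hδ : 0 < δ)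
    (hsep : ∀ y, h y ≠ 0 → ∀ t, δ ≤ ‖y - a t‖) (x0 : ℝ × ℝ) (C0 : ℝ) {ρ G : ℝ × ℝ → ℝ}
    (hρG : MeasureTheory.Integrable fun y => ρ y * G y) (hρ0 : ∀ y, 0 ≤ ρ y)
    (hρ : ∀ y, - gLap h y ≤ ρ y) {ε0 : ℝ} (hε0 : 0 < ε0)
    (hΨ0 : ∀ ε, 0 < ε → ε ≤ ε0 → ∀ y, 0 ≤ gPsi a x0 C0 ε y)
    (hΨ1 : ∀ ε, 0 < ε → ε ≤ ε0 → ∀ y, y ≠ x0 → gPsi a x0 C0 ε y ≤ G y) :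
    gc0 * h x0 ≤ ∫ y, ρ y * G y := by
  have clap := gLap_continuous hh
  have lhc := gLap_hcs hc
  have hcont := hh.continuous
  set H := ∫ y, h y with hH
  have hint : MeasureTheory.Integrable h := hcont.integrable_of_hasCompactSupport hc
  have hmain : ∀ ε, 0 < ε → ε ≤ ε0 →
      ∫ y, gM ε (y - x0) * h y ≤ (∫ y, ρ y * G y) + 2 * ε ^ 2 / (δ ^ 2) ^ 2 * H := by
    intro ε hε hεe
    have cE : Continuous (gE ε) := (gE_contDiff hε (n := 0)).continuous
    have cM : Continuous (gM ε) := by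
      unfold gM
      refine continuous_const.div ?_ fun y => ?_
      · have := (gN_contDiff (n := 0)).continuous; fun_prop
      · have := gN_nonneg y; positivity
    have cU : Continuous (Function.uncurry fun (y : ℝ × ℝ) (t : ℝ) => gE ε (y - a t)) := by
      unfold Function.uncurry; fun_prop
    have cAvg : Continuous (fun y => ∫ t in (0 : ℝ)..1, gE ε (y - a t)) :=
      intervalIntegral.continuous_parametric_intervalIntegral_of_continuous' cU 0 1
    have cΨ : Continuous (gPsi a x0 C0 ε) := by
      unfold gPsi
      exact (cAvg.sub (cE.comp (continuous_id.sub continuous_const))).add continuous_const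
    -- Fubini
    have fub : ∫ t in (0 : ℝ)..1, (∫ y, gE ε (y - a t) * gLap h y) =
        ∫ y, (∫ t in (0 : ℝ)..1, gE ε (y - a t)) * gLap h y := by
      rw [MeasureTheory.intervalIntegral_integral_swap]
      · congr 1; ext y
        rw [intervalIntegral.integral_mul_const]
      · rw [← MeasureTheory.Measure.restrict_univ (μ := (MeasureTheory.volume : MeasureTheory.Measure (ℝ × ℝ))),
          MeasureTheory.Measure.prod_restrict]
        have cF : Continuous (Function.uncurry fun (t : ℝ) (y : ℝ × ℝ) => gE ε (y - a t) * gLap h y) := by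
          unfold Function.uncurry; fun_prop
        have hK : IsCompact (Icc (0 : ℝ) 1 ×ˢ tsupport (gLap h)) := isCompact_Icc.prod lhc
        refine MeasureTheory.IntegrableOn.of_forall_sdiff_eq_zero
          (cF.continuousOn.integrableOn_compact hK) (measurableSet_uIoc.prod MeasurableSet.univ) ?_
        rintro ⟨t, y⟩ ⟨⟨ht, -⟩, hn⟩
        rw [uIoc_of_le zero_le_one] at ht
        have : y ∉ tsupport (gLap h) := fun hy => hn ⟨⟨ht.1.le, ht.2⟩, hy⟩
        simp only [Function.uncurry]
        rw [image_eq_zero_of_notMem_tsupport this, mul_zero]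
    have i1 : MeasureTheory.Integrable fun y => (∫ t in (0 : ℝ)..1, gE ε (y - a t)) * gLap h y :=
      (cAvg.mul clap).integrable_of_hasCompactSupport lhc.mul_left
    have i2 : MeasureTheory.Integrable fun y => gE ε (y - x0) * gLap h y :=
      ((cE.comp (continuous_id.sub continuous_const)).mul clap).integrable_of_hasCompactSupport
        lhc.mul_left
    have i3 : MeasureTheory.Integrable fun y => C0 * gLap h y :=
      (clap.integrable_of_hasCompactSupport lhc).const_mul C0
    have i4 : MeasureTheory.Integrable fun y => gPsi a x0 C0 ε y * gLap h y :=
      (cΨ.mul clap).integrable_of_hasCompactSupport lhc.mul_left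
    have i12 : MeasureTheory.Integrable fun y => (∫ t in (0 : ℝ)..1, gE ε (y - a t)) * gLap h y -
      gE ε (y - x0) * gLap h y := i1.sub i2
    have split : ∫ y, gPsi a x0 C0 ε y * gLap h y =
        (∫ t in (0 : ℝ)..1, (∫ y, gM ε (y - a t) * h y)) - ∫ y, gM ε (y - x0) * h y := by
      have e1 : (fun y => gPsi a x0 C0 ε y * gLap h y) = fun y =>
          ((∫ t in (0 : ℝ)..1, gE ε (y - a t)) * gLap h y - gE ε (y - x0) * gLap h y)
            + C0 * gLap h y := by
        funext y; unfold gPsi; ring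
      rw [e1, MeasureTheory.integral_add i12 i3, MeasureTheory.integral_sub i1 i2,
        MeasureTheory.integral_const_mul, lap_int_zero hh hc, ← fub, green_gE hh hc hε]
      simp only [green_gE hh hc hε]
      ring
    have small : ∀ t, ∫ y, gM ε (y - a t) * h y ≤ 2 * ε ^ 2 / (δ ^ 2) ^ 2 * H := by
      intro t
      rw [hH, ← MeasureTheory.integral_const_mul]
      refine MeasureTheory.integral_mono ?_ (hint.const_mul _) fun y => ?_
      · exact ((cM.comp (continuous_id.sub continuous_const)).mul hcont).integrable_of_hasCompactSupport
          hc.mul_left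
      · simp only
        by_cases hy : h y = 0
        · simp [hy]
        · refine mul_le_mul_of_nonneg_right ?_ (h0 y)
          have k1 := hsep y hy t
          have k2 := norm_sq_le_gN (y - a t)
          have k3 : δ ^ 2 ≤ gN (y - a t) + ε ^ 2 := by nlinarith [sq_nonneg ε]
          unfold gM
          gcongr
    have avg : ∫ t in (0 : ℝ)..1, (∫ y, gM ε (y - a t) * h y) ≤ 2 * ε ^ 2 / (δ ^ 2) ^ 2 * H := by
      have hpos : 0 ≤ 2 * ε ^ 2 / (δ ^ 2) ^ 2 * H :=
        mul_nonneg (by positivity) (MeasureTheory.integral_nonneg h0)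
      have := intervalIntegral.norm_integral_le_of_norm_le_const (a := (0 : ℝ)) (b := 1)
        (f := fun t => ∫ y, gM ε (y - a t) * h y) (C := 2 * ε ^ 2 / (δ ^ 2) ^ 2 * H) (fun t _ => by
          rw [Real.norm_of_nonneg]
          · exact small t
          · refine MeasureTheory.integral_nonneg fun y => mul_nonneg ?_ (h0 y)
            have := gN_nonneg (y - a t)
            unfold gM; positivity)
      simp only [sub_zero, abs_one, mul_one] at this
      exact (le_abs_self _).trans this
    have up : - ∫ y, gPsi a x0 C0 ε y * gLap h y ≤ ∫ y, ρ y * G y := by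
      rw [← MeasureTheory.integral_neg]
      refine MeasureTheory.integral_mono_ae i4.neg hρG ?_
      have hne : ∀ᵐ y : ℝ × ℝ, y ≠ x0 := by
        have : MeasureTheory.volume ({x0} : Set (ℝ × ℝ)) = 0 := by simp
        rw [MeasureTheory.ae_iff]; simpa using this
      filter_upwards [hne] with y hy
      show -(gPsi a x0 C0 ε y * gLap h y) ≤ ρ y * G y
      have k0 := hΨ0 ε hε hεe y
      have k1 := hΨ1 ε hε hεe y hy
      calc -(gPsi a x0 C0 ε y * gLap h y) = gPsi a x0 C0 ε y * (- gLap h y) := by ring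
        _ ≤ gPsi a x0 C0 ε y * ρ y := mul_le_mul_of_nonneg_left (hρ y) k0
        _ ≤ G y * ρ y := mul_le_mul_of_nonneg_right k1 (hρ0 y)
        _ = ρ y * G y := mul_comm _ _
    linarith
  have lim := gM_tendsto hcont hc x0
  have lim2 : Tendsto (fun ε : ℝ => (∫ y, ρ y * G y) + 2 * ε ^ 2 / (δ ^ 2) ^ 2 * H)
      (nhdsWithin 0 (Ioi 0)) (nhds (∫ y, ρ y * G y)) := by
    have : Continuous (fun ε : ℝ => (∫ y, ρ y * G y) + 2 * ε ^ 2 / (δ ^ 2) ^ 2 * H) := by fun_prop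
    have := this.tendsto 0
    simp at this
    simpa using this.mono_left (nhdsWithin_le_nhds (s := Ioi 0))
  refine le_of_tendsto_of_tendsto lim lim2 ?_
  filter_upwards [Ioc_mem_nhdsGT hε0] with ε hε using hmain ε hε.1 hε.2

/-- The integrable singular profile. -/
noncomputable def gG (z : ℝ × ℝ) : ℝ := (Iio (1 : ℝ)).indicator (fun r => Real.log (1 + 1 / r)) ‖z‖

lemma gG_nonneg (z : ℝ × ℝ) : 0 ≤ gG z := by
  unfold gG
  refine indicator_apply_nonneg fun _ => ?_
  have := norm_nonneg z
  have : 0 ≤ 1 / ‖z‖ := by positivity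
  exact Real.log_nonneg (by linarith)

lemma gG_bound (z : ℝ × ℝ) : Real.log (1 + 1 / ‖z‖) ≤ 1 + gG z := by
  by_cases h : ‖z‖ < 1
  · have : gG z = Real.log (1 + 1 / ‖z‖) := indicator_of_mem (s := Iio (1 : ℝ)) h _
    rw [this]; linarith
  · have h0 := gG_nonneg z
    have h1 : 1 / ‖z‖ ≤ 1 := by
      rw [div_le_one (by linarith)]; linarith
    have h2 : 0 ≤ 1 / ‖z‖ := by positivity
    have h3 := Real.log_le_sub_one_of_pos (show 0 < 1 + 1 / ‖z‖ by linarith)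
    linarith

lemma gG_integrable : MeasureTheory.Integrable gG := by
  unfold gG
  rw [MeasureTheory.integrable_fun_norm_addHaar (MeasureTheory.volume : MeasureTheory.Measure (ℝ × ℝ))
    (f := (Iio (1 : ℝ)).indicator (fun r => Real.log (1 + 1 / r)))]
  have hfr : Module.finrank ℝ (ℝ × ℝ) = 2 := by simp
  rw [hfr]
  have hm : Measurable (fun y : ℝ => y ^ (2 - 1) • (Iio (1 : ℝ)).indicator (fun r => Real.log (1 + 1 / r)) y) := by
    refine (measurable_id.pow_const _).smul (Measurable.indicator ?_ measurableSet_Iio)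
    fun_prop
  have hb : MeasureTheory.IntegrableOn ((Ioo (0 : ℝ) 1).indicator fun _ => (1 : ℝ)) (Ioi 0) := by
    refine MeasureTheory.Integrable.integrableOn ?_
    rw [MeasureTheory.integrable_indicator_iff measurableSet_Ioo]
    simp
  refine hb.mono' hm.aestronglyMeasurable ?_
  filter_upwards [MeasureTheory.ae_restrict_mem measurableSet_Ioi] with y hy
  have hy0 : 0 < y := hy
  by_cases h : y < 1
  · rw [indicator_of_mem (show y ∈ Iio (1 : ℝ) from h), indicator_of_mem (show y ∈ Ioo (0 : ℝ) 1 from ⟨hy0, h⟩)]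
    have h2 : 0 < 1 / y := by positivity
    have h3 := Real.log_le_sub_one_of_pos (show 0 < 1 + 1 / y by linarith)
    have h4 : 0 ≤ Real.log (1 + 1 / y) := Real.log_nonneg (by linarith)
    simp only [Nat.add_one_sub_one, pow_one, smul_eq_mul]
    rw [Real.norm_of_nonneg (by positivity)]
    calc y * Real.log (1 + 1 / y) ≤ y * (1 / y) := mul_le_mul_of_nonneg_left (by linarith) hy0.le
      _ = 1 := by field_simp
  · rw [indicator_of_notMem (show y ∉ Iio (1 : ℝ) from h)]
    rw [smul_zero, norm_zero]
    exact indicator_nonneg (fun _ _ => zero_le_one) _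

lemma gE_sub_le {ε A : ℝ} (hε : 0 < ε) (hA : 0 < A) {z w : ℝ × ℝ}
    (h : gN z + ε ^ 2 ≤ A * (gN w + ε ^ 2)) : gE ε z ≤ (1 / 2) * Real.log A + gE ε w := by
  have h1 : 0 < gN z + ε ^ 2 := by have := gN_nonneg z; positivity
  have h2 : 0 < gN w + ε ^ 2 := by have := gN_nonneg w; positivity
  unfold gE
  have := Real.log_le_log h1 h
  rw [Real.log_mul hA.ne' h2.ne'] at this
  linarith

lemma gE_le_log {ε A : ℝ} (hε : 0 < ε) (hA : 0 < A) {z : ℝ × ℝ} (h : gN z + ε ^ 2 ≤ A ^ 2) :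
    gE ε z ≤ Real.log A := by
  have h1 : 0 < gN z + ε ^ 2 := by have := gN_nonneg z; positivity
  unfold gE
  have := Real.log_le_log h1 h
  rw [Real.log_pow] at this
  push_cast at this
  linarith

lemma gPsi_bounds {a : ℝ → ℝ × ℝ} (ha : Continuous a) {x0 : ℝ × ℝ} {d c B ε C0 : ℝ} (hd : 0 < d)
    (hc : 0 < c) (hB : 1 ≤ B) (hε : 0 < ε) (hεd : ε ≤ d) (hax : ∀ t, ‖a t - x0‖ ≤ B * d)
    (harc : ∀ y : ℝ × ℝ, ∃ w : ℝ, ∀ t ∈ Icc (0 : ℝ) 1, |w - c * d * t| ≤ ‖y - a t‖)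
    (hC0 : C0 = (1 / 2) * Real.log 12 + 2 + |Real.log c| + Real.log (3 * B)) (y : ℝ × ℝ) :
    0 ≤ gPsi a x0 C0 ε y ∧
    (y ≠ x0 → gPsi a x0 C0 ε y ≤ C0 + 1 + Real.log (1 + B * d / ‖y - x0‖)) := by
  have cE : Continuous (gE ε) := (gE_contDiff hε (n := 0)).continuous
  have cf : Continuous (fun t => gE ε (y - a t)) := by fun_prop
  have l12 : 0 ≤ Real.log 12 := Real.log_nonneg (by norm_num)
  have l3B : 0 ≤ Real.log (3 * B) := Real.log_nonneg (by linarith)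
  have labs := abs_nonneg (Real.log c)
  set R := ‖y - x0‖ with hR
  have R0 : 0 ≤ R := norm_nonneg _
  have tri1 : ∀ t, R - B * d ≤ ‖y - a t‖ := fun t => by
    have h := norm_sub_le_norm_sub_add_norm_sub y (a t) x0
    linarith [hax t]
  have tri2 : ∀ t, ‖y - a t‖ ≤ R + B * d := fun t => by
    have h := norm_sub_le_norm_sub_add_norm_sub y x0 (a t)
    rw [norm_sub_rev x0 (a t)] at h
    linarith [hax t]
  have Bd : d ≤ B * d := by nlinarith
  have nz := norm_sq_le_gN (y - x0)
  have nz2 := gN_le_norm_sq (y - x0)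
  have ε2 : ε ^ 2 ≤ d ^ 2 := pow_le_pow_left₀ hε.le hεd 2
  have iconst : ∀ C : ℝ, ∫ _ in (0 : ℝ)..1, C = C := fun C => by simp
  constructor
  · unfold gPsi
    rcases le_or_gt (2 * (B * d)) R with h | h
    · have hpt : ∀ t, gE ε (y - x0) - (1 / 2) * Real.log 12 ≤ gE ε (y - a t) := by
        intro t
        have k1 := tri1 t
        have k2 := norm_sq_le_gN (y - a t)
        have k3 : (R / 2) ^ 2 ≤ ‖y - a t‖ ^ 2 := pow_le_pow_left₀ (by positivity) (by linarith) 2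
        have k4 : (2 * d) ^ 2 ≤ R ^ 2 := pow_le_pow_left₀ (by positivity) (by linarith) 2
        have := gE_sub_le (A := 12) hε (by norm_num) (z := y - x0) (w := y - a t) (by
          nlinarith [sq_nonneg ε])
        linarith
      have := intervalIntegral.integral_mono_on (μ := MeasureTheory.volume) (zero_le_one' ℝ)
        intervalIntegrable_const (cf.intervalIntegrable 0 1) (fun t _ => hpt t)
      rw [iconst] at this
      linarith
    · obtain ⟨w, hw⟩ := harc y
      have hs : 0 < c * d := by positivity
      have := avg_log_lower cf hs (c := w) (fun t ht hne => by
        have k1 := hw t ht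
        have k2 := norm_sq_le_gN (y - a t)
        have pos : 0 < |w - c * d * t| := abs_pos.2 hne
        have k3 : |w - c * d * t| ^ 2 ≤ gN (y - a t) + ε ^ 2 := by
          have := pow_le_pow_left₀ pos.le k1 2
          nlinarith [sq_nonneg ε]
        have k4 := Real.log_le_log (by positivity) k3
        rw [Real.log_pow] at k4
        push_cast at k4
        unfold gE
        linarith)
      have k5 : gE ε (y - x0) ≤ Real.log (3 * B * d) := by
        refine gE_le_log hε (by positivity) ?_
        have : R ^ 2 ≤ (2 * (B * d)) ^ 2 := pow_le_pow_left₀ R0 h.le 2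
        have : d ^ 2 ≤ (B * d) ^ 2 := pow_le_pow_left₀ hd.le Bd 2
        nlinarith
      rw [Real.log_mul (by positivity) hd.ne'] at k5
      rw [Real.log_mul hc.ne' hd.ne'] at this
      have := neg_abs_le (Real.log c)
      linarith
  · intro hy
    have Rpos : 0 < R := norm_pos_iff.2 (sub_ne_zero.2 hy)
    have hq : 0 ≤ B * d / R := by positivity
    have hpt : ∀ t, gE ε (y - a t) ≤ (1 / 2) * Real.log (2 * (1 + B * d / R) ^ 2) + gE ε (y - x0) := by
      intro t
      refine gE_sub_le hε (by positivity) ?_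
      have k1 := gN_le_norm_sq (y - a t)
      have k2 := pow_le_pow_left₀ (norm_nonneg _) (tri2 t) 2
      have e1 : R + B * d = R * (1 + B * d / R) := by field_simp
      have k3 : 1 ≤ (1 + B * d / R) ^ 2 := one_le_pow₀ (by linarith)
      set Q := (1 + B * d / R) ^ 2 with hQ
      have e2 : (R + B * d) ^ 2 = R ^ 2 * Q := by rw [e1, mul_pow]
      rw [e2] at k2
      have k4 : R ^ 2 * Q ≤ gN (y - x0) * Q := mul_le_mul_of_nonneg_right nz (by linarith)
      have k5 : ε ^ 2 * 1 ≤ ε ^ 2 * Q := mul_le_mul_of_nonneg_left k3 (sq_nonneg ε)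
      nlinarith [sq_nonneg ε]
    have := intervalIntegral.integral_mono_on (μ := MeasureTheory.volume) (zero_le_one' ℝ)
        (cf.intervalIntegrable 0 1) intervalIntegrable_const (fun t _ => hpt t)
    rw [iconst, Real.log_mul (by norm_num) (by positivity), Real.log_pow] at this
    push_cast at this
    have l2 := Real.log_le_sub_one_of_pos (show (0 : ℝ) < 2 by norm_num)
    unfold gPsi
    linarith

/-- A smooth convex truncation. -/
lemma gBump_exists : ∃ b b1 b2 : ℝ → ℝ, ContDiff ℝ 2 b ∧ (∀ s, HasDerivAt b (b1 s) s) ∧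
    (∀ s, HasDerivAt b1 (b2 s) s) ∧ (∀ s, 0 ≤ b1 s ∧ b1 s ≤ 1) ∧ (∀ s, 0 ≤ b2 s) ∧
    (∀ s, s ≤ 1 → b s = 0) ∧ (∀ s, s - 2 ≤ b s) ∧ (∀ s, 0 ≤ b s) := by
  have hcT : Continuous Real.smoothTransition := Real.smoothTransition.continuous
  have hb : ∀ s, HasDerivAt (fun s => ∫ t in (1:ℝ)..s, Real.smoothTransition (t - 1))
      (Real.smoothTransition (s - 1)) s := by
    intro s
    have hc : Continuous fun t : ℝ => Real.smoothTransition (t - 1) := by fun_prop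
    exact intervalIntegral.integral_hasDerivAt_right (hc.intervalIntegrable _ _)
      (hc.stronglyMeasurableAtFilter _ _) hc.continuousAt
  have hsm : ContDiff ℝ 1 fun t : ℝ => Real.smoothTransition (t - 1) :=
    Real.smoothTransition.contDiff.comp (contDiff_id.sub contDiff_const)
  have hmono : Monotone fun t : ℝ => Real.smoothTransition (t - 1) := fun a b hab =>
    Real.smoothTransition.monotone (by linarith)
  have hb1 : ∀ s, HasDerivAt (fun t : ℝ => Real.smoothTransition (t - 1))
      (deriv (fun t : ℝ => Real.smoothTransition (t - 1)) s) s := fun s =>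
    (hsm.differentiable (by norm_num) s).hasDerivAt
  have hz : ∀ s, s ≤ 1 → ∫ t in (1:ℝ)..s, Real.smoothTransition (t - 1) = 0 := by
    intro s hs
    have : ∫ t in (1:ℝ)..s, Real.smoothTransition (t - 1) = ∫ t in (1:ℝ)..s, (0:ℝ) := by
      refine intervalIntegral.integral_congr fun t ht => ?_
      rw [uIcc_of_ge hs] at ht
      exact Real.smoothTransition.zero_of_nonpos (by linarith [ht.2])
    rw [this]; simp
  have hn : ∀ s, 0 ≤ ∫ t in (1:ℝ)..s, Real.smoothTransition (t - 1) := by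
    intro s
    rcases le_total s 1 with h | h
    · rw [hz s h]
    · exact intervalIntegral.integral_nonneg h fun t _ => Real.smoothTransition.nonneg _
  refine ⟨_, _, _, ?_, hb, hb1, fun s => ⟨Real.smoothTransition.nonneg _, Real.smoothTransition.le_one _⟩,
    fun s => hmono.deriv_nonneg, hz, ?_, hn⟩
  · have : (2 : WithTop ℕ∞) = 1 + 1 := by norm_num
    rw [this, contDiff_succ_iff_deriv]
    refine ⟨fun s => (hb s).differentiableAt, by simp, ?_⟩
    have h2 : deriv (fun s => ∫ t in (1:ℝ)..s, Real.smoothTransition (t - 1))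
        = fun s => Real.smoothTransition (s - 1) := funext fun s => (hb s).deriv
    rw [h2]; exact hsm
  · intro s
    rcases le_total s 2 with h | h
    · linarith [hn s]
    · have hc : Continuous fun t : ℝ => Real.smoothTransition (t - 1) := by fun_prop
      rw [← intervalIntegral.integral_add_adjacent_intervals (b := 2) (hc.intervalIntegrable _ _)
        (hc.intervalIntegrable _ _)]
      have h3 : ∫ t in (2:ℝ)..s, Real.smoothTransition (t - 1) = ∫ t in (2:ℝ)..s, (1:ℝ) := by
        refine intervalIntegral.integral_congr fun t ht => ?_
        rw [uIcc_of_le h] at ht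
        exact Real.smoothTransition.one_of_one_le (by linarith [ht.1])
      have h4 := hn 2
      rw [h3, intervalIntegral.integral_const, smul_eq_mul]; linarith

/-- The truncated solution. -/
lemma trunc_exists {Ω : Set (ℝ × ℝ)} (hopen : IsOpen Ω) (hbdd : Bornology.IsBounded Ω)
    {u : ℝ × ℝ → ℝ} {l : ℝ} (hl : 0 < l) (hc : ContinuousOn u (closure Ω))
    (hd : ∀ p ∈ Ω, ContDiffAt ℝ 2 u p) (hb0 : ∀ p ∈ frontier Ω, u p = 0)
    (hpde : ∀ p ∈ Ω, gLap u p = -(l * Real.exp (u p))) :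
    ∃ h : ℝ × ℝ → ℝ, ContDiff ℝ 2 h ∧ HasCompactSupport h ∧ (∀ y, 0 ≤ h y) ∧
      (∃ δ > 0, ∀ y, h y ≠ 0 → ∀ q ∈ frontier Ω, δ ≤ ‖y - q‖) ∧
      (∀ y, - gLap h y ≤ Ω.indicator (fun p => l * Real.exp (u p)) y) ∧
      ∀ y ∈ Ω, u y - 2 ≤ h y := by
  obtain ⟨b, b1, b2, hbC, hb, hb1, hb1b, hb2, hbz, hblow, hbn⟩ := gBump_exists
  classical
  set S : Set (ℝ × ℝ) := closure Ω ∩ u ⁻¹' Ici 1 with hS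
  have hScl : IsClosed S := hc.preimage_isClosed_of_isClosed isClosed_closure isClosed_Ici
  have hcpt : IsCompact (closure Ω) := hbdd.isCompact_closure
  have hScpt : IsCompact S := hcpt.of_isClosed_subset hScl inter_subset_left
  have hSΩ : S ⊆ Ω := by
    rintro p ⟨hp, hp1⟩
    by_contra hn
    have hf : p ∈ frontier Ω := by rw [hopen.frontier_eq]; exact ⟨hp, hn⟩
    have h1 : (1:ℝ) ≤ u p := hp1
    rw [hb0 p hf] at h1; linarith
  set h : ℝ × ℝ → ℝ := Ω.indicator (fun p => b (u p)) with hh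
  have hoff : ∀ y, y ∉ S → h y = 0 := by
    intro y hy
    by_cases hyΩ : y ∈ Ω
    · rw [hh, indicator_of_mem hyΩ]
      refine hbz _ ?_
      by_contra hlt
      exact hy ⟨subset_closure hyΩ, (not_le.1 hlt).le⟩
    · exact indicator_of_notMem hyΩ _
  have hloc0 : ∀ y, y ∉ S → h =ᶠ[nhds y] fun _ => 0 := by
    intro y hy
    filter_upwards [hScl.isOpen_compl.mem_nhds hy] with z hz using hoff z hz
  have hlocΩ : ∀ y ∈ Ω, h =ᶠ[nhds y] fun p => b (u p) := by
    intro y hy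
    filter_upwards [hopen.mem_nhds hy] with z hz using indicator_of_mem hz _
  refine ⟨h, ?_, HasCompactSupport.intro hScpt fun y hy => hoff y hy, ?_, ?_, ?_, ?_⟩
  · rw [contDiff_iff_contDiffAt]
    intro y
    by_cases hy : y ∈ S
    · refine ContDiffAt.congr_of_eventuallyEq ?_ (hlocΩ y (hSΩ hy))
      exact hbC.contDiffAt.comp y (hd y (hSΩ hy))
    · exact contDiffAt_const.congr_of_eventuallyEq (hloc0 y hy)
  · intro y
    exact indicator_nonneg (fun p _ => hbn _) y
  · have hdisj : Disjoint S (frontier Ω) := by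
      rw [Set.disjoint_left]
      intro p hp hf
      rw [hopen.frontier_eq] at hf
      exact hf.2 (hSΩ hp)
    obtain ⟨r, hr, hr2⟩ := exists_pos_forall_lt_edist hScpt isClosed_frontier hdisj
    refine ⟨r, by exact_mod_cast hr, fun y hy q hq => ?_⟩
    have hyS : y ∈ S := by
      by_contra hn
      exact hy (hoff y hn)
    have h1 := hr2 y hyS q hq
    rw [edist_nndist] at h1
    have h2 : r < nndist y q := by exact_mod_cast h1
    have h3 : (r : ℝ) < dist y q := by exact_mod_cast h2
    rw [← dist_eq_norm]; exact h3.le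
  · intro y
    by_cases hy : y ∈ Ω
    · rw [indicator_of_mem hy, (gLap_congr (hlocΩ y hy)).eq_of_nhds, gLap_comp hb hb1 (hd y hy), hpde y hy]
      have e1 := Real.exp_pos (u y)
      have e2 := hb1b (u y)
      have e3 := hb2 (u y)
      have e4 : 0 ≤ b2 (u y) * ((gDx u y)^2 + (gDy u y)^2) := by positivity
      have e5 : b1 (u y) * (l * Real.exp (u y)) ≤ 1 * (l * Real.exp (u y)) :=
        mul_le_mul_of_nonneg_right e2.2 (by positivity)
      linarith
    · rw [indicator_of_notMem hy, (gLap_congr (hloc0 y fun hs => hy (hSΩ hs))).eq_of_nhds]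
      have : gLap (fun _ => (0:ℝ)) y = 0 := by
        unfold gLap gDx gDy
        simp
      rw [this]; simp
  · intro y hy
    rw [hh, indicator_of_mem hy]; exact hblow _

/-- The height bound. -/
lemma height_bound {Ω : Set (ℝ × ℝ)} (hopen : IsOpen Ω) (hbdd : Bornology.IsBounded Ω)
    {r0 L : ℝ} (hr0 : 0 < r0) (hL : 0 < L) (harcs : gArcs (frontier Ω) (frontier Ω) r0 L) :
    ∃ C1 C2 : ℝ, 0 ≤ C2 ∧ ∀ (u : ℝ × ℝ → ℝ) (l : ℝ) (x0 : ℝ × ℝ) (d : ℝ), 0 < l →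
      ContinuousOn u (closure Ω) → (∀ p ∈ Ω, ContDiffAt ℝ 2 u p) → (∀ p ∈ frontier Ω, u p = 0) →
      (∀ p ∈ Ω, gLap u p = -(l * Real.exp (u p))) → x0 ∈ Ω → (∀ p ∈ closure Ω, u p ≤ u x0) →
      0 < d → (∃ p ∈ frontier Ω, dist x0 p = d) → l * ∫ p in Ω, Real.exp (u p) ≤ 9 * Real.pi →
      u x0 ≤ C1 + C2 * Real.log (1 + d * Real.sqrt (l * Real.exp (u x0))) := by
  obtain ⟨D, hD⟩ := Metric.isBounded_iff.1 hbdd.closure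
  obtain ⟨c, hc⟩ : ∃ c, c = r0 / (|D| + 1) := ⟨_, rfl⟩
  have hD1 : 0 < |D| + 1 := by positivity
  have hc0 : 0 < c := by rw [hc]; positivity
  obtain ⟨B, hB⟩ : ∃ B, B = 1 + L * c := ⟨_, rfl⟩
  have hB1 : 1 ≤ B := by rw [hB]; have := mul_pos hL hc0; linarith
  obtain ⟨C0, hC0⟩ : ∃ C0, C0 = (1/2)*Real.log 12 + 2 + |Real.log c| + Real.log (3*B) := ⟨_, rfl⟩
  have hC00 : 0 ≤ C0 := by
    have h1 : 0 ≤ Real.log 12 := Real.log_nonneg (by norm_num)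
    have h2 : 0 ≤ Real.log (3*B) := Real.log_nonneg (by linarith)
    have h3 := abs_nonneg (Real.log c)
    linarith
  have hg0 := gc0_pos
  set I : ℝ := ∫ z, gG z with hI
  refine ⟨2 + ((C0 + 2 + Real.log B) * (9 * Real.pi) + I) / gc0, 9 * Real.pi / gc0,
    by positivity, ?_⟩
  intro u l x0 d hl hcont hcd hb0 hpde hx0 hmax hd ⟨p0, hp0, hp0d⟩ hmass
  obtain ⟨h, hhC, hhs, hhn, ⟨δ, hδ, hsep⟩, hlap, hlow⟩ := trunc_exists hopen hbdd hl hcont hcd hb0 hpde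
  have hdD : d ≤ |D| + 1 := by
    have := hD (subset_closure hx0) (frontier_subset_closure hp0)
    rw [hp0d] at this
    linarith [le_abs_self D]
  have hs : c * d ≤ r0 := by
    rw [hc, div_mul_eq_mul_div, div_le_iff₀ hD1]
    exact mul_le_mul_of_nonneg_left hdD hr0.le
  obtain ⟨a, hac, haF, harc⟩ := harcs p0 hp0 hp0 (c * d) (by positivity) hs
  have hax : ∀ t, ‖a t - x0‖ ≤ B * d := by
    intro t
    have h1 := (haF t).2
    have h2 : ‖a t - x0‖ ≤ ‖a t - p0‖ + ‖p0 - x0‖ := norm_sub_le_norm_sub_add_norm_sub _ _ _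
    have h3 : ‖p0 - x0‖ = d := by rw [← dist_eq_norm, dist_comm, hp0d]
    rw [hB]; linarith
  set K : ℝ := l * Real.exp (u x0) with hK
  have hKpos : 0 < K := by have := Real.exp_pos (u x0); positivity
  set k : ℝ := Real.sqrt K with hk
  have hkpos : 0 < k := Real.sqrt_pos.2 hKpos
  have hk2 : k ^ 2 = K := Real.sq_sqrt hKpos.le
  set A : ℝ := C0 + 2 + Real.log (1 + B * (d * k)) with hA
  have hBdk : 0 ≤ B * (d * k) := by positivity
  have hA0 : 0 ≤ A := by
    have : 0 ≤ Real.log (1 + B * (d * k)) := Real.log_nonneg (by linarith)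
    linarith
  set ρ : ℝ × ℝ → ℝ := Ω.indicator (fun p => l * Real.exp (u p)) with hρ
  have hρ0 : ∀ y, 0 ≤ ρ y := fun y => indicator_nonneg (fun p _ => by positivity) y
  have hρK : ∀ y, ρ y ≤ K := by
    intro y
    by_cases hy : y ∈ Ω
    · rw [hρ, indicator_of_mem hy]
      exact mul_le_mul_of_nonneg_left (Real.exp_le_exp.2 (hmax y (subset_closure hy))) hl.le
    · rw [hρ, indicator_of_notMem hy]; exact hKpos.le
  have hρint : MeasureTheory.Integrable ρ := by
    rw [hρ, MeasureTheory.integrable_indicator_iff hopen.measurableSet]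
    refine MeasureTheory.IntegrableOn.mono_set ?_ subset_closure
    refine ContinuousOn.integrableOn_compact hbdd.isCompact_closure ?_
    exact continuousOn_const.mul hcont.rexp
  have hρmass : ∫ y, ρ y ≤ 9 * Real.pi := by
    rw [hρ, MeasureTheory.integral_indicator hopen.measurableSet, MeasureTheory.integral_const_mul]
    exact hmass
  set g : ℝ × ℝ → ℝ := fun y => gG (k • (y - x0)) with hg
  have hgint : MeasureTheory.Integrable g :=
    (gG_integrable.comp_smul hkpos.ne').comp_sub_right x0
  have hgval : ∫ y, g y = (k ^ 2)⁻¹ * I := by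
    have e1 : ∫ y, g y = ∫ y, gG (k • y) :=
      MeasureTheory.integral_sub_right_eq_self (fun y => gG (k • y)) x0
    have hfr : Module.finrank ℝ (ℝ × ℝ) = 2 := by simp
    rw [e1, MeasureTheory.Measure.integral_comp_smul_of_nonneg MeasureTheory.volume gG k (hR := hkpos.le), hfr, smul_eq_mul]
  have hρg : MeasureTheory.Integrable fun y => ρ y * g y := by
    refine (hgint.const_mul K).mono' (hρint.aestronglyMeasurable.mul hgint.aestronglyMeasurable) ?_
    refine Eventually.of_forall fun y => ?_
    have := gG_nonneg (k • (y - x0))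
    rw [Real.norm_eq_abs, abs_of_nonneg (mul_nonneg (hρ0 y) this)]
    exact mul_le_mul_of_nonneg_right (hρK y) this
  have hsum : (fun y => ρ y * (A + g y)) = fun y => ρ y * A + ρ y * g y := by
    ext y; ring
  have hρG : MeasureTheory.Integrable fun y => ρ y * (A + g y) := by
    rw [hsum]; exact (hρint.mul_const A).add hρg
  have hbd := fun ε (hε : 0 < ε) (hεd : ε ≤ d) y =>
    gPsi_bounds hac hd hc0 hB1 hε hεd hax (fun y => by simpa [mul_assoc] using harc y) hC0 y
  have hmain := kernel_ineq hhC hhs hhn hac hδ (fun y hy t => hsep y hy _ (haF t).1) x0 C0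
    (ρ := ρ) (G := fun y => A + g y) hρG hρ0 hlap hd
    (fun ε hε hεd y => (hbd ε hε hεd y).1) (by
      intro ε hε hεd y hy
      refine ((hbd ε hε hεd y).2 hy).trans ?_
      have hR : 0 < ‖y - x0‖ := norm_pos_iff.2 (sub_ne_zero.2 hy)
      have hn : ‖k • (y - x0)‖ = k * ‖y - x0‖ := by
        rw [norm_smul, Real.norm_eq_abs, abs_of_pos hkpos]
      have h1 := gG_bound (k • (y - x0))
      rw [hn] at h1
      have h2 : 1 + B * d / ‖y - x0‖ ≤ (1 + B * (d * k)) * (1 + 1 / (k * ‖y - x0‖)) := by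
        have e : (1 + B * (d * k)) * (1 + 1 / (k * ‖y - x0‖))
            = 1 + B * d / ‖y - x0‖ + B * (d * k) + 1 / (k * ‖y - x0‖) := by
          field_simp; ring
        have e2 : 0 < 1 / (k * ‖y - x0‖) := by positivity
        rw [e]; linarith
      have hpos : 0 < 1 + B * d / ‖y - x0‖ := by positivity
      have h3 := Real.log_le_log hpos h2
      have e2 : 0 < 1 / (k * ‖y - x0‖) := by positivity
      rw [Real.log_mul (by linarith) (by linarith)] at h3
      simp only [hA, hg]
      linarith)
  have hint : ∫ y, ρ y * (A + g y) ≤ A * (9 * Real.pi) + I := by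
    rw [hsum, MeasureTheory.integral_add (hρint.mul_const A) hρg, MeasureTheory.integral_mul_const]
    have e1 : (∫ y, ρ y) * A ≤ A * (9 * Real.pi) := by
      rw [mul_comm]; exact mul_le_mul_of_nonneg_left hρmass hA0
    have e2 : ∫ y, ρ y * g y ≤ ∫ y, K * g y :=
      MeasureTheory.integral_mono hρg (hgint.const_mul K) fun y =>
        mul_le_mul_of_nonneg_right (hρK y) (gG_nonneg _)
    have e3 : ∫ y, K * g y = I := by
      rw [MeasureTheory.integral_const_mul, hgval, hk2]; field_simp
    linarith
  have hT : Real.log (1 + B * (d * k)) ≤ Real.log B + Real.log (1 + d * k) := by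
    have hdk : 0 < d * k := by positivity
    rw [← Real.log_mul (by linarith) (by linarith)]
    exact Real.log_le_log (by linarith) (by nlinarith)
  have hfin : gc0 * (u x0 - 2) ≤ (C0 + 2 + Real.log B + Real.log (1 + d * k)) * (9 * Real.pi) + I := by
    have e1 : gc0 * (u x0 - 2) ≤ gc0 * h x0 := mul_le_mul_of_nonneg_left (hlow x0 hx0) hg0.le
    have e2 : A * (9 * Real.pi) ≤ (C0 + 2 + Real.log B + Real.log (1 + d * k)) * (9 * Real.pi) :=
      mul_le_mul_of_nonneg_right (by rw [hA]; linarith) (by positivity)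
    linarith
  have e : 2 + ((C0 + 2 + Real.log B) * (9 * Real.pi) + I) / gc0
      + 9 * Real.pi / gc0 * Real.log (1 + d * k)
      = 2 + ((C0 + 2 + Real.log B + Real.log (1 + d * k)) * (9 * Real.pi) + I) / gc0 := by
    field_simp; ring
  rw [e]
  have : u x0 - 2 ≤ ((C0 + 2 + Real.log B + Real.log (1 + d * k)) * (9 * Real.pi) + I) / gc0 := by
    rw [le_div_iff₀ hg0]; linarith
  linarith

/-- Elementary comparison of logarithmic and polynomial growth. -/
lemma elem_bound {C C1 C2 : ℝ} (hC : 0 < C) (hC2 : 0 ≤ C2) : ∃ Ms : ℝ, ∀ M T : ℝ, 0 ≤ M → 0 ≤ T →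
    T ^ 2 ≤ C * (M + M ^ 2) → M ≤ C1 + C2 * Real.log (1 + T) → M ≤ Ms := by
  obtain ⟨η, hη⟩ : ∃ η, η = 1 / (2 * (C2 + 1)) := ⟨_, rfl⟩
  have hη0 : 0 < η := by rw [hη]; positivity
  have hη2 : C2 * η ≤ 1 / 2 := by
    rw [hη, mul_one_div, div_le_div_iff₀ (by positivity) (by norm_num)]; linarith
  refine ⟨2 * (C1 + C2 * Real.log (1 + Real.sqrt C) + C2 * (- 1 - Real.log η) + 1 / 2), ?_⟩
  intro M T hM hT h1 h2
  have hs0 := Real.sqrt_nonneg C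
  have hs := Real.sq_sqrt hC.le
  have hTb : T ≤ Real.sqrt C * (1 + M) := by
    refine le_of_sq_le_sq ?_ (by positivity)
    rw [mul_pow, hs]
    refine h1.trans (mul_le_mul_of_nonneg_left ?_ hC.le)
    nlinarith
  have hl1 : Real.log (1 + T) ≤ Real.log (1 + Real.sqrt C) + Real.log (1 + M) := by
    rw [← Real.log_mul (by linarith) (by linarith)]
    exact Real.log_le_log (by linarith) (by nlinarith)
  have hl2 : Real.log (1 + M) ≤ η * (1 + M) - 1 - Real.log η := by
    have := Real.log_le_sub_one_of_pos (show 0 < η * (1 + M) by positivity)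
    rw [Real.log_mul hη0.ne' (by linarith)] at this
    linarith
  have h3 : C2 * Real.log (1 + T) ≤ C2 * (Real.log (1 + Real.sqrt C) + (η * (1 + M) - 1 - Real.log η)) :=
    mul_le_mul_of_nonneg_left (by linarith) hC2
  have h4 : C2 * η * (1 + M) ≤ 1 / 2 * (1 + M) := mul_le_mul_of_nonneg_right hη2 (by linarith)
  nlinarith

/-- for the Gelfand problem `-Δu = λ eᵘ` with `λ∫_Ω eᵘ → 8π`, the
maximum point is a nondegenerate critical point for `λ` small enough. -/
theorem concentration_max_nondegenerate
    (Ω : Set (ℝ × ℝ)) (hopen : IsOpen Ω) (hconn : IsConnected Ω)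
    (hbdd : Bornology.IsBounded Ω)
    (hsmooth_bdry : ∀ p ∈ frontier Ω, ∃ (V : Set (ℝ × ℝ)) (g : ℝ × ℝ → ℝ),
      IsOpen V ∧ p ∈ V ∧ ContDiff ℝ (⊤ : ℕ∞) g ∧ (∀ q ∈ V, (q ∈ frontier Ω ↔ g q = 0)) ∧
      ∀ q ∈ V, fderiv ℝ g q ≠ 0)
    (lbar : ℝ) (hlbar : 0 < lbar)
    (U : ℝ → ℝ → ℝ → ℝ)
    (hUsmooth : ∀ l ∈ Set.Ioo 0 lbar,
      ContDiffOn ℝ (⊤ : ℕ∞) (fun p : ℝ × ℝ => U l p.1 p.2) (closure Ω))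
    (hpde : ∀ l ∈ Set.Ioo 0 lbar, ∀ p ∈ Ω,
      -(pd (U l) 2 0 p.1 p.2 + pd (U l) 0 2 p.1 p.2) = l * Real.exp (U l p.1 p.2))
    (hbc : ∀ l ∈ Set.Ioo 0 lbar, ∀ p ∈ frontier Ω, U l p.1 p.2 = 0)
    (hmass : Filter.Tendsto (fun l => l * ∫ p in Ω, Real.exp (U l p.1 p.2))
      (nhdsWithin 0 (Set.Ioi 0)) (nhds (8 * Real.pi)))
    (xl : ℝ → ℝ × ℝ)
    (hxl : ∀ l ∈ Set.Ioo 0 lbar, xl l ∈ Ω ∧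
      ∀ p ∈ closure Ω, U l p.1 p.2 ≤ U l (xl l).1 (xl l).2) :
    ∃ l₀ : ℝ, 0 < l₀ ∧ l₀ ≤ lbar ∧ ∀ l : ℝ, 0 < l → l < l₀ →
      pd (U l) 2 0 (xl l).1 (xl l).2 * pd (U l) 0 2 (xl l).1 (xl l).2
        - (pd (U l) 1 1 (xl l).1 (xl l).2) ^ 2 ≠ 0 := by
  obtain ⟨r0, hr0, L, hL, harcs⟩ := gArcs_all hbdd hsmooth_bdry
  obtain ⟨C, hC, hlocal⟩ := local_bound
  obtain ⟨C1, C2, hC2, hheight⟩ := height_bound hopen hbdd hr0 hL harcs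
  obtain ⟨Ms, hMs⟩ := elem_bound (C1 := C1) hC hC2
  have hpi := Real.pi_pos
  have hev1 := hmass.eventually (Ioo_mem_nhds (show 4 * Real.pi < 8 * Real.pi by linarith)
    (show 8 * Real.pi < 9 * Real.pi by linarith))
  set V : ℝ := MeasureTheory.volume.real Ω with hV
  have hV0 : 0 ≤ V := MeasureTheory.measureReal_nonneg
  have hev2 : ∀ᶠ l : ℝ in nhdsWithin 0 (Ioi 0), l * (Real.exp Ms * V) < 4 * Real.pi := by
    have h1 : Tendsto (fun l : ℝ => l * (Real.exp Ms * V)) (nhds 0) (nhds (0 * (Real.exp Ms * V))) :=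
      tendsto_id.mul_const _
    rw [zero_mul] at h1
    exact (h1.mono_left nhdsWithin_le_nhds).eventually (Iio_mem_nhds (by positivity))
  obtain ⟨l1, hl1, hl1s⟩ := mem_nhdsGT_iff_exists_Ioo_subset.1 (hev1.and hev2)
  refine ⟨min l1 lbar, lt_min hl1 hlbar, min_le_right _ _, ?_⟩
  intro l hl0 hlt hdet
  obtain ⟨⟨hm4, hm9⟩, hsmall⟩ := hl1s ⟨hl0, hlt.trans_le (min_le_left _ _)⟩
  have hlI : l ∈ Ioo 0 lbar := ⟨hl0, hlt.trans_le (min_le_right _ _)⟩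
  obtain ⟨hx0, hmax⟩ := hxl l hlI
  set x0 := xl l with hx0def
  set u : ℝ × ℝ → ℝ := fun p => U l p.1 p.2 with hu
  have hCD := hUsmooth l hlI
  have hcont : ContinuousOn u (closure Ω) := hCD.continuousOn
  have hCDo : ContDiffOn ℝ 3 u Ω := (hCD.mono subset_closure).of_le (WithTop.coe_le_coe.2 (le_top : (3 : ℕ∞) ≤ ⊤))
  have hcd : ∀ p ∈ Ω, ContDiffAt ℝ 2 u p := fun p hp =>
    (hCDo.contDiffAt (hopen.mem_nhds hp)).of_le (by norm_num)
  have hlap : ∀ p ∈ Ω, gLap u p = -(l * Real.exp (u p)) := by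
    intro p hp
    obtain ⟨e1, e2, _⟩ := pd_eqs (hcd p hp)
    have := hpde l hlI p hp
    rw [e1, e2] at this
    rw [hu]; unfold gLap
    simp only
    linarith
  have hnn : ∀ p ∈ closure Ω, 0 ≤ u p := by
    refine pos_of_superharmonic hopen hbdd hcont (hbc l hlI) ?_
    intro p hp
    have h1 := hpde l hlI p hp
    have h2 : 0 < l * Real.exp (U l p.1 p.2) := by positivity
    linarith
  have huniv : Ω ≠ univ := by
    intro h
    rw [h] at hbdd
    exact NoncompactSpace.noncompact_univ (X := ℝ × ℝ) (by simpa using hbdd.isCompact_closure)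
  obtain ⟨p0, hp0, hp0d⟩ := exists_mem_frontier_infDist_compl_eq_dist hx0 huniv
  set d : ℝ := infDist x0 Ωᶜ with hd
  have hd0 : 0 < d := by
    rw [hp0d]
    refine dist_pos.2 ?_
    rintro h
    rw [hopen.frontier_eq, ← h] at hp0
    exact hp0.2 hx0
  have hball : ball x0 d ⊆ Ω := by
    intro y hy
    by_contra hn
    have h1 : d ≤ dist x0 y := infDist_le_dist_of_mem hn
    rw [mem_ball, dist_comm] at hy
    linarith
  have hh := hheight u l x0 d hl0 hcont hcd (hbc l hlI) hlap hx0 hmax hd0 ⟨p0, hp0, hp0d.symm⟩ hm9.le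
  obtain ⟨e1, e2, e3⟩ := pd_eqs (hcd x0 hx0)
  rw [e1, e2, e3] at hdet
  have hloc := hlocal u x0 d l hd0 hl0 (hCDo.mono hball) (fun p hp =>
    ⟨hlap p (hball hp), hnn p (subset_closure (hball hp)), hmax p (subset_closure (hball hp))⟩) hdet
  have hK : 0 ≤ l * Real.exp (u x0) := by positivity
  have hM : u x0 ≤ Ms := by
    refine hMs (u x0) (d * Real.sqrt (l * Real.exp (u x0))) (hnn x0 (subset_closure hx0))
      (by positivity) ?_ hh
    rw [mul_pow, Real.sq_sqrt hK]; exact hloc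
  have hvol : MeasureTheory.volume Ω < ⊤ := hbdd.measure_lt_top
  have hint : ∫ p in Ω, Real.exp (U l p.1 p.2) ≤ Real.exp Ms * V := by
    have h1 := MeasureTheory.norm_setIntegral_le_of_norm_le_const (μ := MeasureTheory.volume)
      (f := fun p : ℝ × ℝ => Real.exp (U l p.1 p.2)) (C := Real.exp Ms) hvol (by
        intro p hp
        rw [Real.norm_eq_abs, abs_of_pos (Real.exp_pos _)]
        exact Real.exp_le_exp.2 ((hmax p (subset_closure hp)).trans hM))
    exact (le_abs_self _).trans h1
  have := mul_le_mul_of_nonneg_left hint hl0.le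
  linarith
end
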